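/- arXiv:1611.05499 — 3 statements merged into one kernel-verified Lean document; each statement's English description precedes it below -/
import Mathlib

section
/- Let q be a prime power, n ≥ 1, and let x be an n×n matrix over F_q. Suppose Λ is a function assigning to each monic irreducible polynomial φ over F_q a partition Λ(φ), equal to the empty partition for all but finitely many φ, such that for every monic irreducible φ and every integer k ≥ 1 one has n - rank(φ(x)^k) = deg φ · ∑_i min(k, Λ(φ)_i) (the sum over the parts Λ(φ)_i of Λ(φ)). Then the number of n×n matrices y over F_q with xy = yx equals ∏_φ q^{deg φ · ∑_{k ≥ 1} (Λ(φ)'_k)²}, where Λ(φ)'_k = #{i : Λ(φ)_i ≥ k}. -/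
open Polynomial

theorem aux_hom {R M : Type*} [CommRing R] [AddCommGroup M] [Module R M] (a : R) :
    Nat.card ((R ⧸ Submodule.span R {a}) →ₗ[R] M) = Nat.card {m : M // a • m = 0} := by
  refine Nat.card_congr
    { toFun := fun f => ⟨f (Submodule.Quotient.mk 1), ?_⟩
      invFun := fun m => (Submodule.span R {a}).liftQ (LinearMap.toSpanSingleton R M m.1) ?_
      left_inv := ?_
      right_inv := ?_ }
  · rw [← map_smul, ← Submodule.Quotient.mk_smul, (Submodule.Quotient.mk_eq_zero _).2, map_zero]
    simp
  · rw [Submodule.span_singleton_le_iff_mem]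
    simpa using m.2
  · intro f
    apply Submodule.linearMap_qext
    ext
    simp
  · intro m
    apply Subtype.ext
    exact (Submodule.liftQ_apply _ _ _).trans (by simp)

theorem aux_end {R M : Type*} [CommRing R] [AddCommGroup M] [Module R M]
    {ι : Type*} [Fintype ι] (a : ι → R)
    (E : M ≃ₗ[R] DirectSum ι fun i => R ⧸ Submodule.span R {a i}) :
    Nat.card (M →ₗ[R] M) = ∏ i, Nat.card {m : M // a i • m = 0} := by
  classical
  have e1 := (E.trans (DirectSum.linearEquivFunOnFintype R ι fun i => R ⧸ Submodule.span R {a i}))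
  rw [Nat.card_congr (LinearEquiv.congrLeft M R e1).toEquiv]
  rw [← Nat.card_congr (LinearMap.lsum R (fun i => R ⧸ Submodule.span R {a i}) (M := M) R).toEquiv]
  rw [Nat.card_pi]
  simp_rw [aux_hom]

theorem aux_tor {R M : Type*} [CommRing R] [AddCommGroup M] [Module R M]
    {ι : Type*} [Fintype ι] (a : ι → R)
    (E : M ≃ₗ[R] DirectSum ι fun i => R ⧸ Submodule.span R {a i}) (b : R) :
    Nat.card {m : M // b • m = 0} =
      ∏ i, Nat.card {m : R ⧸ Submodule.span R {a i} // b • m = 0} := by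
  classical
  have e1 := (E.trans (DirectSum.linearEquivFunOnFintype R ι fun i => R ⧸ Submodule.span R {a i}))
  rw [← Nat.card_pi]
  refine Nat.card_congr ((e1.toEquiv.subtypeEquiv (q := fun v => ∀ i, b • v i = 0) ?_).trans
    (Equiv.subtypePiEquivPi (p := fun (i : ι) (m : R ⧸ Submodule.span R {a i}) => b • m = 0)))
  intro m
  rw [← e1.map_eq_zero_iff, map_smul, funext_iff]
  rfl

theorem aux_quot {F : Type} [Field F] [Fintype F] (f : F[X]) (hf : f ≠ 0):
    Nat.card (F[X] ⧸ Submodule.span F[X] {f}) = Fintype.card F ^ f.natDegree := by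
  have : Module.Finite F (F[X] ⧸ Ideal.span {f}) := 
    (AdjoinRoot.powerBasis hf).finite
  have h := Module.natCard_eq_pow_finrank (K := F) (V := F[X] ⧸ Ideal.span {f})
  rw [finrank_quotient_span_eq_natDegree, Nat.card_eq_fintype_card (α := F)] at h
  exact h

theorem aux_same {F : Type} [Field F] [Fintype F] (f : F[X]) (hf : f ≠ 0) (k e : ℕ) :
    Nat.card {m : F[X] ⧸ Submodule.span F[X] {f ^ e} // f ^ k • m = 0} =
      Fintype.card F ^ (f.natDegree * min k e) := by
  rcases le_total e k with h | h
  · rw [min_eq_right h, mul_comm, ← natDegree_pow, ← aux_quot _ (pow_ne_zero _ hf)]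
    refine Nat.card_congr (Equiv.subtypeUnivEquiv ?_)
    intro m
    obtain ⟨r, rfl⟩ := Submodule.Quotient.mk_surjective _ m
    rw [← Submodule.Quotient.mk_smul, Submodule.Quotient.mk_eq_zero,
      Submodule.mem_span_singleton]
    exact ⟨f ^ (k - e) * r, by
      rw [smul_eq_mul, smul_eq_mul, ← pow_sub_mul_pow f h]; ring⟩
  · rw [min_eq_left h, mul_comm, ← natDegree_pow, ← aux_quot _ (pow_ne_zero _ hf)]
    let g : F[X] →ₗ[F[X]] F[X] ⧸ Submodule.span F[X] {f ^ e} :=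
      (Submodule.mkQ _).comp (LinearMap.toSpanSingleton F[X] F[X] (f ^ (e - k)))
    have hk : LinearMap.ker g = Submodule.span F[X] {f ^ k} := by
      ext r
      simp only [g, LinearMap.mem_ker, LinearMap.comp_apply, Submodule.mkQ_apply,
        Submodule.Quotient.mk_eq_zero, LinearMap.toSpanSingleton_apply,
        Submodule.mem_span_singleton, smul_eq_mul]
      constructor
      · rintro ⟨s, hs⟩
        refine ⟨s, mul_right_cancel₀ (pow_ne_zero (e - k) hf) ?_⟩
        rw [← hs, ← pow_sub_mul_pow f h]; ring
      · rintro ⟨s, rfl⟩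
        exact ⟨s, by rw [← pow_sub_mul_pow f h]; ring⟩
    rw [← hk, Nat.card_congr g.quotKerEquivRange.toEquiv]
    refine Nat.card_congr (Equiv.subtypeEquivRight ?_)
    intro m
    obtain ⟨r, rfl⟩ := Submodule.Quotient.mk_surjective _ m
    rw [← Submodule.Quotient.mk_smul, Submodule.Quotient.mk_eq_zero,
      Submodule.mem_span_singleton]
    constructor
    · rintro ⟨s, hs⟩
      refine ⟨s, ?_⟩
      simp only [g, LinearMap.comp_apply, Submodule.mkQ_apply, LinearMap.toSpanSingleton_apply]
      congr 1
      apply mul_left_cancel₀ (pow_ne_zero k hf)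
      simp only [smul_eq_mul] at hs ⊢
      rw [← hs, ← pow_sub_mul_pow f h]; ring
    · rintro ⟨s, hs⟩
      simp only [g, LinearMap.comp_apply, Submodule.mkQ_apply,
        LinearMap.toSpanSingleton_apply] at hs
      rw [← Submodule.mem_span_singleton, ← Submodule.Quotient.mk_eq_zero,
        Submodule.Quotient.mk_smul, ← hs, ← Submodule.Quotient.mk_smul,
        Submodule.Quotient.mk_eq_zero, Submodule.mem_span_singleton]
      exact ⟨s, by simp only [smul_eq_mul]; rw [← pow_sub_mul_pow f h]; ring⟩

theorem aux_diff {R : Type*} [CommRing R] (a b : R) (h : IsCoprime a b) :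
    Nat.card {m : R ⧸ Submodule.span R {b} // a • m = 0} = 1 := by
  rw [Nat.card_eq_one_iff_unique]
  refine ⟨⟨?_⟩, ⟨⟨0, smul_zero _⟩⟩⟩
  have key : ∀ m : R ⧸ Submodule.span R {b}, a • m = 0 → m = 0 := by
    intro m hm
    obtain ⟨u, v, huv⟩ := h
    have hb : b • m = 0 := by
      obtain ⟨r, rfl⟩ := Submodule.Quotient.mk_surjective _ m
      rw [← Submodule.Quotient.mk_smul, Submodule.Quotient.mk_eq_zero,
        Submodule.mem_span_singleton]
      exact ⟨r, by simp [mul_comm]⟩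
    rw [← one_smul R m, ← huv, add_smul, mul_smul, mul_smul, hm, hb]; simp
  rintro ⟨m, hm⟩ ⟨m', hm'⟩
  ext
  simp [key m hm, key m' hm']

theorem aux_cent {F : Type} [Field F] {n : ℕ} (x : Matrix (Fin n) (Fin n) F) :
    Nat.card {y : Matrix (Fin n) (Fin n) F // x * y = y * x} =
      Nat.card (Module.AEval' (Matrix.toLin' x) →ₗ[F[X]] Module.AEval' (Matrix.toLin' x)) := by
  have h : Nat.card {y : Matrix (Fin n) (Fin n) F // x * y = y * x} =
     Nat.card {y : (Fin n → F) →ₗ[F] (Fin n → F) // Matrix.toLin' x ∘ₗ y = y ∘ₗ Matrix.toLin' x} := by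
    refine Nat.card_congr (Matrix.toLin'.toEquiv.subtypeEquiv ?_)
    intro y
    rw [← Matrix.toLin'.injective.eq_iff, Matrix.toLin'_mul, Matrix.toLin'_mul]
    rfl
  rw [h]
  set f := Matrix.toLin' x
  refine Nat.card_congr
    { toFun := fun y => LinearMap.ofAEval f ((Module.AEval'.of f).toLinearMap ∘ₗ y.1) ?_
      invFun := fun g => ⟨(Module.AEval'.of f).symm.toLinearMap ∘ₗ (g.restrictScalars F) ∘ₗ
        (Module.AEval'.of f).toLinearMap, ?_⟩
      left_inv := ?_
      right_inv := ?_ }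
  · intro m
    have := LinearMap.congr_fun y.2 m
    simp only [LinearMap.comp_apply] at this
    simp only [LinearMap.comp_apply, LinearEquiv.coe_coe, Module.End.smul_def, ← this]
    rw [Module.AEval'.X_smul_of]
  · ext1 m
    ext1
    simp only [LinearMap.comp_apply, LinearEquiv.coe_coe, LinearMap.restrictScalars_apply]
    rw [← Module.AEval'.X_smul_of, map_smul, Module.AEval'.of_symm_X_smul]
  · intro y
    ext1
    rfl
  · intro g
    ext1
    rfl

theorem aux_ker {F : Type} [Field F] [Fintype F] {n : ℕ} (x : Matrix (Fin n) (Fin n) F)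
    (φ : F[X]) (k s : ℕ)
    (h : (n : ℤ) - Matrix.rank ((Polynomial.aeval x) φ ^ k) = s) :
    Nat.card {m : Module.AEval' (Matrix.toLin' x) // φ ^ k • m = 0} = Fintype.card F ^ s := by
  have e : aeval (Matrix.toLin' x) (φ ^ k) = Matrix.toLin' (aeval x φ ^ k) := by
    rw [← map_pow]
    exact (aeval_algHom_apply (Matrix.toLinAlgEquiv' (R := F) (n := Fin n)) x (φ ^ k))
  have h1 : Nat.card {m : Module.AEval' (Matrix.toLin' x) // φ ^ k • m = 0} =
      Nat.card (LinearMap.ker (Matrix.toLin' (aeval x φ ^ k))) := by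
    refine Nat.card_congr ((Module.AEval'.of (Matrix.toLin' x)).symm.toEquiv.subtypeEquiv ?_)
    intro m
    rw [LinearMap.mem_ker, ← e, ← (Module.AEval'.of (Matrix.toLin' x)).symm.map_eq_zero_iff]
    rfl
  rw [h1, Module.natCard_eq_pow_finrank (K := F), Nat.card_eq_fintype_card]
  congr 1
  have h2 := LinearMap.finrank_range_add_finrank_ker (Matrix.toLin' (aeval x φ ^ k))
  rw [Module.finrank_fin_fun] at h2
  rw [Matrix.rank] at h
  change (n : ℤ) - (Module.finrank F (LinearMap.range (Matrix.toLin' (aeval x φ ^ k))) : ℤ) = s at h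
  omega

theorem aux_sq (s : Multiset ℕ) (N : ℕ) (hN : s.sum ≤ N) :
    ∑ k ∈ Finset.range N, (Multiset.card (s.filter (fun p => k + 1 ≤ p))) ^ 2 =
      (s.map fun p => (s.map fun r => min p r).sum).sum := by
  have hle : ∀ p ∈ s, p ≤ N := fun p hp => (Multiset.le_sum_of_mem hp).trans hN
  have h1 : ∀ k, Multiset.card (s.filter (fun p => k + 1 ≤ p)) =
      (s.map fun p => if k + 1 ≤ p then 1 else 0).sum := by
    intro k
    rw [← Multiset.countP_eq_card_filter]
    induction s using Multiset.induction_on with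
    | empty => simp
    | cons a s ih => 
      rw [Multiset.countP_cons, Multiset.map_cons, Multiset.sum_cons, add_comm]
      rw [ih]
      · simp at hN; omega
      · intro p hp; exact hle p (Multiset.mem_cons_of_mem hp)
  have h2 : ∀ p ∈ s, ∀ r, min p r = ∑ k ∈ Finset.range N,
      (if k + 1 ≤ p then 1 else 0) * (if k + 1 ≤ r then 1 else 0) := by
    intro p hp r
    have : ∀ k, ((if k + 1 ≤ p then 1 else 0) * (if k + 1 ≤ r then 1 else 0) : ℕ) =
      if k < min p r then 1 else 0 := by intro k; split_ifs <;> omega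
    simp_rw [this]
    rw [← Finset.sum_filter, Finset.sum_const, smul_eq_mul, mul_one]
    have : (Finset.range N).filter (fun k => k < min p r) = Finset.range (min p r) := by
      ext k; simp; have := hle p hp; omega
    rw [this, Finset.card_range]
  have h3 : ∀ p ∈ s, (s.map fun r => min p r).sum = ∑ k ∈ Finset.range N,
      (if k + 1 ≤ p then 1 else 0) * (s.map fun r => if k + 1 ≤ r then 1 else 0).sum := by
    intro p hp
    simp_rw [h2 p hp, ← Multiset.sum_map_mul_left]
    exact Multiset.sum_map_sum_map s (Finset.range N).val
  rw [Multiset.map_congr rfl h3]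
  refine Eq.trans ?_ (Multiset.sum_map_sum_map s (Finset.range N).val).symm
  change _ = ∑ k ∈ Finset.range N, _
  refine Finset.sum_congr rfl fun k _ => ?_
  rw [h1, Multiset.sum_map_mul_right, sq]

theorem aux_comb {ι : Type*} (s : Multiset ℕ) (T : Finset ι) (e : ι → ℕ)
    (h : ∀ k, (s.map fun p => min k p).sum = ∑ i ∈ T, min k (e i)) :
    ∑ i ∈ T, (s.map fun p => min (e i) p).sum =
      ∑ k ∈ Finset.range s.sum, (Multiset.card (s.filter (fun p => k + 1 ≤ p))) ^ 2 := by
  rw [aux_sq s _ le_rfl]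
  simp_rw [h _]
  refine Eq.trans ?_ (Multiset.sum_map_sum_map s T.val).symm
  change _ = ∑ k ∈ T, _
  refine Finset.sum_congr rfl fun i _ => ?_
  rw [← h]
  simp_rw [min_comm]

theorem aux_decomp {F : Type} [Field F] {M : Type} [AddCommGroup M] [Module F[X] M]
    [Module.Finite F[X] M] (hM : Module.IsTorsion F[X] M) :
    ∃ (ι : Type) (_ : Fintype ι) (p : ι → {f : F[X] // f.Monic ∧ Irreducible f}) (e : ι → ℕ),
      Nonempty (M ≃ₗ[F[X]] DirectSum ι fun i => F[X] ⧸ Submodule.span F[X] {(p i).1 ^ e i}) := by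
  classical
  obtain ⟨ι, _, p, hp, e, ⟨E⟩⟩ := Module.equiv_directSum_of_isTorsion hM
  refine ⟨ι, inferInstance, fun i => ⟨normalize (p i), monic_normalize (hp i).ne_zero,
    (normalize_associated (p i)).symm.irreducible (hp i)⟩, e, ⟨LinearEquiv.trans E
    (DFinsupp.mapRange.linearEquiv (R := F[X]) fun i => Submodule.quotEquivOfEq _ _ ?_)⟩⟩
  exact Ideal.span_singleton_eq_span_singleton.2 ((normalize_associated (p i)).symm.pow_pow)

theorem card_centralizer_matrix
    (q : ℕ) (hq : ∃ p m : ℕ, p.Prime ∧ 0 < m ∧ q = p ^ m)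
    (F : Type) [Field F] [Fintype F] (hF : Fintype.card F = q)
    (n : ℕ) (hn : 1 ≤ n) (x : Matrix (Fin n) (Fin n) F)
    (Λ : {f : Polynomial F // f.Monic ∧ Irreducible f} → Multiset ℕ)
    (hpos : ∀ φ, ∀ p ∈ Λ φ, 0 < p)
    (hfin : {φ : {f : Polynomial F // f.Monic ∧ Irreducible f} | Λ φ ≠ 0}.Finite)
    (hrank : ∀ φ : {f : Polynomial F // f.Monic ∧ Irreducible f}, ∀ k : ℕ, 1 ≤ k →
      (n : ℤ) - Matrix.rank ((Polynomial.aeval x) φ.val ^ k) =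
        (φ.val.natDegree : ℤ) * ((Λ φ).map (fun p => min k p)).sum) :
    Nat.card {y : Matrix (Fin n) (Fin n) F // x * y = y * x} =
      ∏ᶠ φ : {f : Polynomial F // f.Monic ∧ Irreducible f},
        q ^ (φ.val.natDegree *
          ∑ k ∈ Finset.range (Λ φ).sum,
            (Multiset.card ((Λ φ).filter (fun p => k + 1 ≤ p))) ^ 2) := by
  classical
  have hker : ∀ (φ : {f : F[X] // f.Monic ∧ Irreducible f}) (k : ℕ),
      Nat.card {m : Module.AEval' (Matrix.toLin' x) // φ.1 ^ k • m = 0} =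
        q ^ (φ.1.natDegree * ((Λ φ).map (fun p => min k p)).sum) := by
    intro φ k
    rw [← hF]
    apply aux_ker
    rcases Nat.eq_zero_or_pos k with rfl | hk
    · simp [Matrix.rank_one]
    · rw [hrank φ k hk]; push_cast; rfl
  have hq1 : 1 < q := hF ▸ Fintype.one_lt_card
  obtain ⟨ι, _, p, e, ⟨E⟩⟩ := aux_decomp
    (Module.AEval.isTorsion_of_finiteDimensional F (Fin n → F) (Matrix.toLin' x))
  have hsum : ∀ (φ : {f : F[X] // f.Monic ∧ Irreducible f}) (k : ℕ),
      ((Λ φ).map (fun p => min k p)).sum =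
        ∑ i ∈ Finset.univ.filter (fun i => p i = φ), min k (e i) := by
    intro φ k
    have h := hker φ k
    rw [aux_tor _ E] at h
    have h2 : ∀ i, Nat.card {m : F[X] ⧸ Submodule.span F[X] {(p i).1 ^ e i} // φ.1 ^ k • m = 0} =
        q ^ (if p i = φ then φ.1.natDegree * min k (e i) else 0) := by
      intro i
      split_ifs with hi
      · rw [hi, aux_same _ φ.2.1.ne_zero, hF]
      · rw [pow_zero]
        apply aux_diff
        apply IsCoprime.pow
        rw [φ.2.2.coprime_iff_not_dvd]
        intro hd
        exact hi (Subtype.ext (eq_of_monic_of_associated φ.2.1 (p i).2.1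
          (φ.2.2.associated_of_dvd (p i).2.2 hd)).symm)
    simp_rw [h2] at h
    rw [Finset.prod_pow_eq_pow_sum, ← Finset.sum_filter, ← Finset.mul_sum] at h
    have h3 := Nat.pow_right_injective hq1 h
    exact (Nat.eq_of_mul_eq_mul_left φ.2.2.natDegree_pos h3).symm
  rw [aux_cent, aux_end _ E]
  simp_rw [hker]
  rw [finprod_eq_prod_of_mulSupport_subset (s := hfin.toFinset ∪ Finset.univ.image p)]
  · rw [← Finset.prod_fiberwise_of_maps_to (g := p) (t := hfin.toFinset ∪ Finset.univ.image p)]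
    · refine Finset.prod_congr rfl fun φ _ => ?_
      rw [← aux_comb (Λ φ) _ e (hsum φ), Finset.mul_sum, ← Finset.prod_pow_eq_pow_sum]
      refine Finset.prod_congr rfl fun i hi => ?_
      rw [(Finset.mem_filter.1 hi).2]
    · intro i _
      simp
  · intro φ hφ
    rw [Finset.coe_union]
    left
    simp only [Set.Finite.coe_toFinset, Set.mem_ofPred_eq]
    intro h0
    apply hφ
    simp [h0]
end

section
/- Let q be a prime power, n ≥ 1, λ a partition of n, and let x be an n×n matrix over F_q that is nilpotent of Jordan type λ. Then the number of nilpotent n×n matrices y over F_q with xy = yx equals q^{∑_{k ≥ 1} (λ'_k)² − ∑_{i ≥ 1} m_i(λ)}. -/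
universe u
/-- counting points of a surjective additive map, translated -/
lemma card_preimage_shift {L Y : Type*} [AddCommGroup L] [AddCommGroup Y] [Finite L] 
    (g : L →+ Y) (hg : Function.Surjective g) (y0 : Y) (P : Y → Prop) :
    Nat.card {l // P (g l + y0)} = Nat.card {y // P y} * Nat.card g.ker := by
  classical
  have : Finite Y := Finite.of_surjective g hg
  choose s hs using hg
  rw [← Nat.card_prod]
  refine Nat.card_congr ⟨fun l => ⟨⟨g l.1 + y0, l.2⟩, ⟨l.1 - s (g l.1), by simp [AddMonoidHom.mem_ker, hs]⟩⟩,
    fun p => ⟨s (p.1.1 - y0) + p.2.1, by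
      have := p.2.2; rw [AddMonoidHom.mem_ker] at this
      simp [hs, this, p.1.2]⟩, ?_, ?_⟩
  · rintro ⟨l, hl⟩; simp
  · rintro ⟨⟨y, hy⟩, ⟨k, hk⟩⟩
    rw [AddMonoidHom.mem_ker] at hk
    simp [hs, hk]

/-- endomorphisms stabilizing all members of a family of subspaces -/
def stabEnd {F V : Type*} [Field F] [AddCommGroup V] [Module F V] (S : Set (Submodule F V)) :
    Submodule F (Module.End F V) where
  carrier := {T | ∀ U ∈ S, ∀ u ∈ U, T u ∈ U}
  add_mem' := fun ha hb U hU u hu => U.add_mem (ha U hU u hu) (hb U hU u hu)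
  zero_mem' := fun U _ _ _ => U.zero_mem
  smul_mem' := fun c _ ha U hU u hu => U.smul_mem c (ha U hU u hu)

section
variable {F V : Type*} [Field F] [AddCommGroup V] [Module F V]

/-- span of `v, T v, ..., T^(j-1) v` -/
def krylov (T : Module.End F V) (v : V) (j : ℕ) : Submodule F V :=
  Submodule.span F (Set.range fun i : Fin j => (T ^ (i : ℕ)) v)

lemma krylov_le {T : Module.End F V} {v : V} {j : ℕ} {U : Submodule F V}
    (h : ∀ i < j, (T ^ i) v ∈ U) : krylov T v j ≤ U := by
  rw [krylov, Submodule.span_le]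
  rintro _ ⟨i, rfl⟩
  exact h i i.2

lemma pow_mem_krylov (T : Module.End F V) (v : V) {i j : ℕ} (h : i < j) :
    (T ^ i) v ∈ krylov T v j :=
  Submodule.subset_span ⟨⟨i, h⟩, rfl⟩

lemma krylov_congr {T T' : Module.End F V} {v : V} {j : ℕ}
    (h : ∀ i < j, (T ^ i) v = (T' ^ i) v) : krylov T v j = krylov T' v j := by
  apply le_antisymm
  · exact krylov_le fun i hi => h i hi ▸ pow_mem_krylov T' v hi
  · exact krylov_le fun i hi => h i hi ▸ pow_mem_krylov T v hi

lemma krylov_stab {T : Module.End F V} {v : V} {j : ℕ}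
    (h : (T ^ j) v ∈ krylov T v j) : ∀ w ∈ krylov T v j, T w ∈ krylov T v j := by
  intro w hw
  have : krylov T v j ≤ (krylov T v j).comap T := by
    apply krylov_le
    intro i hi
    rw [Submodule.mem_comap, ← Module.End.mul_apply, ← pow_succ']
    by_cases hi' : i + 1 < j
    · exact pow_mem_krylov T v hi'
    · obtain rfl : i + 1 = j := by omega
      exact h
  exact this hw

lemma exists_krylov [FiniteDimensional F V] (T : Module.End F V) (v : V) :
    ∃ j, (T ^ j) v ∈ krylov T v j := by
  by_contra! h
  have hlt : ∀ j, krylov T v j < krylov T v (j+1) := by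
    intro j
    refine lt_of_le_of_ne (krylov_le fun i hi => pow_mem_krylov T v (by omega)) ?_
    intro he
    exact h j (he ▸ pow_mem_krylov T v (Nat.lt_succ_self j))
  exact not_strictMono_of_wellFoundedGT _ (strictMono_nat_of_lt_succ hlt)

open Classical in
/-- the degree of the local minimal polynomial -/
noncomputable def kdeg [FiniteDimensional F V] (T : Module.End F V) (v : V) : ℕ :=
  Nat.find (exists_krylov T v)

/-- the truncated orbit -/
noncomputable def kdata [FiniteDimensional F V] (v : V) (T : Module.End F V) : ℕ × (ℕ → V) :=
  (kdeg T v, fun i => if i < kdeg T v then (T ^ i) v else 0)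

lemma kdeg_mem [FiniteDimensional F V] (T : Module.End F V) (v : V) :
    (T ^ kdeg T v) v ∈ krylov T v (kdeg T v) := by
  classical
  exact Nat.find_spec (exists_krylov T v)

lemma kdeg_min [FiniteDimensional F V] (T : Module.End F V) (v : V) {j : ℕ} (h : j < kdeg T v) :
    (T ^ j) v ∉ krylov T v j := by
  classical
  exact Nat.find_min (exists_krylov T v) h

lemma kdeg_pos [FiniteDimensional F V] (T : Module.End F V) {v : V} (hv : v ≠ 0) :
    0 < kdeg T v := by
  rcases Nat.eq_zero_or_pos (kdeg T v) with h | h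
  · have := kdeg_mem T v
    rw [h] at this
    simp [krylov] at this
    exact absurd this hv
  · exact h

lemma kdeg_eq [FiniteDimensional F V] {T : Module.End F V} {v : V} {j : ℕ}
    (h : (T ^ j) v ∈ krylov T v j) (h' : ∀ i < j, (T ^ i) v ∉ krylov T v i) :
    kdeg T v = j := by
  classical
  exact (Nat.find_eq_iff _).2 ⟨h, h'⟩

lemma kdata_eq_iff [FiniteDimensional F V] {T0 T : Module.End F V} {v : V} {m : ℕ}
    (hm : kdeg T0 v = m + 1) :
    kdata v T = kdata v T0 ↔ (∀ w ∈ krylov T0 v m, (T - T0) w = 0) ∧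
      (T - T0) ((T0 ^ m) v) ∈ krylov T0 v (m + 1) := by
  have hT0 := kdeg_mem T0 v
  rw [hm] at hT0
  constructor
  · intro h
    have h1 : kdeg T v = m + 1 := by rw [← hm]; exact congrArg Prod.fst h
    have h2 : ∀ i < m + 1, (T ^ i) v = (T0 ^ i) v := by
      intro i hi
      have := congrFun (congrArg Prod.snd h) i
      simp only [kdata, h1, hm] at this
      rwa [if_pos hi, if_pos hi] at this
    constructor
    · have : krylov T0 v m ≤ LinearMap.ker (T - T0) := by
        apply krylov_le
        intro i hi
        rw [LinearMap.mem_ker, LinearMap.sub_apply]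
        conv_lhs => enter [1]; rw [← h2 i (by omega)]
        rw [← Module.End.mul_apply, ← Module.End.mul_apply, ← pow_succ', ← pow_succ',
          h2 (i+1) (by omega), sub_self]
      exact fun w hw => this hw
    · rw [LinearMap.sub_apply]
      refine Submodule.sub_mem _ ?_ ?_
      · rw [← h2 m (by omega), ← Module.End.mul_apply, ← pow_succ', ← krylov_congr h2, ← h1]
        exact kdeg_mem T v
      · rw [← Module.End.mul_apply, ← pow_succ']
        exact hT0
  · rintro ⟨ha, hb⟩
    have h2 : ∀ i < m + 1, (T ^ i) v = (T0 ^ i) v := by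
      intro i
      induction i with
      | zero => simp
      | succ i ih =>
        intro hi
        rw [pow_succ', Module.End.mul_apply, ih (by omega), pow_succ', Module.End.mul_apply]
        have := ha _ (pow_mem_krylov T0 v (show i < m by omega))
        rwa [LinearMap.sub_apply, sub_eq_zero] at this
    have h1 : kdeg T v = m + 1 := by
      apply kdeg_eq
      · rw [krylov_congr h2, pow_succ', Module.End.mul_apply, h2 m (by omega)]
        have : T ((T0 ^ m) v) = (T - T0) ((T0 ^ m) v) + (T0 ^ (m+1)) v := by
          rw [pow_succ', Module.End.mul_apply]; simp
        rw [this]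
        exact Submodule.add_mem _ hb hT0
      · intro i hi
        rw [krylov_congr (fun j hj => h2 j (by omega)), h2 i hi]
        exact kdeg_min T0 v (by omega)
    ext i
    · simp [kdata, h1, hm]
    · simp only [kdata, h1, hm]
      split_ifs with hi
      · exact h2 i hi
      · rfl

lemma nil_iff [FiniteDimensional F V] {T : Module.End F V} {v : V} {m : ℕ}
    (W : Submodule F V) (hWdef : W = krylov T v (m+1)) (hW : W ≤ W.comap T) :
    IsNilpotent T ↔ T ((T ^ m) v) = 0 ∧ IsNilpotent (W.mapQ W T hW) := by
  have hpow : ∀ N w, ((W.mapQ W T hW) ^ N) (W.mkQ w) = W.mkQ ((T ^ N) w) := by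
    intro N
    induction N with
    | zero => simp
    | succ N ih =>
      intro w
      rw [pow_succ, Module.End.mul_apply, pow_succ, Module.End.mul_apply, ← ih]
      simp
  constructor
  · rintro ⟨N, hN⟩
    constructor
    · have hW' : ∀ w ∈ W, T w ∈ W := fun w hw => hW hw
      have hco : ∀ k (w : W), (((T.restrict hW') ^ k) w : V) = (T ^ k) w := by
        intro k w
        rw [Module.End.pow_restrict k]
        rfl
      have h1 := LinearMap.aeval_self_charpoly (T.restrict hW')
      rw [(LinearMap.charpoly_eq_X_pow_iff (T.restrict hW')).2 (fun w => ⟨N, by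
        apply Subtype.ext
        rw [hco, hN]; rfl⟩)] at h1
      rw [map_pow, Polynomial.aeval_X] at h1
      have hfr : Module.finrank F W ≤ m + 1 := by
        rw [hWdef, krylov]
        exact (finrank_range_le_card _).trans (by simp)
      have hv : v ∈ W := by
        rw [hWdef]
        simpa using pow_mem_krylov T v (Nat.succ_pos m)
      have h2 := hco (m+1) ⟨v, hv⟩
      rw [pow_eq_zero_of_le hfr h1] at h2
      rw [← Module.End.mul_apply, ← pow_succ']
      exact h2.symm
    · refine ⟨N, ?_⟩
      ext w
      simp only [LinearMap.comp_apply]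
      rw [hpow, hN]; simp
  · rintro ⟨h0, N, hN⟩
    have hz : ∀ w ∈ W, (T ^ (m+1)) w = 0 := by
      have : W ≤ LinearMap.ker (T ^ (m+1)) := by
        rw [hWdef]
        apply krylov_le
        intro i hi
        rw [LinearMap.mem_ker, ← Module.End.mul_apply, ← pow_add, add_comm, pow_add,
          Module.End.mul_apply, pow_succ', Module.End.mul_apply, h0, map_zero]
      exact fun w hw => this hw
    refine ⟨(m+1) + N, ?_⟩
    ext w
    rw [pow_add, Module.End.mul_apply]
    apply hz
    have := hpow N w
    rw [hN] at this
    simpa using this.symm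
end

lemma fiber_sum {α β : Type*} [Finite α] (f : α → β) (P : α → Prop) (c : ℕ)
    (h : ∀ a0, Nat.card {a // f a = f a0 ∧ P a} * c = Nat.card {a // f a = f a0}) :
    Nat.card {a // P a} * c = Nat.card α := by
  classical
  have := Fintype.ofFinite α
  have e1 : Nat.card {a // P a} = ∑ b ∈ Finset.univ.image f, Nat.card {a // f a = b ∧ P a} := by
    simp only [Nat.card_eq_fintype_card, Fintype.card_subtype]
    rw [Finset.card_eq_sum_card_fiberwise (f := f) (t := Finset.univ.image f)
      (fun a _ => by simp)]
    refine Finset.sum_congr rfl fun b _ => ?_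
    rw [Finset.filter_filter]
    congr 1
    ext a
    simp [and_comm]
  have e2 : Nat.card α = ∑ b ∈ Finset.univ.image f, Nat.card {a // f a = b} := by
    simp only [Nat.card_eq_fintype_card, Fintype.card_subtype]
    rw [← Finset.card_univ]
    exact Finset.card_eq_sum_card_image f Finset.univ
  rw [e1, e2, Finset.sum_mul]
  refine Finset.sum_congr rfl fun b hb => ?_
  obtain ⟨a0, -, rfl⟩ := Finset.mem_image.1 hb
  exact h a0

section
set_option linter.unusedSectionVars false
set_option linter.unusedVariables false
variable {F V : Type*} [Field F] [Finite F] [AddCommGroup V] [Module F V] [FiniteDimensional F V]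

lemma pow_mem_stab {S : Set (Submodule F V)} {T : Module.End F V} (hT : T ∈ stabEnd S)
    {U : Submodule F V} (hU : U ∈ S) {v : V} (hv : v ∈ U) (i : ℕ) : (T ^ i) v ∈ U := by
  induction i with
  | zero => simpa
  | succ i ih =>
    rw [pow_succ', Module.End.mul_apply]
    exact hT U hU _ ih

lemma exists_good_vector [Nontrivial V] (S : Set (Submodule F V)) (hS : IsChain (· ≤ ·) S) :
    ∃ v : V, v ≠ 0 ∧ ∀ U ∈ S, U = ⊥ ∨ v ∈ U := by
  by_cases h : ∃ U ∈ S, U ≠ ⊥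
  · obtain ⟨U1, ⟨hU1, hne⟩, hmin⟩ := WellFounded.has_min (wellFounded_lt (α := Submodule F V))
      {U | U ∈ S ∧ U ≠ ⊥} (by obtain ⟨U, h1, h2⟩ := h; exact ⟨U, h1, h2⟩)
    obtain ⟨v, hv, hv0⟩ := Submodule.exists_mem_ne_zero_of_ne_bot hne
    refine ⟨v, hv0, fun U hU => ?_⟩
    by_cases hb : U = ⊥
    · exact Or.inl hb
    · right
      rcases hS.total hU1 hU with h' | h'
      · exact h' hv
      · rcases h'.eq_or_lt with h'' | h''
        · rw [h'']; exact hv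
        · exact absurd h'' (hmin U ⟨hU, hb⟩)
  · push Not at h
    obtain ⟨v, hv⟩ := exists_ne (0 : V)
    exact ⟨v, hv, fun U hU => Or.inl (h U hU)⟩

/-- the difference space of a fibre -/
def fibL (S : Set (Submodule F V)) (K W : Submodule F V) (e : V) :
    Submodule F (Module.End F V) where
  carrier := {T | T ∈ stabEnd S ∧ (∀ w ∈ K, T w = 0) ∧ T e ∈ W}
  add_mem' := fun ha hb => ⟨Submodule.add_mem _ ha.1 hb.1,
    fun w hw => by simp [ha.2.1 w hw, hb.2.1 w hw], W.add_mem ha.2.2 hb.2.2⟩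
  zero_mem' := ⟨Submodule.zero_mem _, fun w _ => rfl, W.zero_mem⟩
  smul_mem' := fun c _ ha => ⟨Submodule.smul_mem _ c ha.1,
    fun w hw => by simp [ha.2.1 w hw], W.smul_mem c ha.2.2⟩

/-- the induced family of subspaces on a quotient -/
def quotFam (S : Set (Submodule F V)) (W : Submodule F V) : Set (Submodule F (V ⧸ W)) :=
  (fun U => U.map W.mkQ) '' S

lemma mapQ_mem_stab {S : Set (Submodule F V)} {W : Submodule F V} {T : Module.End F V}
    (hT : T ∈ stabEnd S) (hW : W ≤ W.comap T) : W.mapQ W T hW ∈ stabEnd (quotFam S W) := by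
  rintro _ ⟨U, hU, rfl⟩ _ ⟨u, hu, rfl⟩
  exact ⟨T u, hT U hU u hu, by simp⟩

lemma fib_count (S : Set (Submodule F V)) (v : V) (hv : v ≠ 0)
    (hvS : ∀ U ∈ S, U = ⊥ ∨ v ∈ U) (T0 : stabEnd S) (m : ℕ) (hm : kdeg T0.1 v = m + 1)
    (W : Submodule F V) (hWdef : W = krylov T0.1 v (m+1))
    (ih : Nat.card {T : stabEnd (quotFam S W) // IsNilpotent T.1} * Nat.card (V ⧸ W) =
      Nat.card (stabEnd (quotFam S W))) :
    Nat.card {T : stabEnd S // kdata v T.1 = kdata v T0.1 ∧ IsNilpotent T.1} * Nat.card V =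
      Nat.card {T : stabEnd S // kdata v T.1 = kdata v T0.1} := by
  have hVfin : Finite V := Module.finite_of_finite F
  set K := krylov T0.1 v m with hK
  set e := (T0.1 ^ m) v with he
  have hEndfin : Finite (Module.End F V) := Module.finite_of_finite F
  have heK : e ∉ K := kdeg_min T0.1 v (by omega)
  have hWU : ∀ U ∈ S, U = ⊥ ∨ W ≤ U := by
    intro U hU
    rcases hvS U hU with h | h
    · exact Or.inl h
    · right
      rw [hWdef]
      exact krylov_le fun i _ => pow_mem_stab T0.2 hU h i
  have hKW : K ≤ W := by
    rw [hWdef]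
    exact krylov_le fun i hi => pow_mem_krylov _ v (by omega)
  have heW : e ∈ W := by rw [hWdef]; exact pow_mem_krylov _ v (by omega)
  have hWle : ∀ P : Submodule F V, K ≤ P → e ∈ P → W ≤ P := by
    intro P h1 h2
    rw [hWdef]
    refine krylov_le fun i hi => ?_
    by_cases h : i < m
    · exact h1 (pow_mem_krylov _ v h)
    · obtain rfl : i = m := by omega
      exact h2
  have hT0W : W ≤ W.comap T0.1 := by
    rw [hWdef]
    exact krylov_stab (by rw [← hm]; exact kdeg_mem _ v)
  have hLW : ∀ l ∈ fibL S K W e, W ≤ W.comap l := by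
    intro l hl
    refine hWle _ (fun w hw => ?_) hl.2.2
    rw [Submodule.mem_comap, hl.2.1 w hw]; exact W.zero_mem
  let g : fibL S K W e →+ W × stabEnd (quotFam S W) :=
    { toFun := fun l => (⟨l.1 e, l.2.2.2⟩, ⟨W.mapQ W l.1 (hLW l.1 l.2), mapQ_mem_stab l.2.1 _⟩)
      map_zero' := by
        refine Prod.ext (Subtype.ext ?_) (Subtype.ext ?_)
        · rfl
        · ext w; rfl
      map_add' := by
        intro a b
        refine Prod.ext (Subtype.ext ?_) (Subtype.ext ?_)
        · rfl
        · ext w; rfl }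
  have hg : Function.Surjective g := by
    rintro ⟨w, D⟩
    obtain ⟨φ, hφe, hφK⟩ : ∃ φ : V →ₗ[F] F, φ e = 1 ∧ ∀ z ∈ K, φ z = 0 := by
      obtain ⟨φ, h1, h2⟩ := Submodule.exists_le_ker_of_notMem heK
      refine ⟨(φ e)⁻¹ • φ, by simp [h1], fun z hz => by
        have := h2 hz
        rw [LinearMap.mem_ker] at this
        simp [this]⟩
    obtain ⟨s, hs⟩ := LinearMap.exists_rightInverse_of_surjective W.mkQ (W.range_mkQ)
    have hs' : ∀ z, W.mkQ (s z) = z := fun z => LinearMap.congr_fun hs z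
    let l : Module.End F V := φ.smulRight w.1 + s ∘ₗ D.1 ∘ₗ W.mkQ
    have hl : ∀ z, l z = φ z • w.1 + s (D.1 (W.mkQ z)) := fun z => rfl
    have h0 : ∀ z ∈ W, W.mkQ z = 0 := fun z hz => by simpa using hz
    have hle : l e = w.1 := by rw [hl, hφe, h0 e heW]; simp
    have hmem : l ∈ fibL S K W e := by
      refine ⟨?_, ?_, ?_⟩
      · intro U hU u hu
        rcases hWU U hU with rfl | h
        · rw [Submodule.mem_bot] at hu
          rw [hu, map_zero]; exact Submodule.zero_mem _
        · rw [hl]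
          refine U.add_mem (U.smul_mem _ (h w.2)) ?_
          obtain ⟨u', hu', h2⟩ := D.2 (U.map W.mkQ) ⟨U, hU, rfl⟩ (W.mkQ u) ⟨u, hu, rfl⟩
          rw [← h2]
          have h3 : s (W.mkQ u') - u' ∈ W := by
            have h4 : W.mkQ (s (W.mkQ u') - u') = 0 := by rw [map_sub, hs', sub_self]
            simpa only [Submodule.mkQ_apply, Submodule.Quotient.mk_eq_zero] using h4
          have := U.add_mem (h h3) hu'
          simpa using this
      · intro z hz
        rw [hl, hφK z hz, h0 z (hKW hz)]; simp
      · rw [hle]; exact w.2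
    refine ⟨⟨l, hmem⟩, Prod.ext (Subtype.ext hle) (Subtype.ext ?_)⟩
    ext z
    change W.mkQ (l z) = D.1 (W.mkQ z)
    rw [hl, map_add, hs', map_smul, h0 w.1 w.2]; simp
  let y0 : W × stabEnd (quotFam S W) :=
    (⟨T0.1 e, hT0W heW⟩, ⟨W.mapQ W T0.1 hT0W, mapQ_mem_stab T0.2 _⟩)
  let P : W × stabEnd (quotFam S W) → Prop := fun y => y.1 = 0 ∧ IsNilpotent y.2.1
  have hdat : ∀ T : Module.End F V, kdata v T = kdata v T0.1 → 
      krylov T v (m+1) = W ∧ (T ^ m) v = e := by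
    intro T h
    have h1 : kdeg T v = m + 1 := by rw [← hm]; exact congrArg Prod.fst h
    have h2 : ∀ i < m + 1, (T ^ i) v = (T0.1 ^ i) v := by
      intro i hi
      have := congrFun (congrArg Prod.snd h) i
      simp only [kdata, h1, hm] at this
      rwa [if_pos hi, if_pos hi] at this
    exact ⟨by rw [hWdef]; exact krylov_congr h2, h2 m (by omega)⟩
  have hP : ∀ l : fibL S K W e, P (g l + y0) ↔ IsNilpotent (l.1 + T0.1) := by
    intro l
    have hd : kdata v (l.1 + T0.1) = kdata v T0.1 := by
      rw [kdata_eq_iff hm]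
      simp only [add_sub_cancel_right]
      exact ⟨l.2.2.1, by rw [← hWdef]; exact l.2.2.2⟩
    obtain ⟨h1, h2⟩ := hdat _ hd
    have hst : W ≤ W.comap (l.1 + T0.1) := fun w hw => W.add_mem (hLW l.1 l.2 hw) (hT0W hw)
    rw [nil_iff W h1.symm hst, h2]
    have : W.mapQ W (l.1 + T0.1) hst = (g l + y0).2.1 := by ext z; rfl
    rw [this]
    exact and_congr_left fun _ => Subtype.ext_iff
  have E1 : Nat.card {T : stabEnd S // kdata v T.1 = kdata v T0.1 ∧ IsNilpotent T.1} =
      Nat.card {l // P (g l + y0)} := by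
    refine Nat.card_congr ⟨fun T => ⟨⟨T.1.1 - T0.1, Submodule.sub_mem _ T.1.2 T0.2, 
      ((kdata_eq_iff hm).1 T.2.1).1, by rw [hWdef]; exact ((kdata_eq_iff hm).1 T.2.1).2⟩, ?_⟩, 
      fun l => ⟨⟨l.1.1 + T0.1, Submodule.add_mem _ l.1.2.1 T0.2⟩, ?_, (hP l.1).1 l.2⟩, ?_, ?_⟩
    · rw [hP]; simpa using T.2.2
    · rw [kdata_eq_iff hm]
      simp only [add_sub_cancel_right]
      exact ⟨l.1.2.2.1, by rw [← hWdef]; exact l.1.2.2.2⟩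
    · intro T; simp
    · intro l; simp
  have E2 : Nat.card {T : stabEnd S // kdata v T.1 = kdata v T0.1} =
      Nat.card {l : fibL S K W e // (fun _ => True) (g l + y0)} := by
    refine Nat.card_congr ⟨fun T => ⟨⟨T.1.1 - T0.1, Submodule.sub_mem _ T.1.2 T0.2, 
      ((kdata_eq_iff hm).1 T.2).1, by rw [hWdef]; exact ((kdata_eq_iff hm).1 T.2).2⟩, trivial⟩, 
      fun l => ⟨⟨l.1.1 + T0.1, Submodule.add_mem _ l.1.2.1 T0.2⟩, ?_⟩, ?_, ?_⟩
    · rw [kdata_eq_iff hm]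
      simp only [add_sub_cancel_right]
      exact ⟨l.1.2.2.1, by rw [← hWdef]; exact l.1.2.2.2⟩
    · intro T; simp
    · intro l; simp
  have E3 : Nat.card {y // P y} = Nat.card {T : stabEnd (quotFam S W) // IsNilpotent T.1} := by
    refine Nat.card_congr ⟨fun y => ⟨y.1.2, y.2.2⟩, fun T => ⟨(0, T.1), rfl, T.2⟩, ?_, ?_⟩
    · rintro ⟨⟨a, b⟩, h, h'⟩
      simp only at h
      subst h; rfl
    · intro T; rfl
  have E4 : Nat.card {y : W × stabEnd (quotFam S W) // (fun _ => True) y} = 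
      Nat.card W * Nat.card (stabEnd (quotFam S W)) := by
    rw [← Nat.card_prod]
    exact Nat.card_congr (Equiv.subtypeUnivEquiv fun _ => trivial)
  rw [E1, E2, card_preimage_shift g hg y0 P, card_preimage_shift g hg y0 (fun _ => True), E3, E4,
    ← ih, Submodule.card_eq_card_quotient_mul_card W]
  ring
end

theorem flag_count {F : Type*} [Field F] [Finite F] : ∀ (N : ℕ) (V : Type u) [AddCommGroup V]
    [Module F V] [FiniteDimensional F V] (_ : Module.finrank F V = N) (S : Set (Submodule F V))
    (_ : IsChain (· ≤ ·) S),
    Nat.card {T : stabEnd S // IsNilpotent T.1} * Nat.card V = Nat.card (stabEnd S) := by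
  intro N
  induction N using Nat.strong_induction_on with
  | _ N IH =>
  intro V _ _ _ hN S hS
  have hVfin : Finite V := Module.finite_of_finite F
  have hEndfin : Finite (Module.End F V) := Module.finite_of_finite F
  rcases subsingleton_or_nontrivial V with hV | hV
  · have h1 : Subsingleton (Module.End F V) := ⟨fun a b => by ext w; exact Subsingleton.elim _ _⟩
    have : Nat.card V = 1 := by simp
    rw [this, mul_one]
    refine Nat.card_congr (Equiv.subtypeUnivEquiv fun T => ⟨1, Subsingleton.elim _ _⟩)
  · obtain ⟨v, hv, hvS⟩ := exists_good_vector S hS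
    refine fiber_sum (fun T : stabEnd S => kdata v T.1) (fun T => IsNilpotent T.1) _ ?_
    intro T0
    obtain ⟨m, hm⟩ : ∃ m, kdeg T0.1 v = m + 1 := ⟨kdeg T0.1 v - 1, by
      have := kdeg_pos T0.1 hv; omega⟩
    refine fib_count S v hv hvS T0 m hm _ rfl ?_
    set W := krylov T0.1 v (m+1)
    have hvW : v ∈ W := by simpa using pow_mem_krylov T0.1 v (Nat.succ_pos m)
    have hWpos : 0 < Module.finrank F W := by
      have : Nontrivial W := ⟨⟨v, hvW⟩, 0, fun h => hv (congrArg Subtype.val h)⟩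
      exact Module.finrank_pos
    have hq := Submodule.finrank_quotient_add_finrank W
    refine IH (Module.finrank F (V ⧸ W)) (by omega) (V ⧸ W) rfl _ ?_
    rintro _ ⟨U, hU, rfl⟩ _ ⟨U', hU', rfl⟩ _
    rcases hS.total hU hU' with h | h
    · exact Or.inl (Submodule.map_mono h)
    · exact Or.inr (Submodule.map_mono h)
open Polynomial in
lemma card_ker_piece {F : Type*} [Field F] [Finite F] (k c : ℕ) :
    Nat.card {r : F[X] ⧸ Submodule.span F[X] {(X : F[X]) ^ k} // (X : F[X]) ^ c • r = 0} =
      Nat.card F ^ (min c k) := by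
  let B := F[X] ⧸ Submodule.span F[X] {(X : F[X]) ^ k}
  have hB : ∀ j, Module.finrank F (F[X] ⧸ Submodule.span F[X] {(X : F[X]) ^ j}) = j := by
    intro j
    have := finrank_quotient_span_eq_natDegree (f := (X : F[X]) ^ j)
    rw [natDegree_X_pow] at this
    exact this
  have hfin : ∀ j, Module.Finite F (F[X] ⧸ Submodule.span F[X] {(X : F[X]) ^ j}) := by
    intro j
    exact (monic_X_pow j).finite_quotient
  have := hfin k
  have := hfin (k - c)
  let μ : B →ₗ[F[X]] B := LinearMap.lsmul F[X] B (X ^ c)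
  let μF : B →ₗ[F] B := μ.restrictScalars F
  let ν : F[X] →ₗ[F[X]] B := μ ∘ₗ Submodule.mkQ _
  have hker : LinearMap.ker ν = Submodule.span F[X] {(X : F[X]) ^ (k - c)} := by
    ext r
    have h1 : ν r = Submodule.Quotient.mk (X ^ c * r) := rfl
    rw [LinearMap.mem_ker, h1, Submodule.Quotient.mk_eq_zero, Submodule.mem_span_singleton,
      Submodule.mem_span_singleton]
    simp only [smul_eq_mul]
    constructor
    · rintro ⟨a, ha⟩
      rcases le_total k c with h | h
      · exact ⟨r, by rw [Nat.sub_eq_zero_of_le h]; simp⟩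
      · refine ⟨a, ?_⟩
        have h2 : (X : F[X]) ^ k = X ^ c * X ^ (k - c) := by rw [← pow_add]; congr 1; omega
        rw [h2] at ha
        apply mul_left_cancel₀ (pow_ne_zero c (X_ne_zero (R := F)))
        rw [← ha]; ring
    · rintro ⟨a, rfl⟩
      refine ⟨X ^ (c - k + 0) * a * X ^ (if k ≤ c then 0 else 0), ?_⟩
      have h2 : (X : F[X]) ^ c * X ^ (k - c) = X ^ (c - k) * X ^ k := by
        rw [← pow_add, ← pow_add]; congr 1; omega
      simp only [ite_self, pow_zero, mul_one, add_zero]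
      linear_combination (-a) * h2
  have hrange : LinearMap.range ν = LinearMap.range μ := by
    rw [LinearMap.range_comp, Submodule.range_mkQ, Submodule.map_top]
  let e : (F[X] ⧸ Submodule.span F[X] {(X : F[X]) ^ (k - c)}) ≃ₗ[F[X]] LinearMap.range μ :=
    (Submodule.quotEquivOfEq _ _ hker.symm) ≪≫ₗ ν.quotKerEquivRange ≪≫ₗ 
      (LinearEquiv.ofEq _ _ hrange)
  have hr : Module.finrank F (LinearMap.range μF) = k - c := by
    rw [← hB (k - c)]
    exact (LinearEquiv.finrank_eq (e.restrictScalars F)).symm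
  have hsum := LinearMap.finrank_range_add_finrank_ker μF
  rw [hr, hB k] at hsum
  have : Module.finrank F (LinearMap.ker μF) = min c k := by omega
  rw [← this, ← Module.natCard_eq_pow_finrank]
  rfl

open Polynomial in
lemma jordan_exists {F V : Type*} [Field F] [Finite F] [AddCommGroup V] [Module F V]
    [FiniteDimensional F V] (x : Module.End F V) (hx : IsNilpotent x) :
    ∃ (d : ℕ) (k : Fin d → ℕ) (g : Fin d → V),
      (∀ i, (x ^ k i) (g i) = 0) ∧
      (∀ z : Fin d → V, (∀ i, (x ^ k i) (z i) = 0) →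
        ∃ y : Module.End F V, x * y = y * x ∧ ∀ i, y (g i) = z i) ∧
      (∀ P : Submodule F V, (∀ i, g i ∈ P) → (∀ w ∈ P, x w ∈ P) → P = ⊤) ∧
      (∀ c, Nat.card (LinearMap.ker (x ^ c)) = Nat.card F ^ (∑ i, min c (k i))) := by
  classical
  obtain ⟨N, hN⟩ := hx
  have hXp : ∀ (m : Module.AEval' x) (c : ℕ), (Module.AEval'.of x).symm ((X : F[X]) ^ c • m) =
      (x ^ c) ((Module.AEval'.of x).symm m) := by
    intro m c
    rw [Module.AEval.of_symm_smul]
    simp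
  have htors : Module.IsTorsion' (Module.AEval' x) (Submonoid.powers (X : F[X])) := by
    intro m
    refine ⟨⟨X ^ N, N, rfl⟩, ?_⟩
    apply (Module.AEval'.of x).symm.injective
    change (Module.AEval'.of x).symm ((X : F[X]) ^ N • m) = _
    rw [hXp, hN]; simp
  obtain ⟨d, k, ⟨f⟩⟩ := Module.torsion_by_prime_power_decomposition
    (irreducible_X (R := F)) htors
  let gM : Fin d → Module.AEval' x := fun i => f.symm (DirectSum.lof F[X] _ _ i 
    (Submodule.Quotient.mk 1))
  refine ⟨d, k, fun i => (Module.AEval'.of x).symm (gM i), ?_, ?_, ?_, ?_⟩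
  · intro i
    rw [← hXp]
    simp only [gM]
    rw [← map_smul, ← map_smul, ← Submodule.Quotient.mk_smul,
      (Submodule.Quotient.mk_eq_zero _).2 (Submodule.mem_span_singleton.2 ⟨1, by simp⟩)]
    simp
  · intro z hz
    have hz' : ∀ i, (X : F[X]) ^ k i • Module.AEval'.of x (z i) = 0 := by
      intro i
      apply (Module.AEval'.of x).symm.injective
      rw [hXp]
      simpa using hz i
    let ψ : (DirectSum (Fin d) fun i => F[X] ⧸ Submodule.span F[X] {(X : F[X]) ^ k i}) →ₗ[F[X]]
        Module.AEval' x := DirectSum.toModule _ _ _ fun i => 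
          Submodule.liftQSpanSingleton ((X : F[X]) ^ k i) 
            (LinearMap.toSpanSingleton F[X] _ (Module.AEval'.of x (z i))) (hz' i)
    let y : Module.End F V := (Module.AEval'.of x).symm.toLinearMap ∘ₗ 
      ((ψ ∘ₗ f.toLinearMap).restrictScalars F) ∘ₗ (Module.AEval'.of x).toLinearMap
    have hy : ∀ w, y w = (Module.AEval'.of x).symm (ψ (f (Module.AEval'.of x w))) := fun w => rfl
    refine ⟨y, ?_, ?_⟩
    · ext w
      rw [Module.End.mul_apply, Module.End.mul_apply, hy, hy, ← Module.AEval'.X_smul_of, map_smul,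
        map_smul, Module.AEval'.of_symm_X_smul]
    · intro i
      rw [hy]
      have h1 : f (Module.AEval'.of x ((Module.AEval'.of x).symm (gM i))) =
          DirectSum.lof F[X] _ _ i (Submodule.Quotient.mk 1) := by
        rw [LinearEquiv.apply_symm_apply]
        exact LinearEquiv.apply_symm_apply f _
      rw [h1]
      simp only [ψ]
      rw [DirectSum.toModule_lof]
      change (Module.AEval'.of x).symm ((1 : F[X]) • Module.AEval'.of x (z i)) = z i
      rw [one_smul, LinearEquiv.symm_apply_apply]
  · intro P hg hst
    have hpoly : ∀ (r : F[X]) (w : V), w ∈ P → aeval x r w ∈ P := by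
      intro r w hw
      induction r using Polynomial.induction_on' with
      | add p q hp hq => rw [map_add]; exact P.add_mem hp hq
      | monomial j a =>
        rw [aeval_monomial]
        have : ∀ j, (x ^ j) w ∈ P := by
          intro j
          induction j with
          | zero => simpa
          | succ j ih => rw [pow_succ', Module.End.mul_apply]; exact hst _ ih
        simpa using P.smul_mem a (this j)
    rw [eq_top_iff]
    intro w _
    have : ∀ m, (Module.AEval'.of x).symm (f.symm m) ∈ P := by
      intro m
      induction m using DirectSum.induction_on with
      | zero => simp
      | add a b ha hb => rw [map_add, map_add]; exact P.add_mem ha hb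
      | of i b =>
        obtain ⟨r, rfl⟩ := Submodule.Quotient.mk_surjective _ b
        have h1 : (Submodule.Quotient.mk r : F[X] ⧸ Submodule.span F[X] {(X : F[X]) ^ k i}) = 
            r • Submodule.Quotient.mk 1 := by
          rw [← Submodule.Quotient.mk_smul]; simp
        change (Module.AEval'.of x).symm (f.symm (DirectSum.lof F[X] _ _ i _)) ∈ P
        rw [h1, map_smul, map_smul, Module.AEval.of_symm_smul]
        exact hpoly r _ (hg i)
    simpa using this (f (Module.AEval'.of x w))
  · intro c
    rw [← Finset.prod_pow_eq_pow_sum]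
    simp_rw [← card_ker_piece]
    rw [← Nat.card_pi]
    refine Nat.card_congr ⟨fun w i => ⟨f (Module.AEval'.of x w.1) i, ?_⟩, 
      fun r => ⟨(Module.AEval'.of x).symm (f.symm ((DirectSum.linearEquivFunOnFintype F[X] _ _).symm 
        fun i => (r i).1)), ?_⟩, ?_, ?_⟩
    · have h1 : (X : F[X]) ^ c • Module.AEval'.of x w.1 = 0 := by
        apply (Module.AEval'.of x).symm.injective
        rw [hXp]
        simpa using w.2
      rw [← DirectSum.smul_apply, ← map_smul, h1]; simp
    · rw [LinearMap.mem_ker, ← hXp, ← map_smul, ← map_smul]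
      have : (X : F[X]) ^ c • (fun i => (r i).1) = 0 := funext fun i => (r i).2
      rw [this]; simp
    · intro w
      apply Subtype.ext
      simp only
      have : (fun i => f (Module.AEval'.of x w.1) i) = 
        DirectSum.linearEquivFunOnFintype F[X] (Fin d) _ (f (Module.AEval'.of x w.1)) := rfl
      rw [this]
      simp
    · intro r
      funext i
      apply Subtype.ext
      have h1 := congrFun (LinearEquiv.apply_symm_apply (DirectSum.linearEquivFunOnFintype F[X]
        (Fin d) fun i => F[X] ⧸ Submodule.span F[X] {(X : F[X]) ^ k i}) (fun i => (r i).1)) i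
      simp only [LinearEquiv.apply_symm_apply]
      exact h1

/-- the commutant of an endomorphism -/
def commEnd {F V : Type*} [Field F] [AddCommGroup V] [Module F V] (x : Module.End F V) :
    Submodule F (Module.End F V) where
  carrier := {y | x * y = y * x}
  add_mem' := fun {a b} ha hb => by
    simp only [Set.mem_ofPred_eq] at *
    rw [mul_add, add_mul, ha, hb]
  zero_mem' := by simp
  smul_mem' := fun c a ha => by
    simp only [Set.mem_ofPred_eq] at *
    rw [mul_smul_comm, smul_mul_assoc, ha]

lemma commEnd_count {F : Type*} {V : Type u} [Field F] [Finite F] [AddCommGroup V] [Module F V]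
    [FiniteDimensional F V] (x : Module.End F V) (hx : IsNilpotent x) :
    ∃ (d : ℕ) (k : Fin d → ℕ),
      Nat.card {y : commEnd x // IsNilpotent y.1} * Nat.card (LinearMap.ker x) =
        Nat.card (commEnd x) ∧
      Nat.card (commEnd x) = ∏ i, Nat.card (LinearMap.ker (x ^ k i)) ∧
      (∀ c, Nat.card (LinearMap.ker (x ^ c)) = Nat.card F ^ (∑ i, min c (k i))) := by
  obtain ⟨d, k, g, hkg, hlift, hgen, hcard⟩ := jordan_exists x hx
  have hVfin : Finite V := Module.finite_of_finite F
  have hEndfin : Finite (Module.End F V) := Module.finite_of_finite F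
  have hcomm : ∀ y ∈ commEnd x, ∀ w, x (y w) = y (x w) := fun y hy w =>
    LinearMap.congr_fun (show x * y = y * x from hy) w
  have hcommp : ∀ y ∈ commEnd x, ∀ c w, (x ^ c) (y w) = y ((x ^ c) w) := by
    intro y hy c w
    have h : Commute x y := hy
    exact LinearMap.congr_fun (h.pow_left c).eq w
  refine ⟨d, k, ?_, ?_, hcard⟩
  · set W := LinearMap.range x with hW
    let S : Set (Submodule F (V ⧸ W)) :=
      Set.range fun c : ℕ => (LinearMap.ker (x ^ c)).map W.mkQ
    have hS : IsChain (· ≤ ·) S := by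
      have hmono : ∀ a b, a ≤ b → (LinearMap.ker (x ^ a)).map W.mkQ ≤
          (LinearMap.ker (x ^ b)).map W.mkQ := by
        intro a b hab
        refine Submodule.map_mono fun w hw => ?_
        rw [LinearMap.mem_ker] at hw ⊢
        rw [show b = (b - a) + a by omega, pow_add, Module.End.mul_apply, hw, map_zero]
      rintro _ ⟨a, rfl⟩ _ ⟨b, rfl⟩ _
      rcases le_total a b with h | h
      · exact Or.inl (hmono a b h)
      · exact Or.inr (hmono b a h)
    have hst : ∀ y ∈ commEnd x, W ≤ W.comap y := by
      rintro y hy _ ⟨w, rfl⟩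
      exact ⟨y w, hcomm y hy w⟩
    let φ : commEnd x →+ stabEnd S :=
      { toFun := fun y => ⟨W.mapQ W y.1 (hst y.1 y.2), by
          rintro _ ⟨c, rfl⟩ _ ⟨w, hw, rfl⟩
          refine ⟨y.1 w, ?_, rfl⟩
          have hw' : (x ^ c) w = 0 := hw
          change (x ^ c) (y.1 w) = 0
          rw [hcommp y.1 y.2, hw', map_zero]⟩
        map_zero' := by apply Subtype.ext; ext w; rfl
        map_add' := by intro a b; apply Subtype.ext; ext w; rfl }
    have hφ : Function.Surjective φ := by
      intro T
      have h1 : ∀ i, ∃ z, (x ^ k i) z = 0 ∧ W.mkQ z = T.1 (W.mkQ (g i)) := by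
        intro i
        obtain ⟨z, hz, hz'⟩ := T.2 _ ⟨k i, rfl⟩ (W.mkQ (g i)) ⟨g i, hkg i, rfl⟩
        exact ⟨z, hz, hz'⟩
      choose z hz hz' using h1
      obtain ⟨y, hy, hyg⟩ := hlift z hz
      refine ⟨⟨y, hy⟩, Subtype.ext ?_⟩
      have hx0 : ∀ w, W.mkQ (x w) = 0 := fun w => by simp [hW]
      have htop := hgen (LinearMap.ker (W.mkQ ∘ₗ y - T.1 ∘ₗ W.mkQ)) (fun i => by
        rw [LinearMap.mem_ker, LinearMap.sub_apply, LinearMap.comp_apply, LinearMap.comp_apply,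
          hyg, hz', sub_self]) (fun w _ => by
        rw [LinearMap.mem_ker, LinearMap.sub_apply, LinearMap.comp_apply, LinearMap.comp_apply,
          ← hcomm y hy, hx0, hx0, map_zero, sub_self])
      ext w
      have hw : w ∈ LinearMap.ker (W.mkQ ∘ₗ y - T.1 ∘ₗ W.mkQ) := by
        rw [htop]; exact Submodule.mem_top
      rw [LinearMap.mem_ker, LinearMap.sub_apply, sub_eq_zero] at hw
      exact hw
    have hnil : ∀ y : commEnd x, IsNilpotent (φ y + 0).1 ↔ IsNilpotent y.1 := by
      intro y
      rw [add_zero]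
      have hpow : ∀ N w, ((φ y).1 ^ N) (W.mkQ w) = W.mkQ ((y.1 ^ N) w) := by
        intro N
        induction N with
        | zero => simp
        | succ N ih =>
          intro w
          rw [pow_succ, Module.End.mul_apply, pow_succ, Module.End.mul_apply, ← ih]
          rfl
      constructor
      · rintro ⟨N, hN⟩
        obtain ⟨n, hn⟩ := hx
        have hr : ∀ w, ∃ u, x u = (y.1 ^ N) w := by
          intro w
          have := hpow N w
          rw [hN] at this
          have h2 : (y.1 ^ N) w ∈ W := by simpa using this.symm
          exact h2
        have hall : ∀ j w, ∃ u, (x ^ j) u = (y.1 ^ (N * j)) w := by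
          intro j
          induction j with
          | zero => intro w; exact ⟨w, by simp⟩
          | succ j ih =>
            intro w
            obtain ⟨u, hu⟩ := ih w
            obtain ⟨u', hu'⟩ := hr u
            refine ⟨u', ?_⟩
            have hc : Commute (x ^ j) (y.1 ^ N) :=
              ((show Commute x y.1 from y.2).pow_pow j N)
            rw [pow_succ, Module.End.mul_apply, hu', Nat.mul_succ, add_comm, pow_add,
              Module.End.mul_apply, ← hu]
            exact LinearMap.congr_fun hc.eq u
        refine ⟨N * n, ?_⟩
        ext w
        obtain ⟨u, hu⟩ := hall n w
        rw [← hu, hn]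
        rfl
      · rintro ⟨N, hN⟩
        refine ⟨N, ?_⟩
        ext w
        simp only [LinearMap.comp_apply]
        rw [hpow, hN]; simp
    have h1 := card_preimage_shift φ hφ 0 (fun T => IsNilpotent T.1)
    have h2 := card_preimage_shift φ hφ 0 (fun _ => True)
    simp only [hnil] at h1
    have h3 : Nat.card {l : commEnd x // True} = Nat.card (commEnd x) :=
      Nat.card_congr (Equiv.subtypeUnivEquiv fun _ => trivial)
    have h4 : Nat.card {l : stabEnd S // True} = Nat.card (stabEnd S) :=
      Nat.card_congr (Equiv.subtypeUnivEquiv fun _ => trivial)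
    rw [h3, h4] at h2
    have h5 : Nat.card (LinearMap.ker x) = Nat.card (V ⧸ W) := by
      rw [Module.natCard_eq_pow_finrank (K := F) (V := LinearMap.ker x),
        Module.natCard_eq_pow_finrank (K := F) (V := V ⧸ W)]
      congr 1
      have := LinearMap.finrank_range_add_finrank_ker x
      rw [← hW] at this
      have := Submodule.finrank_quotient_add_finrank W
      omega
    rw [h1, h2, h5, ← flag_count _ (V ⧸ W) rfl S hS]
    ring
  · rw [← Nat.card_pi]
    refine Nat.card_congr (Equiv.ofBijective (fun y i => ⟨y.1 (g i), ?_⟩) ⟨?_, ?_⟩)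
    · rw [LinearMap.mem_ker, hcommp y.1 y.2, hkg, map_zero]
    · intro y y' h
      have htop := hgen (LinearMap.ker (y.1 - y'.1)) (fun i => by
        have := congrArg Subtype.val (congrFun h i)
        simp only at this
        rw [LinearMap.mem_ker, LinearMap.sub_apply, this, sub_self]) (fun w hw => by
        rw [LinearMap.mem_ker] at hw ⊢
        rw [← hcomm _ (Submodule.sub_mem _ y.2 y'.2), hw, map_zero])
      apply Subtype.ext
      rw [← sub_eq_zero]
      exact LinearMap.ker_eq_top.1 htop
    · intro z
      obtain ⟨y, hy, hyg⟩ := hlift (fun i => (z i).1) (fun i => (z i).2)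
      exact ⟨⟨y, hy⟩, funext fun i => Subtype.ext (hyg i)⟩

lemma sum_min_eq (n : ℕ) (s : Multiset ℕ) (hs : ∀ p ∈ s, p ≤ n) :
    (s.map fun p => (s.map fun p' => min p p').sum).sum =
      ∑ k ∈ Finset.range n, (Multiset.card (s.filter fun p => k + 1 ≤ p)) ^ 2 := by
  classical
  obtain ⟨m, p, rfl⟩ : ∃ (m : ℕ) (p : Fin m → ℕ), s = (Finset.univ : Finset (Fin m)).val.map p := by
    induction s using Quotient.inductionOn with
    | _ l => exact ⟨l.length, l.get, by simp⟩
  have hp : ∀ i, p i ≤ n := fun i => hs _ (Multiset.mem_map_of_mem p (Finset.mem_univ i))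
  have hc : ∀ k, Multiset.card ((Multiset.map p Finset.univ.val).filter fun a => k + 1 ≤ a) =
      ∑ i, if k + 1 ≤ p i then 1 else 0 := by
    intro k
    rw [Multiset.filter_map, Multiset.card_map, ← Finset.card_filter]
    rfl
  simp only [hc, Multiset.map_map, Function.comp_def]
  change ∑ i, ∑ j, min (p i) (p j) = _
  simp only [sq, Finset.sum_mul_sum]
  rw [Finset.sum_comm]
  simp only [Finset.sum_comm (s := Finset.range n)]
  rw [Finset.sum_comm]
  refine Finset.sum_congr rfl fun i _ => ?_
  refine Finset.sum_congr rfl fun j _ => ?_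
  have h1 : ∀ k, ((if k + 1 ≤ p i then 1 else 0) * (if k + 1 ≤ p j then 1 else 0) : ℕ) =
      if k < min (p i) (p j) then 1 else 0 := by
    intro k
    simp only [lt_min_iff, Nat.succ_le_iff]
    by_cases h1 : k < p i <;> by_cases h2 : k < p j <;> simp [h1, h2]
  simp only [h1]
  rw [← Finset.card_filter]
  have : (Finset.range n).filter (fun k => k < min (p i) (p j)) =
      Finset.range (min (p i) (p j)) := by
    ext k
    have := hp i
    simp; omega
  rw [this, Finset.card_range]

theorem card_nilpotent_centralizer_matrix
    (q : ℕ) (hq : ∃ p m : ℕ, p.Prime ∧ 0 < m ∧ q = p ^ m)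
    (F : Type) [Field F] [Fintype F] (hF : Fintype.card F = q)
    (n : ℕ) (hn : 1 ≤ n) (lam : Nat.Partition n)
    (x : Matrix (Fin n) (Fin n) F)
    (hnil : x ^ n = 0)
    (htype : ∀ k : ℕ, 1 ≤ k →
      (n : ℤ) - Matrix.rank (x ^ k) = (lam.parts.map (fun p => min k p)).sum) :
    Nat.card {y : Matrix (Fin n) (Fin n) F // IsNilpotent y ∧ x * y = y * x} =
      q ^ ((∑ k ∈ Finset.range n,
          (Multiset.card (lam.parts.filter (fun p => k + 1 ≤ p))) ^ 2) -
        ∑ i ∈ Finset.range n, Multiset.count (i + 1) lam.parts) := by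
  classical
  let Φ : Matrix (Fin n) (Fin n) F ≃ₐ[F] Module.End F (Fin n → F) := Matrix.toLinAlgEquiv'
  have hX : IsNilpotent (Φ x) := ⟨n, by rw [← map_pow, hnil, map_zero]⟩
  have hqF : Nat.card F = q := by rw [Nat.card_eq_fintype_card, hF]
  have hq1 : 1 < q := by rw [← hF]; exact Fintype.one_lt_card
  obtain ⟨d, k, hA, hB, hC⟩ := commEnd_count (Φ x) hX
  rw [hqF] at hC
  have hK : ∀ c, Nat.card (LinearMap.ker ((Φ x) ^ c)) =
      q ^ ((lam.parts.map (fun p => min c p)).sum) := by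
    intro c
    rw [Module.natCard_eq_pow_finrank (K := F), hqF]
    congr 1
    rcases Nat.eq_zero_or_pos c with rfl | hc
    · rw [pow_zero, show LinearMap.ker (1 : Module.End F (Fin n → F)) = ⊥ from LinearMap.ker_id]
      simp
    · have h1 := htype c hc
      have h2 := LinearMap.finrank_range_add_finrank_ker ((Φ x) ^ c)
      have h3 : Module.finrank F (LinearMap.range ((Φ x) ^ c)) = Matrix.rank (x ^ c) := by
        rw [← map_pow]; rfl
      rw [h3] at h2
      simp only [Module.finrank_fin_fun] at h2
      zify at h2 ⊢
      push_cast at h1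
      linarith
  have hKC : ∀ c, ((lam.parts.map (fun p => min c p)).sum) = ∑ i, min c (k i) := by
    intro c
    exact Nat.pow_right_injective hq1 ((hK c).symm.trans (hC c))
  have hle : ∀ p ∈ lam.parts, p ≤ n := by
    intro p hp
    have := Multiset.le_sum_of_mem hp
    rwa [lam.parts_sum] at this
  have hcardA : Nat.card (commEnd (Φ x)) = q ^ (∑ k ∈ Finset.range n,
          (Multiset.card (lam.parts.filter (fun p => k + 1 ≤ p))) ^ 2) := by
    rw [hB]
    simp only [hK]
    rw [Finset.prod_pow_eq_pow_sum, ← sum_min_eq n _ hle]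
    congr 1
    simp only [hKC (_ : ℕ)]
    have hsw : ∀ s : Multiset ℕ, (s.map fun p => ∑ i, min p (k i)).sum =
        ∑ i, (s.map fun p => min p (k i)).sum := by
      intro s
      induction s using Multiset.induction with
      | empty => simp
      | cons a s ih => simp [ih, Finset.sum_add_distrib]
    rw [hsw]
    refine Finset.sum_congr rfl fun i _ => ?_
    rw [← hKC]
    simp only [min_comm]
  have hker : Nat.card (LinearMap.ker (Φ x)) =
      q ^ (∑ i ∈ Finset.range n, Multiset.count (i + 1) lam.parts) := by
    have h1 := hK 1
    rw [pow_one] at h1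
    rw [h1]
    congr 1
    have h2 : lam.parts.map (fun p => min 1 p) = lam.parts.map (fun _ => 1) := by
      refine Multiset.map_congr rfl fun p hp => ?_
      have := lam.parts_pos hp
      omega
    rw [h2]
    have h3 : ∑ i ∈ (Finset.range n).image (· + 1), Multiset.count i lam.parts =
        Multiset.card lam.parts := by
      apply Multiset.sum_count_eq_card
      intro a ha
      have := lam.parts_pos ha
      have := hle a ha
      simp only [Finset.mem_image, Finset.mem_range]
      exact ⟨a - 1, by omega, by omega⟩
    rw [Finset.sum_image (by intro a _ b _ h; simpa using h)] at h3
    rw [h3]; simp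
  have hN : Nat.card {y : Matrix (Fin n) (Fin n) F // IsNilpotent y ∧ x * y = y * x} =
      Nat.card {y : commEnd (Φ x) // IsNilpotent y.1} := by
    refine Nat.card_congr ⟨fun y => ⟨⟨Φ y.1, ?_⟩, y.2.1.map Φ⟩,
      fun y => ⟨Φ.symm y.1.1, y.2.map Φ.symm, ?_⟩, ?_, ?_⟩
    · change Φ x * Φ y.1 = Φ y.1 * Φ x
      rw [← map_mul, ← map_mul, y.2.2]
    · apply Φ.injective
      have : Φ x * y.1.1 = y.1.1 * Φ x := y.1.2
      simpa using this
    · intro y; simp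
    · intro y; simp
  rw [hN]
  rw [hcardA, hker] at hA
  set a := ∑ i ∈ Finset.range n, Multiset.count (i + 1) lam.parts
  set b := ∑ k ∈ Finset.range n, (Multiset.card (lam.parts.filter (fun p => k + 1 ≤ p))) ^ 2
  have hab : a ≤ b := by
    rw [← Nat.pow_dvd_pow_iff_le_right hq1]
    exact ⟨_, by rw [← hA, mul_comm]⟩
  have hpos : 0 < q ^ a := by positivity
  apply Nat.eq_of_mul_eq_mul_right hpos
  rw [hA, ← pow_add]
  congr 1
  omega
end

section
/- Let q be a prime power, n ≥ 1, λ a partition of n, and let x ∈ gu(n,q) be nilpotent of Jordan type λ (as an n×n matrix over F_{q²}). Then the number of nilpotent elements y ∈ gu(n,q) with xy = yx equals q^{∑_{k ≥ 1} (λ'_k)² − ∑_{i ≥ 1} m_i(λ)}. -/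
open Matrix
set_option linter.unusedSectionVars false


/-- the star structure given by the q-power map -/
theorem exists_starRing (q : ℕ) (hq : ∃ p m : ℕ, p.Prime ∧ 0 < m ∧ q = p ^ m)
    (K : Type) [Field K] [Fintype K] (hK : Fintype.card K = q ^ 2) :
    ∃ S : StarRing K, ∀ a : K, S.star a = a ^ q := by
  obtain ⟨p, m, hp, hm, rfl⟩ := hq
  have : Fact p.Prime := ⟨hp⟩
  have : CharP K p := by
    obtain ⟨p', hp'⟩ := CharP.exists K
    obtain ⟨n, hp1, hn⟩ := FiniteField.card K p'
    have : p' = p := by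
      have h1 : p' ∣ (p ^ m) ^ 2 := by
        rw [← hK, hn]; exact dvd_pow_self _ n.pos.ne'
      have h2 := hp1.dvd_of_dvd_pow (hp1.dvd_of_dvd_pow h1)
      exact (Nat.prime_dvd_prime_iff_eq hp1 hp).1 h2
    exact this ▸ hp'
  refine ⟨{ star := fun a => a ^ (p ^ m), star_involutive := ?_, star_mul := ?_, star_add := ?_ }, fun a => rfl⟩
  · intro a
    change (a ^ (p ^ m)) ^ (p ^ m) = a
    rw [← pow_mul, ← sq, ← hK, FiniteField.pow_card]
  · intro a b
    change (a * b) ^ (p ^ m) = b ^ (p ^ m) * a ^ (p ^ m)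
    rw [mul_pow, mul_comm]
  · intro a b
    exact add_pow_expChar_pow a b p m

section field
variable {K : Type} [Field K] [Fintype K] [StarRing K] {q : ℕ}

theorem two_le_q (hK : Fintype.card K = q ^ 2) : 2 ≤ q := by
  have := Fintype.one_lt_card (α := K)
  by_contra h
  have : q = 0 ∨ q = 1 := by omega
  rcases this with rfl | rfl <;> simp_all

open Classical in
theorem card_norm_zero (hK : Fintype.card K = q ^ 2) (hs : ∀ a : K, star a = a ^ q) :
    (Finset.univ.filter (fun t : K => star t * t = 0)).card = 1 := by
  rw [Finset.card_eq_one]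
  refine ⟨0, ?_⟩
  ext t
  simp

open Classical in
theorem card_norm_ne (hK : Fintype.card K = q ^ 2) (hs : ∀ a : K, star a = a ^ q) (c : K) (hc : star c = c)
    (hc0 : c ≠ 0) :
    (Finset.univ.filter (fun t : K => star t * t = c)).card = q + 1 := by
  have hq := two_le_q hK
  -- the set of nonzero fixed elements has at most q - 1 elements
  set F : Finset K := Finset.univ.filter (fun c : K => star c = c ∧ c ≠ 0) with hF
  have hle : ∀ c ∈ F, (Finset.univ.filter (fun t : K => star t * t = c)).card ≤ q + 1 := by
    intro c hc
    have : (Finset.univ.filter (fun t : K => star t * t = c)) ⊆ (Polynomial.nthRoots (q+1) c).toFinset := by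
      intro t ht
      simp only [Finset.mem_filter, Finset.mem_univ, true_and, hs] at ht
      rw [Multiset.mem_toFinset, Polynomial.mem_nthRoots (by omega), pow_succ, ht]
    exact (Finset.card_le_card this).trans ((Multiset.toFinset_card_le _).trans (Polynomial.card_nthRoots _ _))
  have hFc : F.card ≤ q - 1 := by
    have : F ⊆ (Polynomial.nthRoots (q-1) (1:K)).toFinset := by
      intro t ht
      simp only [hF, Finset.mem_filter, Finset.mem_univ, true_and, hs] at ht
      rw [Multiset.mem_toFinset, Polynomial.mem_nthRoots (by omega)]
      apply mul_right_cancel₀ ht.2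
      rw [← pow_succ, Nat.sub_add_cancel (by omega), ht.1, one_mul]
    exact (Finset.card_le_card this).trans ((Multiset.toFinset_card_le _).trans (Polynomial.card_nthRoots _ _))
  have htot : ∑ c ∈ F, (Finset.univ.filter (fun t : K => star t * t = c)).card = q ^ 2 - 1 := by
    have h1 := Finset.card_eq_sum_card_fiberwise (s := Finset.univ.filter (fun t : K => t ≠ 0)) (t := F)
      (f := fun t : K => star t * t) (by
        intro t ht
        simp only [Finset.coe_filter, Finset.mem_univ, true_and, Set.mem_setOf_eq] at ht
        simp [hF, ht, mul_comm])
    have h2 : (Finset.univ.filter (fun t : K => t ≠ 0)).card = q ^ 2 - 1 := by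
      rw [Finset.filter_ne', Finset.card_erase_of_mem (Finset.mem_univ _), Finset.card_univ, hK]
    rw [← h2, h1]
    refine Finset.sum_congr rfl fun c hc => ?_
    congr 1
    ext t
    simp only [Finset.mem_filter, Finset.mem_univ, true_and]
    refine ⟨fun h => ⟨?_, h⟩, fun h => h.2⟩
    rintro rfl
    simp only [hF, Finset.mem_filter] at hc
    exact hc.2.2 (by rw [← h]; simp)
  have hcF : c ∈ F := by simp [hF, hc, hc0]
  by_contra hne
  have hlt := lt_of_le_of_ne (hle c hcF) hne
  have h3 : ∑ c ∈ F, (Finset.univ.filter (fun t : K => star t * t = c)).card < ∑ c ∈ F, (q+1) :=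
    Finset.sum_lt_sum hle ⟨c, hcF, hlt⟩
  rw [htot, Finset.sum_const, smul_eq_mul] at h3
  have h4 : F.card * (q+1) ≤ (q-1)*(q+1) := Nat.mul_le_mul_right _ hFc
  obtain ⟨r, rfl⟩ : ∃ r, q = r + 1 := ⟨q-1, by omega⟩
  have : (r+1)^2 - 1 = r * (r+1+1) := by
    have : (r+1)^2 = r * (r+1+1) + 1 := by ring
    omega
  simp only [Nat.add_sub_cancel] at h4
  omega

theorem norm_surj (hK : Fintype.card K = q ^ 2) (hs : ∀ a : K, star a = a ^ q) (c : K) (hc : star c = c)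
    (hc0 : c ≠ 0) : ∃ t : K, star t * t = c := by
  classical
  have h := card_norm_ne hK hs c hc hc0
  have : (Finset.univ.filter (fun t : K => star t * t = c)).Nonempty := by
    rw [← Finset.card_pos, h]; omega
  obtain ⟨t, ht⟩ := this
  exact ⟨t, by simpa using ht⟩

theorem exists_not_fixed (hK : Fintype.card K = q ^ 2) (hs : ∀ a : K, star a = a ^ q) :
    ∃ t : K, star t ≠ t := by
  classical
  have hq := two_le_q hK
  by_contra! h
  have : (Finset.univ : Finset K) ⊆ insert 0 (Polynomial.nthRoots (q-1) (1:K)).toFinset := by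
    intro t _
    rw [Finset.mem_insert]
    by_cases h0 : t = 0
    · exact Or.inl h0
    right
    rw [Multiset.mem_toFinset, Polynomial.mem_nthRoots (by omega)]
    apply mul_right_cancel₀ h0
    rw [← pow_succ, Nat.sub_add_cancel (by omega), ← hs, h, one_mul]
  have h1 := (Finset.card_le_card this).trans (Finset.card_insert_le _ _)
  have h2 := (Multiset.toFinset_card_le _).trans (Polynomial.card_nthRoots (q-1) (1:K))
  rw [Finset.card_univ, hK] at h1
  nlinarith [Nat.sub_add_cancel (show 1 ≤ q by omega)]

theorem exists_skew_scalar (hK : Fintype.card K = q ^ 2) (hs : ∀ a : K, star a = a ^ q) :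
    ∃ t : K, t ≠ 0 ∧ star t = - t := by
  obtain ⟨t, ht⟩ := exists_not_fixed hK hs
  exact ⟨t - star t, sub_ne_zero.2 ht.symm, by simp⟩

end field


section nf
variable {K : Type} [Field K] [Fintype K] [StarRing K] {q : ℕ}

theorem skew_pow {V : Type} [AddCommGroup V] [Module K V] (h : V →ₗ⋆[K] V →ₗ[K] K)
    (x : V →ₗ[K] V) (hskew : ∀ u v, h (x u) v = - h u (x v)) (s : ℕ) (u v : V) :
    h ((x ^ s) u) v = (-1) ^ s * h u ((x ^ s) v) := by
  induction s generalizing u v with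
  | zero => simp
  | succ s ih =>
    rw [pow_succ, Module.End.mul_apply, ih, hskew, pow_succ, ← Module.End.mul_apply, ← pow_succ', pow_succ]
    ring

theorem exists_aniso (hK : Fintype.card K = q ^ 2) (hs : ∀ a : K, star a = a ^ q)
    {V : Type} [AddCommGroup V] [Module K V] (h : V →ₗ⋆[K] V →ₗ[K] K)
    (hnd : ∀ v, (∀ u, h u v = 0) → v = 0) (y : V →ₗ[K] V) (hy : y ≠ 0) :
    ∃ v, h v (y v) ≠ 0 := by
  by_contra! hcon
  apply hy
  obtain ⟨t, ht⟩ := exists_not_fixed hK hs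
  ext w
  apply hnd
  intro u
  have h1 := hcon (u + w)
  have h2 := hcon (u + t • w)
  simp only [map_add, LinearMap.add_apply, hcon, map_smul, LinearMap.map_smulₛₗ, LinearMap.smul_apply, smul_eq_mul,
    starRingEnd_apply] at h1 h2
  have h3 : (t - star t) * h u (y w) = 0 := by
    linear_combination h2 - star t * h1
  rcases mul_eq_zero.1 h3 with h4 | h4
  · exact absurd (sub_eq_zero.1 h4).symm ht
  · exact h4

theorem exists_gen (hK : Fintype.card K = q ^ 2) (hs : ∀ a : K, star a = a ^ q)
    (eps : ℕ → K) (heps : ∀ d, 1 ≤ d → eps d ≠ 0 ∧ star (eps d) = (-1) ^ (d - 1) * eps d)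
    {V : Type} [AddCommGroup V] [Module K V] [Nontrivial V] (h : V →ₗ⋆[K] V →ₗ[K] K)
    (hherm : ∀ u v, h v u = star (h u v))
    (hnd : ∀ v, (∀ u, h u v = 0) → v = 0) (x : V →ₗ[K] V)
    (hskew : ∀ u v, h (x u) v = - h u (x v)) (hnil : IsNilpotent x) :
    ∃ (d : ℕ) (v : V), 1 ≤ d ∧ x ^ d = 0 ∧ h v ((x ^ (d - 1)) v) = eps d := by
  set d := nilpotencyClass x with hd
  have hd1 : 1 ≤ d := Nat.one_le_iff_ne_zero.2 (pos_nilpotencyClass_iff.2 hnil).ne'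
  obtain ⟨v, hv⟩ := exists_aniso hK hs h hnd (x ^ (d - 1)) (pow_pred_nilpotencyClass hnil)
  have hst : star (h v ((x ^ (d-1)) v)) = (-1) ^ (d-1) * h v ((x ^ (d-1)) v) := by
    rw [← hherm, skew_pow h x hskew]
  obtain ⟨c, hc⟩ := norm_surj hK hs (eps d / h v ((x ^ (d-1)) v)) (by
    rw [star_div₀, hst, (heps d hd1).2, mul_div_mul_left]
    exact pow_ne_zero _ (by simp)) (div_ne_zero (heps d hd1).1 hv)
  refine ⟨d, c • v, hd1, pow_nilpotencyClass hnil, ?_⟩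
  simp only [map_smul, LinearMap.map_smulₛₗ, LinearMap.smul_apply, smul_eq_mul, starRingEnd_apply]
  rw [← mul_assoc, mul_comm c, hc, div_mul_cancel₀ _ hv]

theorem key_indep (eps : ℕ → K) (heps : ∀ d, 1 ≤ d → eps d ≠ 0 ∧ star (eps d) = (-1) ^ (d - 1) * eps d)
    {V : Type} [AddCommGroup V] [Module K V] (h : V →ₗ⋆[K] V →ₗ[K] K)
    (x : V →ₗ[K] V)
    (hskew : ∀ u v, h (x u) v = - h u (x v)) (d : ℕ) (hd1 : 1 ≤ d) (v : V) (hxd : (x ^ d) v = 0)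
    (hv : h v ((x ^ (d - 1)) v) = eps d) (c : Fin d → K)
    (hc : ∀ t : Fin d, h ((x ^ (t : ℕ)) v) (∑ s, c s • (x ^ (s : ℕ)) v) = 0) : c = 0 := by
  have hz : ∀ s, d ≤ s → (x ^ s) v = 0 := by
    intro s hs
    obtain ⟨r, rfl⟩ := Nat.exists_eq_add_of_le hs
    rw [add_comm, pow_add, Module.End.mul_apply, hxd, map_zero]
  have main : ∀ s : ℕ, ∀ hs : s < d, c ⟨s, hs⟩ = 0 := by
    intro s
    induction s using Nat.strong_induction_on with
    | _ s ih =>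
    intro hs
    have h1 := hc ⟨d - 1 - s, by omega⟩
    rw [map_sum, Finset.sum_eq_single ⟨s, hs⟩] at h1
    · rw [skew_pow h x hskew, map_smul, map_smul, ← Module.End.mul_apply, ← pow_add] at h1
      simp only at h1
      rw [show d - 1 - s + s = d - 1 by omega, hv] at h1
      have h2 : ((-1 : K)) ^ (d - 1 - s) ≠ 0 := pow_ne_zero _ (by simp)
      simpa [(heps d hd1).1] using h1
    · intro s' _ hne
      rcases lt_or_gt_of_ne (fun e => hne (Fin.ext e) : (s' : ℕ) ≠ s) with hlt | hgt
      · have := ih s' hlt s'.2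
        rw [show c s' = 0 from this]; simp
      · rw [skew_pow h x hskew, map_smul, map_smul, ← Module.End.mul_apply, ← pow_add, hz _ (by simp only; omega)]
        simp
    · simp
  ext s
  exact main s s.2

theorem nf (hK : Fintype.card K = q ^ 2) (hs : ∀ a : K, star a = a ^ q)
    (eps : ℕ → K) (heps : ∀ d, 1 ≤ d → eps d ≠ 0 ∧ star (eps d) = (-1) ^ (d - 1) * eps d) (N : ℕ) :
    ∀ (V : Type) [AddCommGroup V] [Module K V] [FiniteDimensional K V] (_ : Module.finrank K V = N)
    (h : V →ₗ⋆[K] V →ₗ[K] K)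
    (_ : ∀ u v, h v u = star (h u v))
    (_ : ∀ v, (∀ u, h u v = 0) → v = 0) (x : V →ₗ[K] V)
    (_ : ∀ u v, h (x u) v = - h u (x v)) (_ : IsNilpotent x),
    ∃ (r : ℕ) (d : Fin r → ℕ) (v : Fin r → V), (∀ i, 1 ≤ d i) ∧ (∀ i, (x ^ d i) (v i) = 0) ∧
      (∀ i j s, i ≠ j → h (v i) ((x ^ s) (v j)) = 0) ∧
      (∀ i, h (v i) ((x ^ (d i - 1)) (v i)) = eps (d i)) ∧
      ∑ i, d i = N ∧
      Submodule.span K (Set.range fun p : Σ i, Fin (d i) => (x ^ (p.2 : ℕ)) (v p.1)) = ⊤ := by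
  induction N using Nat.strong_induction_on with
  | _ N ih =>
  intro V _ _ _ hN h hherm hnd x hskew hnil
  rcases Nat.eq_zero_or_pos N with h0 | hpos
  · subst h0
    have : Subsingleton V := Module.finrank_zero_iff.1 hN
    refine ⟨0, Fin.elim0, Fin.elim0, fun i => i.elim0, fun i => i.elim0, fun i => i.elim0, fun i => i.elim0,
      by simp, Subsingleton.elim _ _⟩
  have : Nontrivial V := Module.nontrivial_of_finrank_pos (R := K) (by omega)
  obtain ⟨d, v, hd1, hxd0, hv⟩ := exists_gen hK hs eps heps h hherm hnd x hskew hnil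
  have hxd : (x ^ d) v = 0 := by rw [hxd0]; rfl
  let φ : V →ₗ[K] (Fin d → K) := LinearMap.pi fun s => h ((x ^ (s : ℕ)) v)
  let ψ : (Fin d → K) →ₗ[K] V := Fintype.linearCombination K (fun s : Fin d => (x ^ (s : ℕ)) v)
  have hψ : ∀ c, ψ c = ∑ s, c s • (x ^ (s : ℕ)) v := fun c => by simp [ψ, Fintype.linearCombination_apply]
  have hinj : Function.Injective (φ ∘ₗ ψ) := by
    rw [← LinearMap.ker_eq_bot, LinearMap.ker_eq_bot']
    intro c hc
    refine key_indep eps heps h x hskew d hd1 v hxd hv c fun t => ?_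
    rw [← hψ]
    exact congrFun hc t
  have hsurj : Function.Surjective (φ ∘ₗ ψ) := LinearMap.injective_iff_surjective.1 hinj
  have hφs : Function.Surjective φ := fun y => by
    obtain ⟨c, hc⟩ := hsurj y
    exact ⟨ψ c, hc⟩
  set W := LinearMap.ker φ with hW
  have hWmem : ∀ u ∈ W, ∀ s, h ((x ^ s) v) u = 0 := by
    intro u hu s
    by_cases hsd : s < d
    · exact congrFun (LinearMap.mem_ker.1 hu) ⟨s, hsd⟩
    · obtain ⟨r, rfl⟩ := Nat.exists_eq_add_of_le (not_lt.1 hsd)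
      rw [pow_add, hxd0]; simp
  have hWfin : Module.finrank K W = N - d := by
    have := LinearMap.finrank_range_add_finrank_ker φ
    rw [LinearMap.range_eq_top.2 hφs, finrank_top, Module.finrank_fin_fun, hN, ← hW] at this
    omega
  have hdN : d ≤ N := by
    have := LinearMap.finrank_range_add_finrank_ker φ
    rw [LinearMap.range_eq_top.2 hφs, finrank_top, Module.finrank_fin_fun, hN, ← hW] at this
    omega
  have hdec : ∀ u, ∃ c, u - ψ c ∈ W := by
    intro u
    obtain ⟨c, hc⟩ := hsurj (φ u)
    refine ⟨c, ?_⟩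
    rw [hW, LinearMap.mem_ker, map_sub, ← hc]
    simp
  have hxW : ∀ u ∈ W, x u ∈ W := by
    intro u hu
    rw [hW, LinearMap.mem_ker]
    ext s
    change h ((x ^ (s : ℕ)) v) (x u) = 0
    have := hskew ((x ^ (s:ℕ)) v) u
    rw [← Module.End.mul_apply, ← pow_succ', hWmem u hu] at this
    simpa using this.symm
  let x' : W →ₗ[K] W := x.restrict hxW
  have hx' : ∀ (s : ℕ) (u : W), (((x' ^ s) u : W) : V) = (x ^ s) (u : V) := by
    intro s
    induction s with
    | zero => intro u; rfl
    | succ s ih => intro u; rw [pow_succ, Module.End.mul_apply, ih, pow_succ, Module.End.mul_apply]; rfl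
  let h' : W →ₗ⋆[K] W →ₗ[K] K := h.domRestrict₁₂ W W
  have hh' : ∀ u w : W, h' u w = h (u : V) (w : V) := fun u w => rfl
  obtain ⟨r, d', v', h1, h2, h3, h4, h5, h6⟩ := ih (N - d) (by omega) W hWfin h'
    (fun u w => by rw [hh', hh', hherm])
    (fun w hw => by
      apply Subtype.ext
      apply hnd
      intro u
      obtain ⟨c, hc⟩ := hdec u
      have e1 : h (u - ψ c) w = 0 := hw ⟨_, hc⟩
      have e2 : h (ψ c) w = 0 := by
        rw [hψ, map_sum, LinearMap.sum_apply]
        refine Finset.sum_eq_zero fun s _ => ?_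
        rw [LinearMap.map_smulₛₗ, LinearMap.smul_apply, hWmem _ w.2, smul_zero]
      rw [map_sub, LinearMap.sub_apply, e2, sub_zero] at e1
      exact e1)
    x' (fun u w => by rw [hh', hh']; exact hskew _ _)
    (by
      obtain ⟨k, hk⟩ := hnil
      refine ⟨k, ?_⟩
      ext u
      rw [hx', hk]; rfl)
  refine ⟨r + 1, Fin.cons d d', Fin.cons v (fun i => (v' i : V)), ?_, ?_, ?_, ?_, ?_, ?_⟩
  · intro i
    refine Fin.cases ?_ (fun i => ?_) i
    · simpa using hd1
    · simpa using h1 i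
  · intro i
    refine Fin.cases ?_ (fun i => ?_) i
    · simpa using hxd
    · simp only [Fin.cons_succ]
      rw [← hx', h2]; rfl
  · intro i j s
    refine Fin.cases ?_ (fun i => ?_) i <;> refine Fin.cases ?_ (fun j => ?_) j
    · simp
    · intro _
      simp only [Fin.cons_succ, Fin.cons_zero]
      rw [← hx']
      simpa using hWmem _ ((x' ^ s) (v' j)).2 0
    · intro _
      simp only [Fin.cons_succ, Fin.cons_zero]
      rw [hherm, hWmem _ (v' i).2, star_zero]
    · intro hij
      simp only [Fin.cons_succ]
      rw [← hx']
      exact h3 i j s (fun e => hij (by rw [e]))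
  · intro i
    refine Fin.cases ?_ (fun i => ?_) i
    · simpa using hv
    · simp only [Fin.cons_succ]
      rw [← hx']
      exact h4 i
  · rw [Fin.sum_univ_succ]
    simp only [Fin.cons_succ, Fin.cons_zero]
    omega
  · rw [eq_top_iff]
    intro u _
    obtain ⟨c, hc⟩ := hdec u
    rw [← sub_add_cancel u (ψ c)]
    apply Submodule.add_mem
    · have : (⟨u - ψ c, hc⟩ : W) ∈ Submodule.span K (Set.range fun p : Σ i, Fin (d' i) => (x' ^ (p.2 : ℕ)) (v' p.1)) := by
        rw [h6]; trivial
      have h7 := Submodule.mem_map_of_mem (f := W.subtype) this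
      rw [Submodule.map_span] at h7
      refine Submodule.span_mono ?_ h7
      rintro _ ⟨_, ⟨⟨i, s⟩, rfl⟩, rfl⟩
      refine ⟨⟨i.succ, s⟩, ?_⟩
      simp [hx']
    · rw [hψ]
      refine Submodule.sum_mem _ fun s _ => Submodule.smul_mem _ _ (Submodule.subset_span ?_)
      exact ⟨⟨0, s⟩, rfl⟩

end nf


section counting

theorem card_fiber_const {X Y : Type} [Finite X] [Finite Y] (f : X → Y) (c : ℕ)
    (hf : ∀ y, Nat.card {x // f x = y} = c) : Nat.card X = Nat.card Y * c := by
  have := Fintype.ofFinite Y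
  rw [← Nat.card_congr (Equiv.sigmaFiberEquiv f), Nat.card_sigma]
  simp [hf]

theorem double_count {X Y : Type} [Finite X] [Finite Y] (R : X → Y → Prop) (c c' : ℕ)
    (h1 : ∀ x, Nat.card {y // R x y} = c) (h2 : ∀ y, Nat.card {x // R x y} = c') :
    Nat.card X * c = Nat.card Y * c' := by
  rw [← card_fiber_const (X := {p : X × Y // R p.1 p.2}) (fun p => p.1.1) c,
    ← card_fiber_const (X := {p : X × Y // R p.1 p.2}) (fun p => p.1.2) c']
  · intro y
    rw [← h2 y]
    refine Nat.card_congr ⟨fun p => ⟨p.1.1.1, by have := p.1.2; rw [p.2] at this; exact this⟩,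
      fun x => ⟨⟨(x.1, y), x.2⟩, rfl⟩, ?_, ?_⟩
    · rintro ⟨⟨⟨x, y'⟩, h⟩, rfl⟩; rfl
    · rintro ⟨x, h⟩; rfl
  · intro x
    rw [← h1 x]
    refine Nat.card_congr ⟨fun p => ⟨p.1.1.2, by have := p.1.2; rw [p.2] at this; exact this⟩,
      fun y => ⟨⟨(x, y.1), y.2⟩, rfl⟩, ?_, ?_⟩
    · rintro ⟨⟨⟨x, y'⟩, h⟩, rfl⟩; rfl
    · rintro ⟨x, h⟩; rfl

end counting

section unitary
variable {K : Type} [Field K] [Fintype K] [StarRing K] {q : ℕ}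

/-- the sesquilinear form of a matrix -/
def sform {α : Type} [Fintype α] (a : Matrix α α K) : (α → K) →ₗ⋆[K] (α → K) →ₗ[K] K :=
  LinearMap.mk₂'ₛₗ (starRingEnd K) (RingHom.id K) (fun u v => star u ⬝ᵥ (a *ᵥ v))
    (by intro u u' v; simp [add_dotProduct])
    (by intro c u v; simp [smul_dotProduct, starRingEnd_apply])
    (by intro u v v'; simp [mulVec_add, dotProduct_add])
    (by intro c u v; simp [mulVec_smul, dotProduct_smul])

theorem sform_apply {α : Type} [Fintype α] (a : Matrix α α K) (u v : α → K) :
    sform a u v = star u ⬝ᵥ (a *ᵥ v) := rfl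

theorem dot_star_swap {α : Type} [Fintype α] (a : Matrix α α K) (u v : α → K) :
    star (a *ᵥ u) ⬝ᵥ v = star u ⬝ᵥ (aᴴ *ᵥ v) := by
  rw [star_mulVec, dotProduct_mulVec]

theorem star_dot {α : Type} [Fintype α] (u v : α → K) :
    star (star u ⬝ᵥ v) = star v ⬝ᵥ u := by
  rw [star_dotProduct, star_star]

theorem onb_form (hK : Fintype.card K = q ^ 2) (hs : ∀ a : K, star a = a ^ q)
    (V : Type) [AddCommGroup V] [Module K V] [FiniteDimensional K V]
    (h : V →ₗ⋆[K] V →ₗ[K] K)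
    (hherm : ∀ u v, h v u = star (h u v))
    (hnd : ∀ v, (∀ u, h u v = 0) → v = 0) (N : ℕ) (hN : Module.finrank K V = N) :
    ∃ f : Fin N → V, ∀ i j, h (f i) (f j) = if i = j then 1 else 0 := by
  obtain ⟨t, ht0, ht⟩ := exists_skew_scalar hK hs
  obtain ⟨r, d, v, h1, h2, h3, h4, h5, h6⟩ := nf hK hs (fun d => if Even (d - 1) then 1 else t)
    (by
      intro d hd
      by_cases hev : Even (d - 1)
      · simp [hev]
      · simp [hev, ht0, ht, (Nat.not_even_iff_odd.1 hev).neg_one_pow]) N V hN h hherm hnd 0 (by simp) IsNilpotent.zero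
  have hd : ∀ i, d i = 1 := by
    intro i
    have := h4 i
    by_contra hne
    have h7 : d i - 1 ≠ 0 := by have := h1 i; omega
    rw [zero_pow h7] at this
    simp only [LinearMap.zero_apply, map_zero] at this
    split_ifs at this
    · exact zero_ne_one this
    · exact ht0 this.symm
  have hr : r = N := by simpa [hd] using h5
  subst hr
  refine ⟨v, fun i j => ?_⟩
  split_ifs with hij
  · subst hij
    simpa [hd] using h4 i
  · simpa using h3 i j 0 hij

variable (K) in
/-- order of the unitary group -/
noncomputable def cU (α : Type) [Fintype α] [DecidableEq α] : ℕ :=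
  Nat.card {P : Matrix α α K // Pᴴ * P = 1}
variable (K) in
/-- number of nilpotent skew-Hermitian matrices -/
noncomputable def cN (α : Type) [Fintype α] [DecidableEq α] : ℕ :=
  Nat.card {a : Matrix α α K // aᴴ = -a ∧ IsNilpotent a}
variable (K) in
/-- number of invertible skew-Hermitian matrices -/
noncomputable def cI (α : Type) [Fintype α] [DecidableEq α] : ℕ :=
  Nat.card {a : Matrix α α K // aᴴ = -a ∧ IsUnit a}

theorem cU_pos (α : Type) [Fintype α] [DecidableEq α] : 0 < cU K α := by
  have : Nonempty {P : Matrix α α K // Pᴴ * P = 1} := ⟨⟨1, by simp⟩⟩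
  exact Nat.card_pos

theorem cU_rect (α β : Type) [Fintype α] [DecidableEq α] [Fintype β] [DecidableEq β] (e : α ≃ β) :
    Nat.card {P : Matrix α β K // Pᴴ * P = 1} = cU K α := by
  refine Nat.card_congr ((Matrix.reindex (Equiv.refl α) e.symm).subtypeEquiv fun P => ?_)
  simp only [reindex_apply, conjTranspose_submatrix, Equiv.refl_symm, Equiv.symm_symm, Equiv.coe_refl]
  rw [show (Pᴴ.submatrix (⇑e) id * P.submatrix id ⇑e) = (Pᴴ * P).submatrix e e from
    (Matrix.submatrix_mul _ _ _ _ _ Function.bijective_id).symm]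
  constructor
  · intro h; rw [h, submatrix_one_equiv]
  · intro h
    ext i j
    have := congrFun (congrFun h (e.symm i)) (e.symm j)
    simpa [Matrix.one_apply] using this

theorem card_GL_eq (hK : Fintype.card K = q ^ 2) (hs : ∀ a : K, star a = a ^ q) (m : ℕ) :
    ∏ i : Fin m, ((q ^ 2) ^ m - (q ^ 2) ^ (i : ℕ)) = cI K (Fin m) * cU K (Fin m) := by
  obtain ⟨t, ht0, ht⟩ := exists_skew_scalar hK hs
  have h1 := Matrix.card_GL_field (𝔽 := K) m
  rw [hK] at h1
  rw [← h1]
  refine card_fiber_const (fun b : GL (Fin m) K => (⟨t • ((b : Matrix (Fin m) (Fin m) K)ᴴ * b), ?_, ?_⟩ :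
    {a : Matrix (Fin m) (Fin m) K // aᴴ = -a ∧ IsUnit a})) _ ?_
  · rw [conjTranspose_smul, ht, conjTranspose_mul, conjTranspose_conjTranspose, neg_smul]
  · have hb : IsUnit (b : Matrix (Fin m) (Fin m) K) := b.isUnit
    have := (hb.star).mul hb
    have h2 : t • ((b : Matrix (Fin m) (Fin m) K)ᴴ * (b : Matrix (Fin m) (Fin m) K)) =
        (Units.mk0 t ht0) • ((b : Matrix (Fin m) (Fin m) K)ᴴ * (b : Matrix (Fin m) (Fin m) K)) := rfl
    rw [h2]
    exact this.smul _
  · rintro ⟨a, ha, hau⟩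
    -- existence
    have hex : ∃ b0 : Matrix (Fin m) (Fin m) K, IsUnit b0 ∧ t • (b0ᴴ * b0) = a := by
      have hct : (t⁻¹ • a)ᴴ = t⁻¹ • a := by
        rw [conjTranspose_smul, ha, star_inv₀, ht, inv_neg, smul_neg, neg_smul, neg_neg]
      obtain ⟨f, hf⟩ := onb_form hK hs (Fin m → K) (sform (t⁻¹ • a))
        (by
          intro u v
          rw [sform_apply, sform_apply, star_dot, dot_star_swap, hct])
        (by
          intro v hv
          have h2 : (t⁻¹ • a) *ᵥ v = 0 := by
            ext i
            have := hv (star (Pi.single i 1))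
            rw [sform_apply, star_star, single_one_dotProduct] at this
            exact this
          rw [smul_mulVec] at h2
          have h3 : a *ᵥ v = 0 := by
            rcases smul_eq_zero.1 h2 with h | h
            · exact absurd (inv_eq_zero.1 h) ht0
            · exact h
          exact (Matrix.mulVec_injective_iff_isUnit.2 hau) (by rw [h3, mulVec_zero]))
        m (by simp)
      let F : Matrix (Fin m) (Fin m) K := Matrix.of fun i j => f j i
      have hF : Fᴴ * ((t⁻¹ • a) * F) = 1 := by
        ext i j
        have := hf i j
        rw [sform_apply] at this
        rw [Matrix.one_apply, ← this]
        rfl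
      have hFu : IsUnit F := by
        have : (Fᴴ * (t⁻¹ • a)) * F = 1 := by rw [mul_assoc, hF]
        exact IsUnit.of_mul_eq_one_right _ this
      clear_value F
      obtain ⟨G, rfl⟩ := hFu
      refine ⟨(G⁻¹ : GL (Fin m) K), (G⁻¹).isUnit, ?_⟩
      have h4 : (G : Matrix (Fin m) (Fin m) K) * (G⁻¹ : GL (Fin m) K) = 1 := by
        rw [← Units.val_mul]; simp
      have h5 : ((G⁻¹ : GL (Fin m) K) : Matrix (Fin m) (Fin m) K)ᴴ * (G : Matrix (Fin m) (Fin m) K)ᴴ = 1 := by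
        rw [← conjTranspose_mul, h4, conjTranspose_one]
      have h6 : t⁻¹ • a = ((G⁻¹ : GL (Fin m) K) : Matrix (Fin m) (Fin m) K)ᴴ * (G⁻¹ : GL (Fin m) K) := by
        calc t⁻¹ • a = (((G⁻¹ : GL (Fin m) K) : Matrix (Fin m) (Fin m) K)ᴴ * (G : Matrix (Fin m) (Fin m) K)ᴴ) *
              (t⁻¹ • a) * ((G : Matrix (Fin m) (Fin m) K) * (G⁻¹ : GL (Fin m) K)) := by rw [h4, h5]; simp
          _ = ((G⁻¹ : GL (Fin m) K) : Matrix (Fin m) (Fin m) K)ᴴ * ((G : Matrix (Fin m) (Fin m) K)ᴴ *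
              ((t⁻¹ • a) * (G : Matrix (Fin m) (Fin m) K))) * (G⁻¹ : GL (Fin m) K) := by simp only [mul_assoc]
          _ = _ := by rw [hF, mul_one]
      rw [← h6, smul_smul, mul_inv_cancel₀ ht0, one_smul]
    obtain ⟨_, ⟨b0, rfl⟩, rfl⟩ := hex
    symm
    refine Nat.card_eq_of_bijective (fun s : {P : Matrix (Fin m) (Fin m) K // Pᴴ * P = 1} =>
      ⟨⟨s.1, s.1ᴴ, mul_eq_one_comm.1 s.2, s.2⟩ * b0, ?_⟩) ⟨?_, ?_⟩
    · apply Subtype.ext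
      simp only [Units.val_mul, conjTranspose_mul]
      rw [mul_assoc, ← mul_assoc s.1ᴴ, s.2, one_mul]
    · intro s s' h
      have h1 := congrArg (fun z => (z.1 * b0⁻¹ : GL (Fin m) K).1) h
      simp only [mul_inv_cancel_right] at h1
      exact Subtype.ext h1
    · rintro ⟨b, hb⟩
      have hb' := congrArg Subtype.val hb
      simp only at hb'
      have hb2 : (b : Matrix (Fin m) (Fin m) K)ᴴ * b = (b0 : Matrix (Fin m) (Fin m) K)ᴴ * b0 :=
        smul_right_injective _ ht0 hb'
      refine ⟨⟨((b * b0⁻¹ : GL (Fin m) K) : Matrix (Fin m) (Fin m) K), ?_⟩, ?_⟩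
      · have h4 : (b0 : Matrix (Fin m) (Fin m) K) * (b0⁻¹ : GL (Fin m) K) = 1 := by
          rw [← Units.val_mul]; simp
        rw [Units.val_mul, conjTranspose_mul, mul_assoc, ← mul_assoc _ (b : Matrix (Fin m) (Fin m) K), hb2,
          mul_assoc, h4, mul_one, ← conjTranspose_mul, h4, conjTranspose_one]
      · apply Subtype.ext
        apply Units.ext
        simp

end unitary


section unitary2
variable {K : Type} [Field K] [Fintype K] [StarRing K] {q : ℕ}

open Classical in
theorem card_norm_sum (hK : Fintype.card K = q ^ 2) (hs : ∀ a : K, star a = a ^ q) (m : ℕ) :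
    ∀ c : K, star c = c → (q : ℤ) * (Nat.card {v : Fin m → K // ∑ i, star (v i) * v i = c} : ℤ) =
      q ^ (2 * m) + (-1) ^ m * q ^ m * (q * (if c = 0 then 1 else 0) - 1) := by
  induction m with
  | zero =>
    intro c hc
    by_cases h0 : c = 0
    · subst h0
      simp
    · simp [h0, Ne.symm h0]
  | succ m ih =>
    intro c hc
    have e1 : Nat.card {v : Fin (m+1) → K // ∑ i, star (v i) * v i = c} =
        ∑ t : K, Nat.card {v : Fin m → K // ∑ i, star (v i) * v i = c - star t * t} := by
      rw [← Nat.card_sigma]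
      refine Nat.card_congr ⟨fun v => ⟨v.1 0, Fin.tail v.1, ?_⟩, fun v => ⟨Fin.cons v.1 v.2.1, ?_⟩, ?_, ?_⟩
      · have := v.2
        rw [Fin.sum_univ_succ] at this
        exact eq_sub_of_add_eq' this
      · rw [Fin.sum_univ_succ]
        simp only [Fin.cons_zero, Fin.cons_succ]
        rw [v.2.2]; ring
      · rintro ⟨v, hv⟩
        simp
      · rintro ⟨t, v, hv⟩
        rfl
    have e2 : (∑ t : K, (if c - star t * t = 0 then (1:ℤ) else 0)) = (q + 1) - q * (if c = 0 then 1 else 0) := by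
      rw [Finset.sum_boole]
      by_cases h0 : c = 0
      · subst h0
        have := card_norm_zero hK hs
        simp only [zero_sub, neg_eq_zero]
        rw [this]; simp
      · have := card_norm_ne hK hs c hc h0
        simp only [sub_eq_zero, eq_comm (a := c)]
        rw [this]; simp [Ne.symm h0]
    have e3 : ∑ t : K, (1 : ℤ) = (q:ℤ) ^ 2 := by
      rw [Finset.sum_const, Finset.card_univ, hK]; simp
    rw [e1]
    push_cast
    rw [Finset.mul_sum, Finset.sum_congr rfl (fun t _ => ih (c - star t * t) (by simp [hc, mul_comm]))]
    calc ∑ t : K, ((q:ℤ) ^ (2 * m) + (-1) ^ m * q ^ m * (q * (if c - star t * t = 0 then 1 else 0) - 1))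
        = (q:ℤ) ^ (2 * m) * ∑ t : K, (1 : ℤ) + (-1) ^ m * q ^ m *
          (q * (∑ t : K, (if c - star t * t = 0 then (1:ℤ) else 0)) - ∑ t : K, (1 : ℤ)) := by
          simp only [Finset.mul_sum, ← Finset.sum_sub_distrib, ← Finset.sum_add_distrib, mul_one]
      _ = _ := by
          rw [e2, e3]; ring

theorem std_nd {α : Type} [Fintype α] [DecidableEq α] (v : α → K) (hv : ∀ u : α → K, star u ⬝ᵥ v = 0) : v = 0 := by
  ext i
  have := hv (star (Pi.single i 1))
  rw [star_star, single_one_dotProduct] at this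
  exact this

/-- orthonormal bases of nondegenerate subspaces -/
theorem onb_sub (hK : Fintype.card K = q ^ 2) (hs : ∀ a : K, star a = a ^ q)
    {α : Type} [Fintype α] [DecidableEq α] (W : Submodule K (α → K))
    (hW : ∀ w ∈ W, (∀ u ∈ W, star u ⬝ᵥ w = 0) → w = 0) (N : ℕ) (hN : Module.finrank K W = N) :
    ∃ f : Matrix α (Fin N) K, fᴴ * f = 1 ∧ ∀ i, (fun j => f j i) ∈ W := by
  obtain ⟨f, hf⟩ := onb_form hK hs W ((sform (1 : Matrix α α K)).domRestrict₁₂ W W)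
    (by
      intro u v
      simp only [LinearMap.domRestrict₁₂_apply, sform_apply, one_mulVec]
      rw [star_dot])
    (by
      intro v hv
      apply Subtype.ext
      apply hW v v.2
      intro u hu
      have := hv ⟨u, hu⟩
      simpa only [LinearMap.domRestrict₁₂_apply, sform_apply, one_mulVec] using this) N hN
  refine ⟨Matrix.of fun j i => (f i : α → K) j, ?_, fun i => (f i).2⟩
  ext i j
  have := hf i j
  simp only [LinearMap.domRestrict₁₂_apply, sform_apply, one_mulVec] at this
  rw [Matrix.one_apply, ← this]
  rfl

theorem cross_zero {α β γ : Type} [Fintype α] (f : Matrix α β K) (g : Matrix α γ K)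
    (h : ∀ i j, star (fun l => f l i) ⬝ᵥ (fun l => g l j) = 0) : fᴴ * g = 0 := by
  ext i j
  exact h i j

theorem exists_col (hK : Fintype.card K = q ^ 2) (hs : ∀ a : K, star a = a ^ q) (m : ℕ)
    (v : Fin (m+1) → K) (hv : star v ⬝ᵥ v = 1) :
    ∃ P : Matrix (Fin (m+1)) (Unit ⊕ Fin m) K, Pᴴ * P = 1 ∧ ∀ i, P i (Sum.inl ()) = v i := by
  set φ := sform (1 : Matrix (Fin (m+1)) (Fin (m+1)) K) v with hφ
  have hφa : ∀ u, φ u = star v ⬝ᵥ u := by intro u; rw [hφ, sform_apply, one_mulVec]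
  have hφ0 : φ ≠ 0 := by
    intro h
    have := hφa v
    rw [h, hv] at this
    simp at this
  have hfin : Module.finrank K (LinearMap.ker φ) = m := by
    have := Module.Dual.finrank_ker_add_one_of_ne_zero (f := φ) hφ0
    rw [Module.finrank_fin_fun] at this
    omega
  obtain ⟨f, hf, hfm⟩ := onb_sub hK hs (LinearMap.ker φ) (by
    intro w hw hu
    rw [LinearMap.mem_ker, hφa] at hw
    apply std_nd
    intro u
    have h1 := hu (u - (star v ⬝ᵥ u) • v) (by
      rw [LinearMap.mem_ker, hφa, dotProduct_sub, dotProduct_smul, hv]; simp)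
    rw [star_sub, star_smul, sub_dotProduct, smul_dotProduct, hw] at h1
    simpa using h1) m hfin
  refine ⟨fromCols (Matrix.of fun i _ => v i) f, ?_, fun i => rfl⟩
  rw [conjTranspose_fromCols_eq_fromRows_conjTranspose, fromRows_mul_fromCols, hf, ← fromBlocks_one]
  congr 1
  · ext i j
    exact hv
  · apply cross_zero
    intro i j
    have := hfm j
    rw [LinearMap.mem_ker, hφa] at this
    exact this
  · apply cross_zero
    intro i j
    have := hfm i
    rw [LinearMap.mem_ker, hφa] at this
    have h2 := star_dot v (fun l => f l i)
    rw [this, star_zero] at h2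
    exact h2.symm

theorem cU_succ (hK : Fintype.card K = q ^ 2) (hs : ∀ a : K, star a = a ^ q) (m : ℕ) :
    cU K (Fin (m+1)) = Nat.card {v : Fin (m+1) → K // ∑ i, star (v i) * v i = 1} * cU K (Fin m) := by
  have e : Fin (m+1) ≃ Unit ⊕ Fin m := Fintype.equivOfCardEq (by simp [add_comm])
  rw [← cU_rect (Fin (m+1)) (Unit ⊕ Fin m) e]
  refine card_fiber_const (fun P => ⟨fun i => P.1 i (Sum.inl ()), ?hunit⟩) _ ?_
  case hunit =>
    have := congrFun (congrFun P.2 (Sum.inl ())) (Sum.inl ())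
    simpa [Matrix.mul_apply] using this
  · rintro ⟨v, hv⟩
    obtain ⟨P0, hP0, hc0⟩ := exists_col hK hs m v hv
    have hP0' : P0 * P0ᴴ = 1 := (mul_eq_one_comm_of_card_eq _ _ _ (Fintype.card_congr e).symm).1 hP0
    symm
    refine Nat.card_eq_of_bijective (fun s : {P : Matrix (Fin m) (Fin m) K // Pᴴ * P = 1} =>
      ⟨⟨P0 * fromBlocks (1 : Matrix Unit Unit K) (0 : Matrix Unit (Fin m) K) (0 : Matrix (Fin m) Unit K) s.1, ?_⟩, ?_⟩) ⟨?_, ?_⟩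
    · rw [conjTranspose_mul, Matrix.mul_assoc, ← Matrix.mul_assoc P0ᴴ, hP0, Matrix.one_mul, fromBlocks_conjTranspose, fromBlocks_multiply]
      simp [s.2]
    · apply Subtype.ext
      ext i
      simp only [Matrix.mul_apply, Fintype.sum_sum_type]
      simp [hc0]
    · intro s s' h
      have h1 := congrArg (fun z => P0ᴴ * z.1.1) h
      simp only [← Matrix.mul_assoc, hP0, Matrix.one_mul, fromBlocks_inj] at h1
      exact Subtype.ext h1.2.2.2
    · rintro ⟨⟨P, hP⟩, hPv⟩
      have hcol : ∀ i, P i (Sum.inl ()) = v i := fun i => congrFun (congrArg Subtype.val hPv) i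
      set R := P0ᴴ * P with hR
      have hRR : Rᴴ * R = 1 := by
        rw [hR, conjTranspose_mul, conjTranspose_conjTranspose, Matrix.mul_assoc, ← Matrix.mul_assoc P0, hP0', Matrix.one_mul, hP]
      have hRc : ∀ j, R j (Sum.inl ()) = (1 : Matrix (Unit ⊕ Fin m) (Unit ⊕ Fin m) K) j (Sum.inl ()) := by
        intro j
        rw [← hP0, hR, Matrix.mul_apply, Matrix.mul_apply]
        simp only [hcol, hc0]
      have h11 : R.toBlocks₁₁ = 1 := by
        ext i j
        have := hRc (Sum.inl i)
        simpa [toBlocks₁₁] using this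
      have h21 : R.toBlocks₂₁ = 0 := by
        ext i j
        have := hRc (Sum.inr i)
        simpa [toBlocks₂₁] using this
      have hRb := fromBlocks_toBlocks R
      rw [h11, h21] at hRb
      rw [← hRb, fromBlocks_conjTranspose, fromBlocks_multiply, ← fromBlocks_one, fromBlocks_inj] at hRR
      simp only [conjTranspose_one, conjTranspose_zero, Matrix.one_mul, Matrix.zero_mul, Matrix.mul_zero, Matrix.mul_one, add_zero] at hRR
      obtain ⟨-, h12, -, h22⟩ := hRR
      rw [h12] at h22 hRb
      simp only [Matrix.mul_zero, zero_add] at h22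
      refine ⟨⟨R.toBlocks₂₂, h22⟩, ?_⟩
      apply Subtype.ext
      apply Subtype.ext
      simp only
      rw [hRb, hR, ← Matrix.mul_assoc, hP0', Matrix.one_mul]

end unitary2


section fitting
variable {K : Type} [Field K] [Fintype K] [StarRing K] {q : ℕ}

theorem card_skew_sq (hK : Fintype.card K = q ^ 2) (hs : ∀ a : K, star a = a ^ q)
    {α : Type} [Fintype α] [DecidableEq α] (A : Submodule K (Matrix α α K)) (hA : ∀ a ∈ A, aᴴ ∈ A) :
    Nat.card {a : Matrix α α K // a ∈ A ∧ aᴴ = -a} ^ 2 = Nat.card A := by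
  obtain ⟨t, ht⟩ := exists_not_fixed hK hs
  have ht' : t - star t ≠ 0 := sub_ne_zero.2 ht.symm
  rw [sq, ← Nat.card_prod]
  refine Nat.card_eq_of_bijective (fun p => ⟨p.1.1 + t • p.2.1, A.add_mem p.1.2.1 (A.smul_mem _ p.2.2.1)⟩) ⟨?_, ?_⟩
  · rintro ⟨⟨a, ha, ha'⟩, ⟨b, hb, hb'⟩⟩ ⟨⟨c, hc, hc'⟩, ⟨d, hd, hd'⟩⟩ h
    have h1 : a + t • b = c + t • d := congrArg Subtype.val h
    have h2 := congrArg conjTranspose h1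
    simp only [conjTranspose_add, conjTranspose_smul, ha', hb', hc', hd'] at h2
    have h3 : (t - star t) • b = (t - star t) • d := by
      rw [sub_smul, sub_smul]
      simp only [smul_neg] at h2
      have := congrArg₂ (· + ·) h1 h2
      calc t • b - star t • b = (a + t • b) + (-a + -(star t • b)) := by abel
        _ = (c + t • d) + (-c + -(star t • d)) := this
        _ = _ := by abel
    have h4 : b = d := smul_right_injective _ ht' h3
    subst h4
    have h5 : a = c := by simpa using h1
    subst h5
    rfl
  · rintro ⟨c, hc⟩
    have hc2 := hA c hc
    have hst : star (t - star t)⁻¹ = - (t - star t)⁻¹ := by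
      rw [star_inv₀, star_sub, star_star, ← neg_sub, inv_neg]
    set b := (t - star t)⁻¹ • (c + cᴴ) with hb
    have hbs : bᴴ = -b := by
      rw [hb, conjTranspose_smul, hst, conjTranspose_add, conjTranspose_conjTranspose, neg_smul, add_comm]
    have hb2 : (t - star t) • b = c + cᴴ := by
      rw [hb, smul_smul, mul_inv_cancel₀ ht', one_smul]
    have hbA : b ∈ A := A.smul_mem _ (A.add_mem hc hc2)
    refine ⟨(⟨c - t • b, A.sub_mem hc (A.smul_mem _ hbA), ?_⟩, ⟨b, hbA, hbs⟩), ?_⟩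
    · rw [conjTranspose_sub, conjTranspose_smul, hbs]
      rw [sub_smul, sub_eq_iff_eq_add] at hb2
      rw [hb2]
      simp only [smul_neg]
      abel
    · apply Subtype.ext
      simp

theorem card_skew (hK : Fintype.card K = q ^ 2) (hs : ∀ a : K, star a = a ^ q)
    {α : Type} [Fintype α] [DecidableEq α] (A : Submodule K (Matrix α α K)) (hA : ∀ a ∈ A, aᴴ ∈ A)
    (N : ℕ) (hN : Nat.card A = (q ^ 2) ^ N) :
    Nat.card {a : Matrix α α K // a ∈ A ∧ aᴴ = -a} = q ^ N := by
  have := card_skew_sq hK hs A hA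
  rw [hN, ← pow_mul, mul_comm, pow_mul] at this
  exact Nat.pow_left_injective (n := 2) (by norm_num) this

theorem card_skew_univ (hK : Fintype.card K = q ^ 2) (hs : ∀ a : K, star a = a ^ q)
    (α : Type) [Fintype α] [DecidableEq α] :
    Nat.card {a : Matrix α α K // aᴴ = -a} = q ^ (Fintype.card α ^ 2) := by
  have := card_skew hK hs (⊤ : Submodule K (Matrix α α K)) (by simp) (Fintype.card α ^ 2) (by
    rw [Nat.card_congr (Equiv.subtypeUnivEquiv (by simp))]
    change Nat.card (α → α → K) = _
    rw [Nat.card_eq_fintype_card, Fintype.card_fun, Fintype.card_fun, hK, ← pow_mul (q ^ 2), sq (Fintype.card α)])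
  simpa using this

/-- `P` is a unitary frame adapted to the Fitting decomposition of `a` -/
def Good {α β γ : Type} [Fintype α] [Fintype β] [Fintype γ] [DecidableEq β] [DecidableEq γ]
    (P : Matrix α (β ⊕ γ) K) (a : Matrix α α K) : Prop :=
  ∃ (n : Matrix β β K) (u : Matrix γ γ K), Pᴴ * a * P = fromBlocks n 0 0 u ∧ IsNilpotent n ∧ IsUnit u

theorem intertwine0 {β γ : Type} [Fintype β] [Fintype γ] [DecidableEq β] [DecidableEq γ]
    (n : Matrix β β K) (u : Matrix γ γ K) (hn : IsNilpotent n) (hu : IsUnit u) (w : Matrix β γ K)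
    (h : n * w = w * u) : w = 0 := by
  obtain ⟨k, hk⟩ := hn
  have h1 : ∀ r : ℕ, n ^ r * w = w * u ^ r := by
    intro r
    induction r with
    | zero => simp
    | succ r ih => rw [pow_succ, Matrix.mul_assoc, h, ← Matrix.mul_assoc, ih, Matrix.mul_assoc, ← pow_succ]
  have h2 := h1 k
  rw [hk, Matrix.zero_mul] at h2
  obtain ⟨v, hv⟩ := hu.pow k
  have h3 : u ^ k * (v⁻¹ : (Matrix γ γ K)ˣ) = 1 := by rw [← hv]; simp
  have := congrArg (· * ((v⁻¹ : (Matrix γ γ K)ˣ) : Matrix γ γ K)) h2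
  simp only [Matrix.zero_mul, Matrix.mul_assoc, h3, Matrix.mul_one] at this
  exact this.symm

theorem intertwine0' {β γ : Type} [Fintype β] [Fintype γ] [DecidableEq β] [DecidableEq γ]
    (n : Matrix β β K) (u : Matrix γ γ K) (hn : IsNilpotent n) (hu : IsUnit u) (w : Matrix γ β K)
    (h : u * w = w * n) : w = 0 := by
  have h1 : nᵀ * wᵀ = wᵀ * uᵀ := by rw [← transpose_mul, ← transpose_mul, h]
  have := intertwine0 nᵀ uᵀ (by
    obtain ⟨k, hk⟩ := hn
    exact ⟨k, by rw [← transpose_pow, hk, transpose_zero]⟩) (by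
    rw [Matrix.isUnit_iff_isUnit_det, det_transpose, ← Matrix.isUnit_iff_isUnit_det]; exact hu) wᵀ h1
  exact transpose_eq_zero.1 this

theorem good_block {α β γ β' γ' : Type} [Fintype α] [DecidableEq α] [Fintype β] [Fintype γ] [DecidableEq β] [DecidableEq γ]
    [Fintype β'] [Fintype γ'] [DecidableEq β'] [DecidableEq γ']
    (P : Matrix α (β ⊕ γ) K) (P' : Matrix α (β' ⊕ γ') K) (a : Matrix α α K)
    (hP : P * Pᴴ = 1) (hP' : P' * P'ᴴ = 1) (h : Good P a) (h' : Good P' a) :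
    ∃ s t, Pᴴ * P' = fromBlocks s 0 0 t := by
  obtain ⟨n, u, e, hn, hu⟩ := h
  obtain ⟨n', u', e', hn', hu'⟩ := h'
  set w := Pᴴ * P' with hw
  have h1 : (Pᴴ * a * P) * w = w * (P'ᴴ * a * P') := by
    calc (Pᴴ * a * P) * w = Pᴴ * a * (P * Pᴴ) * P' := by simp only [hw, Matrix.mul_assoc]
      _ = Pᴴ * a * P' := by rw [hP, Matrix.mul_one]
      _ = Pᴴ * (P' * P'ᴴ) * a * P' := by rw [hP', Matrix.mul_one]
      _ = _ := by simp only [hw, Matrix.mul_assoc]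
  rw [e, e', ← fromBlocks_toBlocks w, fromBlocks_multiply, fromBlocks_multiply, fromBlocks_inj] at h1
  simp only [Matrix.zero_mul, Matrix.mul_zero, add_zero, zero_add] at h1
  obtain ⟨-, h12, h21, -⟩ := h1
  have e12 := intertwine0 n u' hn hu' _ h12
  have e21 := intertwine0' n' u hn' hu _ h21
  refine ⟨w.toBlocks₁₁, w.toBlocks₂₂, ?_⟩
  conv_lhs => rw [← fromBlocks_toBlocks w, e12, e21]

theorem good_card_le {α : Type} [Fintype α] [DecidableEq α] {k l k' l' : ℕ} (P : Matrix α (Fin k ⊕ Fin l) K)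
    (P' : Matrix α (Fin k' ⊕ Fin l') K) (a : Matrix α α K)
    (hP : P * Pᴴ = 1) (hP' : P' * P'ᴴ = 1) (hPi : P'ᴴ * P' = 1) (h : Good P a) (h' : Good P' a) :
    k' ≤ k := by
  obtain ⟨s, t, e⟩ := good_block P P' a hP hP' h h'
  have h1 : (Pᴴ * P')ᴴ * (Pᴴ * P') = 1 := by
    rw [conjTranspose_mul, conjTranspose_conjTranspose, Matrix.mul_assoc, ← Matrix.mul_assoc P, hP, Matrix.one_mul, hPi]
  rw [e, fromBlocks_conjTranspose, fromBlocks_multiply, ← fromBlocks_one, fromBlocks_inj] at h1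
  have h2 := h1.1
  simp only [conjTranspose_zero, Matrix.zero_mul, add_zero] at h2
  have h3 := rank_mul_le_right sᴴ s
  rw [h2, rank_one, Fintype.card_fin] at h3
  exact h3.trans (by simpa using rank_le_card_height s)

theorem exists_good (hK : Fintype.card K = q ^ 2) (hs : ∀ a : K, star a = a ^ q) (m : ℕ)
    (a : Matrix (Fin m) (Fin m) K) (ha : aᴴ = -a) :
    ∃ k, k ≤ m ∧ ∃ P : Matrix (Fin m) (Fin k ⊕ Fin (m - k)) K, Pᴴ * P = 1 ∧ Good P a := by
  set f : Module.End K (Fin m → K) := (Matrix.toLin' a) with hf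
  have hfa : ∀ v, f v = a *ᵥ v := fun v => by rw [hf, toLin'_apply]
  have hsk : ∀ (r : ℕ) (u v : Fin m → K), star ((f ^ r) u) ⬝ᵥ v = (-1) ^ r * (star u ⬝ᵥ (f ^ r) v) := by
    intro r u v
    have := skew_pow (sform (1 : Matrix (Fin m) (Fin m) K)) f (by
      intro u v
      simp only [sform_apply, one_mulVec]
      rw [hfa, hfa, dot_star_swap, ha, neg_mulVec, dotProduct_neg]) r u v
    simpa only [sform_apply, one_mulVec] using this
  set V0 := LinearMap.ker (f ^ (m+1)) with hV0
  set V1 := LinearMap.range (f ^ (m+1)) with hV1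
  have hker : LinearMap.ker (f ^ ((m+1) + (m+1))) = V0 := by
    rw [hV0, Module.End.ker_pow_eq_ker_pow_finrank_of_le (by simp; omega),
      Module.End.ker_pow_eq_ker_pow_finrank_of_le (m := m+1) (by simp)]
  have hdis : Disjoint V0 V1 := by
    rw [Submodule.disjoint_def]
    rintro _ h0 ⟨w, rfl⟩
    have : w ∈ LinearMap.ker (f ^ ((m+1) + (m+1))) := by
      rw [LinearMap.mem_ker, pow_add, Module.End.mul_apply]
      exact LinearMap.mem_ker.1 h0
    rw [hker] at this
    exact this
  have hrn := LinearMap.finrank_range_add_finrank_ker (f ^ (m+1))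
  rw [Module.finrank_fin_fun, ← hV0, ← hV1] at hrn
  have htop : V0 ⊔ V1 = ⊤ := Submodule.eq_top_of_disjoint _ _ (by rw [Module.finrank_fin_fun]; omega) hdis
  have horth : ∀ u ∈ V0, ∀ v ∈ V1, star u ⬝ᵥ v = 0 := by
    rintro u hu _ ⟨w, rfl⟩
    have h1 := hsk (m+1) u w
    rw [LinearMap.mem_ker.1 hu, star_zero, zero_dotProduct] at h1
    rcases mul_eq_zero.1 h1.symm with h | h
    · exact absurd h (pow_ne_zero _ (by simp))
    · exact h
  have horth' : ∀ u ∈ V1, ∀ v ∈ V0, star u ⬝ᵥ v = 0 := by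
    intro u hu v hv
    rw [← star_dot, horth v hv u hu, star_zero]
  have hdecomp : ∀ u, ∃ y ∈ V0, ∃ z ∈ V1, y + z = u := by
    intro u
    have : u ∈ V0 ⊔ V1 := by rw [htop]; trivial
    exact Submodule.mem_sup.1 this
  obtain ⟨f0, hf0, hf0m⟩ := onb_sub hK hs V0 (by
    intro w hw h
    apply std_nd
    intro u
    obtain ⟨y, hy, z, hz, rfl⟩ := hdecomp u
    rw [star_add, add_dotProduct, h y hy, horth' z hz w hw, add_zero]) (Module.finrank K V0) rfl
  obtain ⟨f1, hf1, hf1m⟩ := onb_sub hK hs V1 (by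
    intro w hw h
    apply std_nd
    intro u
    obtain ⟨y, hy, z, hz, rfl⟩ := hdecomp u
    rw [star_add, add_dotProduct, h z hz, horth y hy w hw, add_zero]) (m - Module.finrank K V0) (by omega)
  have ha0 : ∀ v ∈ V0, a *ᵥ v ∈ V0 := by
    intro v hv
    rw [← hfa, hV0, LinearMap.mem_ker, ← Module.End.mul_apply, ← pow_succ, pow_succ', Module.End.mul_apply,
      LinearMap.mem_ker.1 hv, map_zero]
  have ha1 : ∀ v ∈ V1, a *ᵥ v ∈ V1 := by
    rintro _ ⟨w, rfl⟩
    rw [← hfa, ← Module.End.mul_apply, ← pow_succ', pow_succ, Module.End.mul_apply]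
    exact ⟨_, rfl⟩
  have hPP : (fromCols f0 f1)ᴴ * (fromCols f0 f1) = 1 := by
    rw [conjTranspose_fromCols_eq_fromRows_conjTranspose, fromRows_mul_fromCols, hf0, hf1, ← fromBlocks_one]
    congr 1
    · exact cross_zero _ _ fun i j => horth _ (hf0m i) _ (hf1m j)
    · exact cross_zero _ _ fun i j => horth' _ (hf1m i) _ (hf0m j)
  have hcardeq : Fintype.card (Fin (Module.finrank K V0) ⊕ Fin (m - Module.finrank K V0)) = Fintype.card (Fin m) := by
    simp; omega
  have hPP' := (mul_eq_one_comm_of_card_eq _ _ _ hcardeq).1 hPP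
  have hblk : (fromCols f0 f1)ᴴ * a * (fromCols f0 f1) = fromBlocks (f0ᴴ * (a * f0)) 0 0 (f1ᴴ * (a * f1)) := by
    rw [Matrix.mul_assoc, mul_fromCols, conjTranspose_fromCols_eq_fromRows_conjTranspose, fromRows_mul_fromCols]
    congr 1
    · exact cross_zero _ _ fun i j => horth _ (hf0m i) _ (ha1 _ (hf1m j))
    · exact cross_zero _ _ fun i j => horth' _ (hf1m i) _ (ha0 _ (hf0m j))
  have hpow : ∀ r : ℕ, (fromCols f0 f1)ᴴ * a ^ r * (fromCols f0 f1) =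
      fromBlocks ((f0ᴴ * (a * f0)) ^ r) 0 0 ((f1ᴴ * (a * f1)) ^ r) := by
    intro r
    induction r with
    | zero => simp [hPP, fromBlocks_one]
    | succ r ih =>
      calc (fromCols f0 f1)ᴴ * a ^ (r+1) * (fromCols f0 f1)
          = (fromCols f0 f1)ᴴ * a ^ r * (fromCols f0 f1 * (fromCols f0 f1)ᴴ) * a * (fromCols f0 f1) := by
            rw [hPP', Matrix.mul_one, pow_succ]; simp only [Matrix.mul_assoc]
        _ = ((fromCols f0 f1)ᴴ * a ^ r * (fromCols f0 f1)) * ((fromCols f0 f1)ᴴ * a * (fromCols f0 f1)) := by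
            simp only [Matrix.mul_assoc]
        _ = _ := by rw [ih, hblk, fromBlocks_multiply]; simp [pow_succ]
  refine ⟨Module.finrank K V0, by omega, fromCols f0 f1, hPP, _, _, hblk, ?_, ?_⟩
  · refine ⟨m+1, ?_⟩
    have h1 := hpow (m+1)
    rw [Matrix.mul_assoc, mul_fromCols, conjTranspose_fromCols_eq_fromRows_conjTranspose, fromRows_mul_fromCols, fromBlocks_inj] at h1
    rw [← h1.1]
    have : a ^ (m+1) * f0 = 0 := by
      ext i j
      have h2 := LinearMap.mem_ker.1 (hf0m j)
      rw [hf, ← toLin'_pow, toLin'_apply] at h2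
      exact congrFun h2 i
    rw [this, Matrix.mul_zero]
  · rw [← Matrix.mulVec_injective_iff_isUnit]
    rw [← Matrix.coe_mulVecLin, ← LinearMap.ker_eq_bot, LinearMap.ker_eq_bot']
    intro w hw
    rw [mulVecLin_apply] at hw
    have h1 : ((fromCols f0 f1)ᴴ * a * (fromCols f0 f1)) *ᵥ (Sum.elim 0 w) = 0 := by
      rw [hblk, fromBlocks_mulVec]
      ext i
      rcases i with i | i <;> simp [hw]
    have h2 : a *ᵥ (fromCols f0 f1 *ᵥ (Sum.elim 0 w)) = 0 := by
      have := congrArg (fun z => (fromCols f0 f1) *ᵥ z) h1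
      simp only [mulVec_mulVec, ← Matrix.mul_assoc, hPP', Matrix.one_mul, mulVec_zero] at this
      rw [mulVec_mulVec]; exact this
    have h3 : fromCols f0 f1 *ᵥ (Sum.elim 0 w) = f1 *ᵥ w := by
      rw [fromCols_mulVec]; simp
    rw [h3] at h2
    have h4 : f1 *ᵥ w ∈ V1 := by
      have : f1 *ᵥ w = ∑ j, w j • (fun i => f1 i j) := by
        ext i
        simp [mulVec, dotProduct, Finset.sum_apply, mul_comm]
      rw [this]
      exact Submodule.sum_mem _ fun j _ => Submodule.smul_mem _ _ (hf1m j)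
    have h5 : f1 *ᵥ w ∈ V0 := by
      refine LinearMap.mem_ker.2 ?_
      rw [pow_succ, Module.End.mul_apply, hfa, h2, map_zero]
    have h6 := Submodule.disjoint_def.1 hdis _ h5 h4
    have h7 := congrArg (fun z => f1ᴴ *ᵥ z) h6
    simp only [mulVec_mulVec, hf1, one_mulVec, mulVec_zero] at h7
    exact h7

end fitting


section fitcount
variable {K : Type} [Field K] [Fintype K] [StarRing K] {q : ℕ}

theorem good_count_a {α β γ : Type} [Fintype α] [DecidableEq α] [Fintype β] [Fintype γ] [DecidableEq β] [DecidableEq γ]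
    (P : Matrix α (β ⊕ γ) K) (h1 : Pᴴ * P = 1) (h2 : P * Pᴴ = 1) :
    Nat.card {a : Matrix α α K // aᴴ = -a ∧ Good P a} = cN K β * cI K γ := by
  unfold cN cI
  rw [← Nat.card_prod]
  symm
  have key : ∀ X : Matrix (β ⊕ γ) (β ⊕ γ) K, Pᴴ * (P * X * Pᴴ) * P = X := by
    intro X
    calc Pᴴ * (P * X * Pᴴ) * P = (Pᴴ * P) * X * (Pᴴ * P) := by simp only [Matrix.mul_assoc]
      _ = X := by rw [h1, Matrix.one_mul, Matrix.mul_one]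
  have key2 : ∀ X : Matrix α α K, P * (Pᴴ * X * P) * Pᴴ = X := by
    intro X
    calc P * (Pᴴ * X * P) * Pᴴ = (P * Pᴴ) * X * (P * Pᴴ) := by simp only [Matrix.mul_assoc]
      _ = X := by rw [h2, Matrix.one_mul, Matrix.mul_one]
  refine Nat.card_eq_of_bijective (fun p : {a : Matrix β β K // aᴴ = -a ∧ IsNilpotent a} ×
      {a : Matrix γ γ K // aᴴ = -a ∧ IsUnit a} =>
      (⟨P * (fromBlocks p.1.1 0 0 p.2.1 : Matrix (β ⊕ γ) (β ⊕ γ) K) * Pᴴ, ?_, p.1.1, p.2.1, key _, p.1.2.2, p.2.2.2⟩ :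
        {a : Matrix α α K // aᴴ = -a ∧ Good P a})) ⟨?_, ?_⟩
  · have : (fromBlocks p.1.1 0 0 p.2.1 : Matrix (β ⊕ γ) (β ⊕ γ) K)ᴴ = - fromBlocks p.1.1 0 0 p.2.1 := by
      rw [fromBlocks_conjTranspose, p.1.2.1, p.2.2.1, fromBlocks_neg]; simp
    rw [conjTranspose_mul, conjTranspose_mul, this, conjTranspose_conjTranspose, Matrix.neg_mul, Matrix.mul_neg,
      Matrix.mul_assoc]
  · rintro ⟨⟨a, ha⟩, ⟨b, hb⟩⟩ ⟨⟨c, hc⟩, ⟨d, hd⟩⟩ h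
    have h3 : P * (fromBlocks a 0 0 b : Matrix (β ⊕ γ) (β ⊕ γ) K) * Pᴴ = P * (fromBlocks c 0 0 d : Matrix (β ⊕ γ) (β ⊕ γ) K) * Pᴴ :=
      congrArg Subtype.val h
    have h4 := congrArg (fun X => Pᴴ * X * P) h3
    simp only [key, fromBlocks_inj] at h4
    obtain ⟨rfl, -, -, rfl⟩ := h4
    rfl
  · rintro ⟨a, ha, n, u, e, hn, hu⟩
    have h5 : (Pᴴ * a * P)ᴴ = - (Pᴴ * a * P) := by
      rw [conjTranspose_mul, conjTranspose_mul, ha, conjTranspose_conjTranspose, Matrix.neg_mul, Matrix.mul_neg,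
        Matrix.mul_assoc]
    rw [e, fromBlocks_conjTranspose, fromBlocks_neg, fromBlocks_inj] at h5
    refine ⟨(⟨n, h5.1, hn⟩, ⟨u, h5.2.2.2, hu⟩), Subtype.ext ?_⟩
    change P * (fromBlocks n 0 0 u : Matrix (β ⊕ γ) (β ⊕ γ) K) * Pᴴ = a
    rw [← e, key2]

theorem good_count_P {α β γ : Type} [Fintype α] [DecidableEq α] [Fintype β] [Fintype γ] [DecidableEq β] [DecidableEq γ]
    (hc : Fintype.card (β ⊕ γ) = Fintype.card α) (a : Matrix α α K)
    (P : Matrix α (β ⊕ γ) K) (h1 : Pᴴ * P = 1) (hP : Good P a) :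
    Nat.card {Q : Matrix α (β ⊕ γ) K // Qᴴ * Q = 1 ∧ Good Q a} = cU K β * cU K γ := by
  unfold cU
  rw [← Nat.card_prod]
  symm
  have h2 := (mul_eq_one_comm_of_card_eq _ _ _ hc).1 h1
  refine Nat.card_eq_of_bijective (fun p : {s : Matrix β β K // sᴴ * s = 1} ×
      {t : Matrix γ γ K // tᴴ * t = 1} =>
      (⟨P * (fromBlocks p.1.1 0 0 p.2.1 : Matrix (β ⊕ γ) (β ⊕ γ) K), ?_, ?_⟩ :
        {Q : Matrix α (β ⊕ γ) K // Qᴴ * Q = 1 ∧ Good Q a})) ⟨?_, ?_⟩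
  · rw [conjTranspose_mul, Matrix.mul_assoc, ← Matrix.mul_assoc Pᴴ, h1, Matrix.one_mul, fromBlocks_conjTranspose,
      fromBlocks_multiply]
    simp [p.1.2, p.2.2, fromBlocks_one]
  · obtain ⟨n, u, e, hn, hu⟩ := hP
    obtain ⟨⟨s, hs⟩, ⟨t, ht⟩⟩ := p
    refine ⟨sᴴ * n * s, tᴴ * u * t, ?_, ?_, ?_⟩
    · rw [conjTranspose_mul]
      calc (fromBlocks s 0 0 t : Matrix (β ⊕ γ) (β ⊕ γ) K)ᴴ * Pᴴ * a * (P * fromBlocks s 0 0 t)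
          = (fromBlocks s 0 0 t : Matrix (β ⊕ γ) (β ⊕ γ) K)ᴴ * (Pᴴ * a * P) * fromBlocks s 0 0 t := by
            simp only [Matrix.mul_assoc]
        _ = _ := by
            rw [e, fromBlocks_conjTranspose, fromBlocks_multiply, fromBlocks_multiply]; simp
    · obtain ⟨k, hk⟩ := hn
      refine ⟨k, ?_⟩
      have hs' : s * sᴴ = 1 := mul_eq_one_comm.1 hs
      have : ∀ r : ℕ, (sᴴ * n * s) ^ r = sᴴ * n ^ r * s := by
        intro r
        induction r with
        | zero => simp [hs]
        | succ r ih =>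
          calc (sᴴ * n * s) ^ (r+1) = sᴴ * n ^ r * (s * sᴴ) * n * s := by
                rw [pow_succ, ih]; simp only [Matrix.mul_assoc]
            _ = _ := by rw [hs', Matrix.mul_one, pow_succ]; simp only [Matrix.mul_assoc]
      rw [this, hk]; simp
    · exact (((IsUnit.of_mul_eq_one _ ht).mul hu).mul (IsUnit.of_mul_eq_one _ (mul_eq_one_comm.1 ht)))
  · rintro ⟨⟨a, ha⟩, ⟨b, hb⟩⟩ ⟨⟨c, hc⟩, ⟨d, hd⟩⟩ h
    have h3 : P * (fromBlocks a 0 0 b : Matrix (β ⊕ γ) (β ⊕ γ) K) = P * (fromBlocks c 0 0 d : Matrix (β ⊕ γ) (β ⊕ γ) K) :=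
      congrArg Subtype.val h
    have h4 := congrArg (fun X => Pᴴ * X) h3
    simp only [← Matrix.mul_assoc, h1, Matrix.one_mul, fromBlocks_inj] at h4
    obtain ⟨rfl, -, -, rfl⟩ := h4
    rfl
  · rintro ⟨Q, hQ, hQg⟩
    have hQ2 := (mul_eq_one_comm_of_card_eq _ _ _ hc).1 hQ
    obtain ⟨s, t, e⟩ := good_block P Q a h2 hQ2 hP hQg
    have h5 : (Pᴴ * Q)ᴴ * (Pᴴ * Q) = 1 := by
      rw [conjTranspose_mul, conjTranspose_conjTranspose, Matrix.mul_assoc, ← Matrix.mul_assoc P, h2, Matrix.one_mul, hQ]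
    rw [e, fromBlocks_conjTranspose, fromBlocks_multiply, ← fromBlocks_one, fromBlocks_inj] at h5
    simp only [conjTranspose_zero, Matrix.zero_mul, add_zero, zero_add] at h5
    refine ⟨(⟨s, h5.1⟩, ⟨t, h5.2.2.2⟩), Subtype.ext ?_⟩
    change P * (fromBlocks s 0 0 t : Matrix (β ⊕ γ) (β ⊕ γ) K) = Q
    rw [← e, ← Matrix.mul_assoc, h2, Matrix.one_mul]

variable (K) in
/-- skew-Hermitian matrices whose Fitting null component has dimension k -/
def fitSet (m k : ℕ) : Type := {a : Matrix (Fin m) (Fin m) K // aᴴ = -a ∧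
  ∃ P : Matrix (Fin m) (Fin k ⊕ Fin (m - k)) K, Pᴴ * P = 1 ∧ Good P a}

theorem fitSet_card (m k : ℕ) (hk : k ≤ m) :
    cU K (Fin m) * (cN K (Fin k) * cI K (Fin (m - k))) =
      Nat.card (fitSet K m k) * (cU K (Fin k) * cU K (Fin (m-k))) := by
  have hc : Fintype.card (Fin k ⊕ Fin (m - k)) = Fintype.card (Fin m) := by simp; omega
  have : Finite (fitSet K m k) := by unfold fitSet; infer_instance
  rw [← cU_rect (Fin m) (Fin k ⊕ Fin (m - k)) (Fintype.equivOfCardEq hc.symm)]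
  apply double_count (fun (P : {P : Matrix (Fin m) (Fin k ⊕ Fin (m - k)) K // Pᴴ * P = 1}) (a : fitSet K m k) =>
    Good P.1 a.1)
  · rintro ⟨P, hP⟩
    rw [← good_count_a P hP ((mul_eq_one_comm_of_card_eq _ _ _ hc).1 hP)]
    refine Nat.card_congr ⟨fun a => ⟨a.1.1, a.1.2.1, a.2⟩, fun a => ⟨⟨a.1, a.2.1, P, hP, a.2.2⟩, a.2.2⟩, ?_, ?_⟩
    · rintro ⟨⟨a, ha⟩, h⟩; rfl
    · rintro ⟨a, h⟩; rfl
  · rintro ⟨a, ha, P, hP, hg⟩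
    rw [← good_count_P hc a P hP hg]
    refine Nat.card_congr ⟨fun Q => ⟨Q.1.1, Q.1.2, Q.2⟩, fun Q => ⟨⟨Q.1, Q.2.1⟩, Q.2.2⟩, ?_, ?_⟩
    · rintro ⟨⟨a, ha⟩, h⟩; rfl
    · rintro ⟨a, h⟩; rfl

theorem fitSet_sum (hK : Fintype.card K = q ^ 2) (hs : ∀ a : K, star a = a ^ q) (m : ℕ) :
    ∑ k : Fin (m+1), Nat.card (fitSet K m k) = q ^ (m ^ 2) := by
  have h1 := card_skew_univ hK hs (Fin m)
  rw [Fintype.card_fin] at h1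
  rw [← h1]
  have : ∀ k, Finite (fitSet K m k) := fun k => by unfold fitSet; infer_instance
  rw [← Nat.card_sigma]
  refine Nat.card_eq_of_bijective (fun p : (Σ k : Fin (m+1), fitSet K m k) =>
    (⟨p.2.1, p.2.2.1⟩ : {a : Matrix (Fin m) (Fin m) K // aᴴ = -a})) ⟨?_, ?_⟩
  · rintro ⟨⟨k, hk⟩, ⟨a, ha, P, hP, hg⟩⟩ ⟨⟨l, hl⟩, ⟨b, hb, Q, hQ, hg'⟩⟩ h
    have h2 : a = b := congrArg Subtype.val h
    subst h2
    have hP' := (mul_eq_one_comm_of_card_eq _ _ _ (by simp; omega)).1 hP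
    have hQ' := (mul_eq_one_comm_of_card_eq _ _ _ (by simp; omega)).1 hQ
    have e : k = l := le_antisymm (good_card_le Q P a hQ' hP' hP hg' hg) (good_card_le P Q a hP' hQ' hQ hg hg')
    subst e
    rfl
  · rintro ⟨a, ha⟩
    obtain ⟨k, hk, P, hP, hg⟩ := exists_good hK hs m a ha
    exact ⟨⟨⟨k, by omega⟩, ⟨a, ha, P, hP, hg⟩⟩, rfl⟩

end fitcount


section qid

/-- the finite product `(p;p)_m` -/
def pP (p : ℚ) (m : ℕ) : ℚ := ∏ i ∈ Finset.range m, (1 - p ^ (i+1))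
/-- the finite product `(-p;p)_m` -/
def pM (p : ℚ) (m : ℕ) : ℚ := ∏ i ∈ Finset.range m, (1 + p ^ (i+1))

theorem pP_ne (p : ℚ) (hp : ∀ i : ℕ, 1 - p ^ (i+1) ≠ 0) (m : ℕ) : pP p m ≠ 0 :=
  Finset.prod_ne_zero_iff.2 fun i _ => hp i

open PowerSeries in
theorem q_identity (p : ℚ) (hp : ∀ i : ℕ, 1 - p ^ (i+1) ≠ 0) (m : ℕ) :
    ∑ x ∈ Finset.HasAntidiagonal.antidiagonal m, ((-p) ^ x.1 / pP p x.1) * (pM p x.2 / pP p x.2) = 1 / pP p m := by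
  set A : PowerSeries ℚ := PowerSeries.mk fun k => (-p) ^ k / pP p k with hA
  set B : PowerSeries ℚ := PowerSeries.mk fun k => pM p k / pP p k with hB
  have hP0 : pP p 0 = 1 := by simp [pP]
  have hM0 : pM p 0 = 1 := by simp [pM]
  have hPs : ∀ k, pP p (k+1) = pP p k * (1 - p ^ (k+1)) := fun k => Finset.prod_range_succ _ _
  have hMs : ∀ k, pM p (k+1) = pM p k * (1 + p ^ (k+1)) := fun k => Finset.prod_range_succ _ _
  have h1 : A * (1 + C p * X) = rescale p A := by
    ext k
    rw [coeff_rescale, mul_add, mul_one, ← mul_assoc, map_add]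
    rcases k with _ | k
    · simp [coeff_zero_mul_X]
    · rw [coeff_succ_mul_X, coeff_mul_C, hA, coeff_mk, coeff_mk, hPs]
      have := hp k
      have := pP_ne p hp k
      field_simp
      ring
  have h2 : B * (1 - X) = (1 + C p * X) * rescale p B := by
    ext k
    rw [mul_sub, mul_one, add_mul, one_mul, mul_assoc, map_sub, map_add, coeff_C_mul]
    rcases k with _ | k
    · simp
    · rw [coeff_succ_mul_X, coeff_succ_X_mul, coeff_rescale, coeff_rescale, hB, coeff_mk, coeff_mk, hPs, hMs]
      have := hp k
      have := pP_ne p hp k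
      field_simp
      ring
  have h3 : (A * B) * (1 - X) = rescale p (A * B) := by
    rw [mul_assoc, h2, ← mul_assoc, h1, map_mul]
  have h4 : ∀ m, coeff m (A * B) = 1 / pP p m := by
    intro m
    induction m with
    | zero => simp [hA, hB, coeff_mul, hP0, hM0]
    | succ m ih =>
      have h5 := congrArg (coeff (m+1)) h3
      rw [mul_sub, mul_one, map_sub, coeff_succ_mul_X, coeff_rescale, ih] at h5
      have := hp m
      have := pP_ne p hp m
      rw [hPs]
      have h6 : coeff (m+1) (A * B) * (1 - p ^ (m+1)) = 1 / pP p m := by linear_combination h5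
      rw [eq_div_iff (by positivity), mul_comm (pP p m), ← mul_assoc, h6]
      field_simp
  rw [← h4, coeff_mul]
  simp only [hA, hB, coeff_mk]

end qid

section fq
variable {K : Type} [Field K] [Fintype K] [StarRing K] {q : ℕ}

theorem one_sub_p_ne (hq : 2 ≤ q) (i : ℕ) : 1 - (-(q:ℚ)⁻¹) ^ (i+1) ≠ 0 := by
  intro h
  have h1 : (-(q:ℚ)⁻¹) ^ (i+1) = 1 := by linarith
  have h2 : |(-(q:ℚ)⁻¹)| ^ (i+1) = 1 := by rw [← abs_pow, h1]; simp
  have h3 : (2:ℚ) ≤ q := by exact_mod_cast hq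
  have h4 : |(-(q:ℚ)⁻¹)| < 1 := by
    rw [abs_neg, abs_of_pos (by positivity)]
    exact inv_lt_one_of_one_lt₀ (by linarith)
  have := pow_lt_one₀ (abs_nonneg _) h4 (Nat.succ_ne_zero i)
  simp only [Nat.succ_eq_add_one] at this
  linarith

theorem cU_eq (hK : Fintype.card K = q ^ 2) (hs : ∀ a : K, star a = a ^ q) (m : ℕ) :
    (cU K (Fin m) : ℚ) = (q:ℚ) ^ (m ^ 2) * pP (-(q:ℚ)⁻¹) m := by
  have hq := two_le_q hK
  have hq0 : (q:ℚ) ≠ 0 := by positivity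
  induction m with
  | zero =>
    have : cU K (Fin 0) = 1 := by
      unfold cU
      rw [Nat.card_eq_one_iff_unique]
      exact ⟨⟨fun a b => Subtype.ext (Subsingleton.elim _ _)⟩, ⟨⟨1, by simp⟩⟩⟩
    simp [this, pP]
  | succ m ih =>
    rw [cU_succ hK hs]
    have h1 := card_norm_sum hK hs (m+1) 1 (star_one K)
    rw [if_neg one_ne_zero] at h1
    have h2 : (q:ℚ) * (Nat.card {v : Fin (m+1) → K // ∑ i, star (v i) * v i = 1} : ℚ) =
      (q:ℚ)^(2*(m+1)) + (-1)^(m+1) * q^(m+1) * (q * 0 - 1) := by exact_mod_cast h1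
    have h3 : (Nat.card {v : Fin (m+1) → K // ∑ i, star (v i) * v i = 1} : ℚ) =
        (q:ℚ) ^ (2 * m + 1) * (1 - (-(q:ℚ)⁻¹) ^ (m+1)) := by
      apply mul_left_cancel₀ hq0
      rw [h2, neg_pow (q:ℚ)⁻¹, inv_pow]
      field_simp
      ring
    push_cast
    rw [h3, ih, pP, pP, Finset.prod_range_succ]
    ring

theorem cI_eq (hK : Fintype.card K = q ^ 2) (hs : ∀ a : K, star a = a ^ q) (m : ℕ) :
    (cI K (Fin m) : ℚ) = (q:ℚ) ^ (m ^ 2) * pM (-(q:ℚ)⁻¹) m := by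
  have hq := two_le_q hK
  have hq0 : (q:ℚ) ≠ 0 := by positivity
  have h1 := card_GL_eq hK hs m
  have h2 : (∏ i : Fin m, ((q^2)^m - (q^2)^(i:ℕ)) : ℕ) = ∏ i ∈ Finset.range m, ((q^2)^m - (q^2)^i) :=
    Fin.prod_univ_eq_prod_range (fun i => (q^2)^m - (q^2)^i) m
  rw [h2] at h1
  have h3 : ((∏ i ∈ Finset.range m, ((q^2)^m - (q^2)^i) : ℕ) : ℚ) =
      (q:ℚ)^(m^2) * q^(m^2) * (pM (-(q:ℚ)⁻¹) m * pP (-(q:ℚ)⁻¹) m) := by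
    rw [← Finset.prod_range_reflect, Nat.cast_prod, pM, pP, ← Finset.prod_mul_distrib]
    have : (q:ℚ)^(m^2) * q^(m^2) = ∏ i ∈ Finset.range m, ((q:ℚ)^m * q^m) := by
      rw [Finset.prod_const, Finset.card_range, mul_pow, ← pow_mul, sq]
    rw [this, ← Finset.prod_mul_distrib]
    refine Finset.prod_congr rfl fun i hi => ?_
    have hi := Finset.mem_range.1 hi
    rw [Nat.cast_sub (Nat.pow_le_pow_right (by positivity) (by omega))]
    push_cast
    have e : (q:ℚ)^m = q^(m-1-i) * q^(i+1) := by rw [← pow_add]; congr 1; omega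
    rw [neg_pow (q:ℚ)⁻¹, inv_pow]
    have e1 : ((-1:ℚ)^(i+1))^2 = 1 := by rw [← pow_mul, mul_comm, pow_mul]; simp
    rw [← pow_mul, ← pow_mul, mul_comm 2, mul_comm 2, pow_mul, pow_mul, e]
    have hh : (q:ℚ)^(i+1) ≠ 0 := by positivity
    generalize (q:ℚ)^(i+1) = z at *
    generalize (q:ℚ)^(m-1-i) = w at *
    generalize (-1:ℚ)^(i+1) = s at *
    field_simp
    linear_combination w^2 * e1
  have h4 := congrArg (Nat.cast : ℕ → ℚ) h1
  rw [h3, Nat.cast_mul, cU_eq hK hs] at h4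
  have := pP_ne (-(q:ℚ)⁻¹) (one_sub_p_ne hq) m
  have hh : (q:ℚ)^(m^2) ≠ 0 := by positivity
  have h5 : (q:ℚ) ^ m ^ 2 * pP (-(q:ℚ)⁻¹) m ≠ 0 := mul_ne_zero hh this
  apply mul_right_cancel₀ h5
  rw [← h4]; ring

theorem cN_fin_q (hK : Fintype.card K = q ^ 2) (hs : ∀ a : K, star a = a ^ q) (m : ℕ) :
    (cN K (Fin m) : ℚ) = (q:ℚ) ^ (m ^ 2) * ((q:ℚ)⁻¹) ^ m := by
  have hq := two_le_q hK
  have hq0 : (q:ℚ) ≠ 0 := by positivity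
  have hpne := one_sub_p_ne hq
  set p := -(q:ℚ)⁻¹ with hp
  have main : ∀ m, ∑ x ∈ Finset.HasAntidiagonal.antidiagonal m, ((cN K (Fin x.1) / (q:ℚ)^(x.1^2)) / pP p x.1) * (pM p x.2 / pP p x.2)
      = 1 / pP p m := by
    intro m
    have h1 := congrArg (Nat.cast : ℕ → ℚ) (fitSet_sum hK hs m)
    rw [Fin.sum_univ_eq_sum_range (fun k => Nat.card (fitSet K m k)) (m+1)] at h1
    rw [Finset.Nat.sum_antidiagonal_eq_sum_range_succ_mk]
    push_cast at h1
    have hh : (q:ℚ)^(m^2) ≠ 0 := by positivity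
    have h0 := pP_ne p hpne m
    rw [eq_div_iff h0]
    apply mul_left_cancel₀ hh
    rw [mul_one, Finset.sum_mul, Finset.mul_sum]
    refine Eq.trans ?_ h1
    refine Finset.sum_congr rfl fun k hk => ?_
    have hk : k ≤ m := by have := Finset.mem_range.1 hk; omega
    have h2 := congrArg (Nat.cast : ℕ → ℚ) (fitSet_card (K := K) m k hk)
    push_cast at h2
    rw [cU_eq hK hs, cU_eq hK hs, cU_eq hK hs, cI_eq hK hs, ← hp] at h2
    have := pP_ne p hpne k
    have := pP_ne p hpne (m-k)
    simp only
    field_simp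
    have h5 : (q:ℚ)^((m-k)^2) ≠ 0 := by positivity
    apply mul_right_cancel₀ h5
    linear_combination h2
  have e : ∀ m, (cN K (Fin m) / (q:ℚ)^(m^2)) = (-p) ^ m := by
    intro m
    induction m using Nat.strong_induction_on with
    | _ m ih =>
      have h1 := main m
      have h2 := q_identity p hpne m
      rw [← h2, Finset.Nat.sum_antidiagonal_eq_sum_range_succ_mk, Finset.Nat.sum_antidiagonal_eq_sum_range_succ_mk,
        Finset.sum_range_succ, Finset.sum_range_succ] at h1
      have h3 : ∀ f g : ℕ → ℚ, (∀ k < m, f k = g k) → ∑ k ∈ Finset.range m, f k = ∑ k ∈ Finset.range m, g k :=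
        fun f g h => Finset.sum_congr rfl fun k hk => h k (Finset.mem_range.1 hk)
      rw [h3 _ (fun k => ((-p) ^ k / pP p k) * (pM p (m-k) / pP p (m-k))) (fun k hk => by simp only; rw [ih k hk])] at h1
      have h4 := add_left_cancel h1
      simp only [Nat.sub_self] at h4
      have hz : pP p 0 = 1 := by simp [pP]
      have hz' : pM p 0 = 1 := by simp [pM]
      rw [hz, hz', div_one, mul_one, mul_one] at h4
      exact (div_left_inj' (pP_ne p hpne m)).1 h4
  have := e m
  rw [div_eq_iff (by positivity)] at this
  rw [this, hp, neg_neg, mul_comm]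

theorem cN_eq (hK : Fintype.card K = q ^ 2) (hs : ∀ a : K, star a = a ^ q) (α : Type) [Fintype α] [DecidableEq α] :
    cN K α * q ^ (Fintype.card α) = q ^ (Fintype.card α ^ 2) := by
  have hq := two_le_q hK
  have hq0 : (q:ℚ) ≠ 0 := by positivity
  set m := Fintype.card α
  have h1 : cN K α = cN K (Fin m) := by
    unfold cN
    refine Nat.card_congr ((Matrix.reindexAlgEquiv K K (Fintype.equivFin α)).toEquiv.subtypeEquiv fun a => ?_)
    have : ((Matrix.reindexAlgEquiv K K (Fintype.equivFin α)) a)ᴴ = (Matrix.reindexAlgEquiv K K (Fintype.equivFin α)) aᴴ := by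
      simp [Matrix.coe_reindexAlgEquiv, conjTranspose_submatrix]
    change _ ↔ ((Matrix.reindexAlgEquiv K K (Fintype.equivFin α)) a)ᴴ = - (Matrix.reindexAlgEquiv K K (Fintype.equivFin α)) a ∧
      IsNilpotent ((Matrix.reindexAlgEquiv K K (Fintype.equivFin α)) a)
    rw [this, ← map_neg, EmbeddingLike.apply_eq_iff_eq]
    refine and_congr Iff.rfl ?_
    exact (IsNilpotent.map_iff (AlgEquiv.injective _)).symm
  rw [h1]
  have h2 := cN_fin_q hK hs m
  have : ((cN K (Fin m) * q ^ m : ℕ) : ℚ) = ((q ^ (m^2) : ℕ) : ℚ) := by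
    push_cast
    rw [h2, inv_pow]
    field_simp
  exact_mod_cast this

end fq


section struc
variable {K : Type} [Field K] [Fintype K] [StarRing K] {q : ℕ}

theorem nilp_charpoly {α : Type} [Fintype α] [DecidableEq α] (T : Matrix α α K) (h : IsNilpotent T) :
    T.charpoly = Polynomial.X ^ Fintype.card α := by
  have := Matrix.isNilpotent_charpoly_sub_pow_of_isNilpotent h
  exact sub_eq_zero.1 this.eq_zero

theorem nilp_of_dvd {α : Type} [Fintype α] [DecidableEq α] (T : Matrix α α K) (N : ℕ)
    (h : T.charpoly ∣ Polynomial.X ^ N) : IsNilpotent T := by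
  obtain ⟨g, hg⟩ := h
  refine ⟨N, ?_⟩
  have := congrArg (Polynomial.aeval T) hg
  rw [map_mul, Matrix.aeval_self_charpoly, zero_mul] at this
  simpa using this

theorem nilp_blocks {α β : Type} [Fintype α] [DecidableEq α] [LinearOrder β] (T : Matrix α α K) (b : α → β)
    (hT : T.BlockTriangular b) : IsNilpotent T ↔ ∀ k, IsNilpotent (T.toSquareBlock b k) := by
  have h1 := hT.charpoly
  constructor
  · intro h k
    by_cases hk : k ∈ Finset.univ.image b
    · apply nilp_of_dvd _ (Fintype.card α)
      rw [← nilp_charpoly T h, h1]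
      exact Finset.dvd_prod_of_mem (fun k => (T.toSquareBlock b k).charpoly) hk
    · have : IsEmpty {a // b a = k} := ⟨fun a => hk (Finset.mem_image.2 ⟨a.1, Finset.mem_univ _, a.2⟩)⟩
      exact ⟨0, Subsingleton.elim _ _⟩
  · intro h
    apply nilp_of_dvd _ (∑ k ∈ Finset.univ.image b, Fintype.card {a // b a = k})
    rw [h1, ← Finset.prod_pow_eq_pow_sum]
    exact Finset.prod_dvd_prod_of_dvd _ _ fun k _ => by rw [nilp_charpoly _ (h k)]

/-- normal form data for a nilpotent skew-Hermitian matrix -/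
structure NF {n : ℕ} (x : Matrix (Fin n) (Fin n) K) where
  r : ℕ
  d : Fin r → ℕ
  v : Fin r → (Fin n → K)
  eps : ℕ → K
  hx : xᴴ = -x
  hnil : x ^ n = 0
  heps : ∀ d, 1 ≤ d → eps d ≠ 0 ∧ star (eps d) = (-1) ^ (d - 1) * eps d
  hd1 : ∀ i, 1 ≤ d i
  hd0 : ∀ i, x ^ d i *ᵥ v i = 0
  horth : ∀ i j s, i ≠ j → star (v i) ⬝ᵥ (x ^ s *ᵥ v j) = 0
  hself : ∀ i, star (v i) ⬝ᵥ (x ^ (d i - 1) *ᵥ v i) = eps (d i)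
  hsum : ∑ i, d i = n
  hspan : Submodule.span K (Set.range fun p : Σ i, Fin (d i) => x ^ (p.2 : ℕ) *ᵥ v p.1) = ⊤

theorem exists_NF (hK : Fintype.card K = q ^ 2) (hs : ∀ a : K, star a = a ^ q) {n : ℕ}
    (x : Matrix (Fin n) (Fin n) K) (hx : xᴴ = -x) (hnil : x ^ n = 0) : Nonempty (NF x) := by
  obtain ⟨t, ht0, ht⟩ := exists_skew_scalar hK hs
  have heps : ∀ d, 1 ≤ d → (if Even (d-1) then (1:K) else t) ≠ 0 ∧ star (if Even (d-1) then (1:K) else t)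
      = (-1) ^ (d - 1) * (if Even (d-1) then (1:K) else t) := by
    intro d _
    split_ifs with h
    · simp [h.neg_one_pow]
    · simp [(Nat.not_even_iff_odd.1 h).neg_one_pow, ht, ht0]
  have hp : ∀ s : ℕ, ∀ u, ((toLin' x) ^ s) u = x ^ s *ᵥ u := by
    intro s u
    rw [← toLin'_pow, toLin'_apply]
  obtain ⟨r, d, v, h1, h2, h3, h4, h5, h6⟩ := nf hK hs (fun d => if Even (d-1) then (1:K) else t) heps n (Fin n → K)
    (by simp) (sform 1) (by intro u v; simp only [sform_apply, one_mulVec]; rw [star_dot])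
    (by
      intro v hv
      apply std_nd
      intro u
      simpa [sform_apply] using hv u) (toLin' x)
    (by
      intro u v
      simp only [sform_apply, one_mulVec, toLin'_apply]
      rw [dot_star_swap, hx, neg_mulVec, dotProduct_neg])
    ⟨n, by rw [← toLin'_pow, hnil, map_zero]⟩
  simp only [hp, sform_apply, one_mulVec] at h2 h3 h4 h6
  exact ⟨⟨r, d, v, _, hx, hnil, heps, h1, h2, h3, h4, h5, h6⟩⟩

namespace NF
variable {n : ℕ} {x : Matrix (Fin n) (Fin n) K} (D : NF x)

/-- coordinate functionals modulo `xV` -/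
def phi (i : Fin D.r) : (Fin n → K) →ₗ[K] K :=
  (D.eps (D.d i))⁻¹ • (sform (x ^ (D.d i - 1)) (D.v i))

theorem phi_apply (i : Fin D.r) (u : Fin n → K) :
    D.phi i u = (D.eps (D.d i))⁻¹ * (star (D.v i) ⬝ᵥ (x ^ (D.d i - 1) *ᵥ u)) := rfl

theorem phi_v (i j : Fin D.r) : D.phi i (D.v j) = if i = j then 1 else 0 := by
  rw [phi_apply]
  split_ifs with h
  · subst h
    rw [D.hself, inv_mul_cancel₀ (D.heps _ (D.hd1 i)).1]
  · rw [D.horth _ _ _ h, mul_zero]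

theorem x_pow_star (D : NF x) (s : ℕ) : (x ^ s)ᴴ = (-1 : K) ^ s • x ^ s := by
  rw [conjTranspose_pow, D.hx, neg_pow]
  rcases Nat.even_or_odd s with h | h <;> simp [h.neg_one_pow]

theorem phi_x (i : Fin D.r) (u : Fin n → K) : D.phi i (x *ᵥ u) = 0 := by
  rw [phi_apply, mulVec_mulVec, ← pow_succ, Nat.sub_add_cancel (D.hd1 i)]
  have h1 : (star (x ^ (D.d i) *ᵥ D.v i) ⬝ᵥ u) = 0 := by rw [D.hd0]; simp
  rw [dot_star_swap, D.x_pow_star, smul_mulVec, dotProduct_smul, smul_eq_mul, mul_eq_zero] at h1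
  rcases h1 with h | h
  · exact absurd h (pow_ne_zero _ (by simp))
  · rw [h, mul_zero]

theorem phi_ker (i : Fin D.r) (k : ℕ) (hk : k < D.d i) (u : Fin n → K) (hu : x ^ k *ᵥ u = 0) :
    D.phi i u = 0 := by
  rw [phi_apply, show D.d i - 1 = (D.d i - 1 - k) + k by omega, pow_add, ← mulVec_mulVec, hu]
  simp

theorem decomp (u : Fin n → K) : ∃ w, u = ∑ l, D.phi l u • D.v l + x *ᵥ w := by
  have hu : u ∈ Submodule.span K (Set.range fun p : Σ i, Fin (D.d i) => x ^ (p.2 : ℕ) *ᵥ D.v p.1) := by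
    rw [D.hspan]; trivial
  induction hu using Submodule.span_induction with
  | mem u h =>
    obtain ⟨⟨i, s, hs⟩, rfl⟩ := h
    rcases s with _ | s
    · refine ⟨0, ?_⟩
      simp [phi_v]
    · refine ⟨x ^ s *ᵥ D.v i, ?_⟩
      simp only [pow_succ', ← mulVec_mulVec, phi_x, zero_smul, Finset.sum_const_zero, zero_add]
  | zero => exact ⟨0, by simp⟩
  | add u v _ _ h1 h2 =>
    obtain ⟨w, hw⟩ := h1
    obtain ⟨w', hw'⟩ := h2
    refine ⟨w + w', ?_⟩
    simp only [map_add, add_smul, Finset.sum_add_distrib, mulVec_add]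
    conv_lhs => rw [hw, hw']
    abel
  | smul c u _ h =>
    obtain ⟨w, hw⟩ := h
    refine ⟨c • w, ?_⟩
    simp only [map_smul, smul_assoc, ← Finset.smul_sum, mulVec_smul]
    rw [← smul_add, ← hw]

/-- the matrix of `c` acting on `V / xV` -/
def T (c : Matrix (Fin n) (Fin n) K) : Matrix (Fin D.r) (Fin D.r) K := Matrix.of fun i j => D.phi i (c *ᵥ D.v j)

theorem T_apply (c : Matrix (Fin n) (Fin n) K) (i j) : D.T c i j = D.phi i (c *ᵥ D.v j) := rfl

theorem comm_pow {c : Matrix (Fin n) (Fin n) K} (hc : x * c = c * x) (k : ℕ) (u : Fin n → K) :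
    x ^ k *ᵥ (c *ᵥ u) = c *ᵥ (x ^ k *ᵥ u) := by
  rw [mulVec_mulVec, mulVec_mulVec]
  have : Commute x c := hc
  rw [(this.pow_left k).eq]

theorem T_tri (c : Matrix (Fin n) (Fin n) K) (hc : x * c = c * x) : (D.T c).BlockTriangular D.d := by
  intro i j hij
  refine D.phi_ker i _ hij _ ?_
  rw [comm_pow hc, D.hd0, mulVec_zero]

theorem T_mul (c c' : Matrix (Fin n) (Fin n) K) (hc : x * c = c * x) : D.T (c * c') = D.T c * D.T c' := by
  ext i j
  rw [Matrix.mul_apply]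
  simp only [T_apply]
  obtain ⟨w, hw⟩ := D.decomp (c' *ᵥ D.v j)
  rw [← mulVec_mulVec]
  conv_lhs => rw [hw]
  have h1 : c *ᵥ (x *ᵥ w) = x *ᵥ (c *ᵥ w) := by rw [mulVec_mulVec, mulVec_mulVec, hc]
  rw [mulVec_add, h1, map_add, phi_x, add_zero, ← Matrix.mulVecLin_apply, map_sum, map_sum]
  refine Finset.sum_congr rfl fun l _ => ?_
  rw [map_smul, map_smul, smul_eq_mul, mul_comm, Matrix.mulVecLin_apply]

theorem T_one : D.T 1 = 1 := by
  ext i j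
  rw [T_apply, one_mulVec, phi_v, Matrix.one_apply]

theorem T_pow (c : Matrix (Fin n) (Fin n) K) (hc : x * c = c * x) (s : ℕ) : D.T (c ^ s) = D.T c ^ s := by
  induction s with
  | zero => simp [T_one]
  | succ s ih => rw [pow_succ', D.T_mul _ _ hc, ih, pow_succ']

theorem T_add (c c' : Matrix (Fin n) (Fin n) K) : D.T (c + c') = D.T c + D.T c' := by
  ext i j
  simp [T_apply, add_mulVec]

theorem T_smul (a : K) (c : Matrix (Fin n) (Fin n) K) : D.T (a • c) = a • D.T c := by
  ext i j
  simp [T_apply, smul_mulVec]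

theorem T_star (c : Matrix (Fin n) (Fin n) K) (i j : Fin D.r) (hij : D.d i = D.d j) (hc : x * c = c * x) :
    D.T cᴴ i j = star (D.T c j i) := by
  simp only [T_apply, phi_apply, star_mul', star_inv₀, (D.heps _ (D.hd1 j)).2]
  have hc' : x * cᴴ = cᴴ * x := by
    have := congrArg conjTranspose hc
    rw [conjTranspose_mul, conjTranspose_mul, D.hx, Matrix.mul_neg, Matrix.neg_mul, neg_inj] at this
    exact this.symm
  rw [star_dot, dot_star_swap, dot_star_swap, D.x_pow_star, smul_mulVec, mulVec_smul, dotProduct_smul, ← comm_pow hc',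
    hij, smul_eq_mul, mul_inv]
  have : ((-1:K) ^ (D.d j - 1))⁻¹ * (-1:K) ^ (D.d j - 1) = 1 := inv_mul_cancel₀ (pow_ne_zero _ (by simp))
  rw [mul_comm ((-1:K) ^ (D.d j - 1))⁻¹, mul_assoc, ← mul_assoc ((-1:K) ^ (D.d j - 1))⁻¹, this, one_mul]

theorem T_nilp (c : Matrix (Fin n) (Fin n) K) (hc : x * c = c * x) : IsNilpotent (D.T c) ↔ IsNilpotent c := by
  constructor
  · rintro ⟨N, hN⟩
    rw [← D.T_pow _ hc] at hN
    have hcN : x * c ^ N = c ^ N * x := ((show Commute x c from hc).pow_right N).eq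
    have h1 : ∀ u, ∃ w, c ^ N *ᵥ u = x *ᵥ w := by
      intro u
      obtain ⟨w, hw⟩ := D.decomp u
      have h2 : ∀ l, ∃ w, c ^ N *ᵥ D.v l = x *ᵥ w := by
        intro l
        obtain ⟨w, hw⟩ := D.decomp (c ^ N *ᵥ D.v l)
        refine ⟨w, ?_⟩
        have : ∀ i, D.phi i (c ^ N *ᵥ D.v l) = 0 := fun i => by rw [← T_apply, hN]; rfl
        simpa [this] using hw
      choose w' hw' using h2
      refine ⟨∑ l, D.phi l u • w' l + c ^ N *ᵥ w, ?_⟩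
      conv_lhs => rw [hw]
      rw [mulVec_add, mulVec_add, mulVec_mulVec w, ← hcN, ← mulVec_mulVec, mulVec_sum, mulVec_sum]
      simp only [mulVec_smul, hw']
    have h3 : ∀ s : ℕ, ∀ u, ∃ w, (c ^ N) ^ s *ᵥ u = x ^ s *ᵥ w := by
      intro s
      induction s with
      | zero => intro u; exact ⟨u, by simp⟩
      | succ s ih =>
        intro u
        obtain ⟨w, hw⟩ := h1 u
        obtain ⟨w', hw'⟩ := ih w
        refine ⟨w', ?_⟩
        rw [pow_succ, ← mulVec_mulVec, hw, mulVec_mulVec,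
          ← ((show Commute x (c ^ N) from hcN).pow_right s).eq, ← mulVec_mulVec, hw', mulVec_mulVec, ← pow_succ']
    refine ⟨N * n, ?_⟩
    rw [pow_mul]
    apply Matrix.ext_of_mulVec_single
    intro i
    obtain ⟨w, hw⟩ := h3 n (Pi.single i 1)
    rw [hw, D.hnil, zero_mulVec, zero_mulVec]
  · rintro ⟨N, hN⟩
    refine ⟨N, ?_⟩
    rw [← D.T_pow _ hc, hN]
    ext i j
    simp [T_apply]

end NF
end struc


section struc2
variable {K : Type} [Field K] [Fintype K] [StarRing K] {q : ℕ}
namespace NF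
variable {n : ℕ} {x : Matrix (Fin n) (Fin n) K} (D : NF x)

/-- the Jordan basis -/
noncomputable def bas : Module.Basis (Σ i, Fin (D.d i)) K (Fin n → K) :=
  basisOfTopLeSpanOfCardEqFinrank (fun p : Σ i, Fin (D.d i) => x ^ (p.2 : ℕ) *ᵥ D.v p.1) D.hspan.ge
    (by simp [D.hsum])

theorem bas_apply (p) : D.bas p = x ^ (p.2 : ℕ) *ᵥ D.v p.1 := by
  simp [bas]

theorem extend (w : Fin D.r → (Fin n → K)) (hw : ∀ j, x ^ D.d j *ᵥ w j = 0) :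
    ∃ c : Matrix (Fin n) (Fin n) K, x * c = c * x ∧ ∀ j, c *ᵥ D.v j = w j := by
  set f := D.bas.constr K (fun p => x ^ (p.2 : ℕ) *ᵥ w p.1) with hf
  have hfb : ∀ (i : Fin D.r) (s : ℕ), f (x ^ s *ᵥ D.v i) = x ^ s *ᵥ w i := by
    intro i s
    by_cases h : s < D.d i
    · have := D.bas.constr_basis K (fun p => x ^ (p.2 : ℕ) *ᵥ w p.1) ⟨i, s, h⟩
      rw [bas_apply] at this
      exact this
    · rw [show s = (s - D.d i) + D.d i by omega, pow_add, ← mulVec_mulVec, ← mulVec_mulVec, hw, D.hd0]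
      simp
  have hcf : ∀ u, (LinearMap.toMatrix' f) *ᵥ u = f u := fun u => by
    rw [← toLin'_apply, toLin'_toMatrix']
  refine ⟨LinearMap.toMatrix' f, ?_, ?_⟩
  · apply Matrix.toLin'.injective
    refine D.bas.ext fun p => ?_
    rw [toLin'_apply, toLin'_apply, ← mulVec_mulVec, ← mulVec_mulVec, hcf, hcf, bas_apply, hfb, mulVec_mulVec,
      mulVec_mulVec, ← pow_succ', hfb]
  · intro j
    have := hfb j 0
    simp only [pow_zero, one_mulVec] at this
    rw [hcf, this]

theorem comm_ext (c c' : Matrix (Fin n) (Fin n) K) (hc : x * c = c * x) (hc' : x * c' = c' * x)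
    (h : ∀ j, c *ᵥ D.v j = c' *ᵥ D.v j) : c = c' := by
  apply Matrix.toLin'.injective
  refine D.bas.ext fun p => ?_
  rw [toLin'_apply, toLin'_apply, bas_apply, ← comm_pow hc, ← comm_pow hc', h]

theorem rank_x (k : ℕ) : (x ^ k).rank = ∑ i, (D.d i - k) := by
  have h1 : LinearMap.range (toLin' (x ^ k)) =
      Submodule.span K (Set.range fun p : {p : Σ i, Fin (D.d i) // k ≤ (p.2 : ℕ)} => D.bas p.1) := by
    apply le_antisymm
    · rw [LinearMap.range_eq_map, ← D.bas.span_eq, Submodule.map_span, Submodule.span_le]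
      rintro _ ⟨_, ⟨⟨i, s, hs⟩, rfl⟩, rfl⟩
      rw [toLin'_apply, bas_apply, mulVec_mulVec, ← pow_add]
      by_cases h : k + s < D.d i
      · apply Submodule.subset_span
        refine ⟨⟨⟨i, k + s, h⟩, by simp⟩, ?_⟩
        simp only [bas_apply]
      · simp only
        rw [show k + s = (k + s - D.d i) + D.d i by omega, pow_add, ← mulVec_mulVec, D.hd0]
        simp
    · rw [Submodule.span_le]
      rintro _ ⟨⟨⟨i, s, hs⟩, hk⟩, rfl⟩
      simp only at hk
      refine ⟨x ^ (s - k) *ᵥ D.v i, ?_⟩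
      simp only [bas_apply]
      rw [toLin'_apply, mulVec_mulVec, ← pow_add, Nat.add_sub_cancel' hk]
  unfold Matrix.rank
  change Module.finrank K (LinearMap.range (toLin' (x ^ k))) = _
  rw [h1]
  rw [show (fun p : {p : Σ i, Fin (D.d i) // k ≤ (p.2 : ℕ)} => D.bas p.1) = D.bas ∘ Subtype.val from rfl,
    finrank_span_eq_card (D.bas.linearIndependent.comp _ Subtype.val_injective)]
  rw [Fintype.card_congr (show {p : Σ i, Fin (D.d i) // k ≤ (p.2 : ℕ)} ≃ Σ i, Fin (D.d i - k) from
    ⟨fun p => ⟨p.1.1, ⟨p.1.2 - k, by have := p.1.2.2; have := p.2; omega⟩⟩,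
     fun p => ⟨⟨p.1, ⟨p.2 + k, by have := p.2.2; omega⟩⟩, by simp⟩,
     by rintro ⟨⟨i, s, hs⟩, h⟩; simp only at h; simp [Nat.sub_add_cancel h],
     by rintro ⟨i, s, hs⟩; simp⟩)]
  simp

theorem card_ker (hK : Fintype.card K = q ^ 2) (k : ℕ) :
    Nat.card {w : Fin n → K // x ^ k *ᵥ w = 0} = (q ^ 2) ^ (∑ i, min k (D.d i)) := by
  have h1 : Nat.card {w : Fin n → K // x ^ k *ᵥ w = 0} = Nat.card (LinearMap.ker (toLin' (x ^ k))) :=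
    Nat.card_congr (Equiv.subtypeEquivRight fun w => by rw [LinearMap.mem_ker, toLin'_apply])
  rw [h1, Module.natCard_eq_pow_finrank (K := K), Nat.card_eq_fintype_card, hK]
  congr 1
  have h2 := LinearMap.finrank_range_add_finrank_ker (toLin' (x ^ k))
  have h3 : Module.finrank K (LinearMap.range (toLin' (x ^ k))) = (x ^ k).rank := rfl
  rw [h3, D.rank_x, Module.finrank_fin_fun] at h2
  have h4 : ∑ i, (D.d i - k) + ∑ i, min k (D.d i) = n := by
    rw [← Finset.sum_add_distrib]
    conv_rhs => rw [← D.hsum]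
    exact Finset.sum_congr rfl fun i _ => by omega
  omega

theorem card_centralizer (hK : Fintype.card K = q ^ 2) :
    Nat.card {c : Matrix (Fin n) (Fin n) K // x * c = c * x} = (q ^ 2) ^ (∑ j, ∑ i, min (D.d j) (D.d i)) := by
  rw [← Finset.prod_pow_eq_pow_sum, ← Finset.prod_congr rfl fun j _ => D.card_ker hK (D.d j), ← Nat.card_pi]
  refine Nat.card_eq_of_bijective (fun c j => ⟨c.1 *ᵥ D.v j, by rw [comm_pow c.2, D.hd0, mulVec_zero]⟩) ⟨?_, ?_⟩
  · rintro ⟨c, hc⟩ ⟨c', hc'⟩ h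
    exact Subtype.ext (D.comm_ext c c' hc hc' fun j => congrArg Subtype.val (congrFun h j))
  · intro w
    obtain ⟨c, hc, h⟩ := D.extend (fun j => (w j).1) (fun j => (w j).2)
    exact ⟨⟨c, hc⟩, funext fun j => Subtype.ext (h j)⟩

theorem comm_star (D : NF x) {c : Matrix (Fin n) (Fin n) K} (hc : x * c = c * x) : x * cᴴ = cᴴ * x := by
  have := congrArg conjTranspose hc
  rw [conjTranspose_mul, conjTranspose_mul, D.hx, Matrix.mul_neg, Matrix.neg_mul, neg_inj] at this
  exact this.symm

variable (x) in
/-- skew-Hermitian part of the centralizer -/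
def skewCent : AddSubgroup (Matrix (Fin n) (Fin n) K) where
  carrier := {c | x * c = c * x ∧ cᴴ = -c}
  zero_mem' := by simp
  add_mem' := by
    rintro a b ⟨h1, h2⟩ ⟨h3, h4⟩
    exact ⟨by rw [mul_add, add_mul, h1, h3], by rw [conjTranspose_add, h2, h4, neg_add]⟩
  neg_mem' := by
    rintro a ⟨h1, h2⟩
    exact ⟨by rw [mul_neg, neg_mul, h1], by rw [conjTranspose_neg, h2]⟩

variable (K) in
/-- skew-Hermitian matrices -/
def skewGrp (α : Type) : AddSubgroup (Matrix α α K) where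
  carrier := {c | cᴴ = -c}
  zero_mem' := by simp
  add_mem' := by
    rintro a b h2 h4
    change (a + b)ᴴ = -(a+b)
    rw [conjTranspose_add, h2, h4, neg_add]
  neg_mem' := by
    rintro a h2
    change (-a)ᴴ = - -a
    rw [conjTranspose_neg, h2]

theorem card_skewCent (hK : Fintype.card K = q ^ 2) (hs : ∀ a : K, star a = a ^ q) :
    Nat.card (skewCent x) = q ^ (∑ j, ∑ i, min (D.d j) (D.d i)) := by
  let A : Submodule K (Matrix (Fin n) (Fin n) K) :=
    { carrier := {c | x * c = c * x}
      zero_mem' := by simp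
      add_mem' := by
        rintro a b (h1 : _ = _) (h3 : _ = _)
        change _ = _
        rw [mul_add, add_mul, h1, h3]
      smul_mem' := by
        rintro a b (h1 : _ = _)
        change _ = _
        rw [Matrix.mul_smul, Matrix.smul_mul, h1] }
  exact card_skew hK hs A (fun a ha => D.comm_star ha) _ (D.card_centralizer hK)

theorem d_lt (i : Fin D.r) : D.d i < n + 1 := by
  have := Finset.single_le_sum (f := D.d) (fun i _ => Nat.zero_le _) (Finset.mem_univ i)
  rw [D.hsum] at this
  omega

/-- block index -/
def b (i : Fin D.r) : Fin (n+1) := ⟨D.d i, D.d_lt i⟩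

/-- the reduction map to the blocks -/
def red : skewCent x →+ (∀ k : Fin (n+1), skewGrp K {i // D.b i = k}) where
  toFun c k := ⟨(D.T c.1).toSquareBlock D.b k, by
    ext i j
    have hij : D.d i.1 = D.d j.1 := by
      have := i.2.trans j.2.symm
      exact congrArg Fin.val this
    have h1 := D.T_star c.1 i.1 j.1 hij c.2.1
    have h2 : c.1ᴴ = -c.1 := c.2.2
    rw [h2] at h1
    have h3 : D.T (-c.1) = - D.T c.1 := by
      rw [← neg_one_smul K, T_smul, neg_one_smul]
    rw [h3] at h1
    exact h1.symm⟩
  map_zero' := by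
    funext k
    ext i j
    simp [T_apply, toSquareBlock_def]
  map_add' c c' := by
    funext k
    apply Subtype.ext
    change (D.T (c.1 + c'.1)).toSquareBlock D.b k = (D.T c.1).toSquareBlock D.b k + (D.T c'.1).toSquareBlock D.b k
    rw [T_add]
    rfl

theorem red_apply (c : skewCent x) (k) : (D.red c k).1 = (D.T c.1).toSquareBlock D.b k := rfl

theorem red_nilp (c : skewCent x) : (∀ k, IsNilpotent (D.red c k).1) ↔ IsNilpotent c.1 := by
  rw [← D.T_nilp c.1 c.2.1]
  exact (nilp_blocks (D.T c.1) D.b (fun i j hij => D.T_tri c.1 c.2.1 hij)).symm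

theorem red_surj (hK : Fintype.card K = q ^ 2) (hs : ∀ a : K, star a = a ^ q) : Function.Surjective D.red := by
  intro B
  set Bm : Matrix (Fin D.r) (Fin D.r) K := Matrix.of fun i j =>
    if h : D.b i = D.b j then (B (D.b j)).1 ⟨i, h⟩ ⟨j, rfl⟩ else 0 with hBm
  have hBk : ∀ k, Bm.toSquareBlock D.b k = (B k).1 := by
    intro k
    ext ⟨i, hi⟩ ⟨j, hj⟩
    subst hj
    simp [toSquareBlock_def, hBm, hi]
  obtain ⟨c, hc, hcv⟩ := D.extend (fun j => ∑ l, Bm l j • D.v l) (by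
    intro j
    rw [mulVec_sum]
    refine Finset.sum_eq_zero fun l _ => ?_
    rw [mulVec_smul]
    by_cases h : D.b l = D.b j
    · have : D.d l = D.d j := congrArg Fin.val h
      rw [← this, D.hd0, smul_zero]
    · simp [hBm, h])
  have hT : D.T c = Bm := by
    ext i j
    rw [T_apply, hcv, map_sum]
    simp [phi_v]
  obtain ⟨t, ht⟩ := exists_not_fixed hK hs
  have ht' : t - star t ≠ 0 := sub_ne_zero.2 ht.symm
  set θ := t / (t - star t) with hθ
  have hθ1 : θ + star θ = 1 := by
    rw [hθ, star_div₀, star_sub, star_star, ← neg_sub t (star t), div_neg, ← sub_eq_add_neg, ← sub_div, div_self ht']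
  have hc2 := D.comm_star hc
  refine ⟨⟨θ • c - (θ • c)ᴴ, ?_, ?_⟩, ?_⟩
  · rw [conjTranspose_smul, mul_sub, sub_mul, Matrix.mul_smul, Matrix.smul_mul, Matrix.mul_smul, Matrix.smul_mul, hc, hc2]
  · rw [conjTranspose_sub, conjTranspose_conjTranspose, neg_sub]
  · funext k
    apply Subtype.ext
    rw [red_apply]
    ext i j
    have hij : D.d i.1 = D.d j.1 := congrArg Fin.val (i.2.trans j.2.symm)
    have hB : ∀ i j, (B k).1 i j = D.T c i.1 j.1 := by
      intro i j; rw [hT, ← hBk]; rfl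
    have hBs : star ((B k).1 j i) = - (B k).1 i j := congrFun (congrFun (show (B k).1ᴴ = - (B k).1 from (B k).2) i) j
    change D.T (θ • c - (θ • c)ᴴ) i.1 j.1 = _
    rw [conjTranspose_smul, sub_eq_add_neg, ← neg_smul, T_add, T_smul, T_smul, Matrix.add_apply, Matrix.smul_apply,
      Matrix.smul_apply, D.T_star c _ _ hij hc, ← hB, ← hB, hBs, smul_eq_mul, smul_eq_mul]
    linear_combination (B k).1 i j * hθ1

end NF

theorem preimage_count {G H : Type} [AddGroup G] [AddGroup H] [Finite G] [Finite H] (f : G →+ H)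
    (hf : Function.Surjective f) (S : H → Prop) :
    Nat.card {g // S (f g)} * Nat.card H = Nat.card {h // S h} * Nat.card G := by
  have hfib : ∀ h, Nat.card {g // f g = h} = Nat.card f.ker := by
    intro h
    obtain ⟨g0, rfl⟩ := hf h
    refine Nat.card_congr ⟨fun g => ⟨-g0 + g.1, by rw [AddMonoidHom.mem_ker, map_add, map_neg, g.2, neg_add_cancel]⟩,
      fun g => ⟨g0 + g.1, by rw [map_add, AddMonoidHom.mem_ker.1 g.2, add_zero]⟩, ?_, ?_⟩
    · rintro ⟨g, hg⟩; simp
    · rintro ⟨g, hg⟩; simp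
  rw [card_fiber_const f _ hfib]
  rw [card_fiber_const (fun g : {g // S (f g)} => (⟨f g.1, g.2⟩ : {h // S h})) (Nat.card f.ker)]
  · ring
  · rintro ⟨h, hh⟩
    rw [← hfib h]
    refine Nat.card_congr ⟨fun g => ⟨g.1.1, congrArg Subtype.val g.2⟩, fun g => ⟨⟨g.1, by rw [g.2]; exact hh⟩, Subtype.ext g.2⟩, ?_, ?_⟩
    · rintro ⟨⟨g, hg⟩, hg2⟩; rfl
    · rintro ⟨g, hg⟩; rfl

namespace NF
variable {n : ℕ} {x : Matrix (Fin n) (Fin n) K} (D : NF x)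

theorem main_count (hK : Fintype.card K = q ^ 2) (hs : ∀ a : K, star a = a ^ q) :
    Nat.card {c : skewCent x // IsNilpotent c.1} * q ^ D.r = q ^ (∑ j, ∑ i, min (D.d j) (D.d i)) := by
  have h1 := preimage_count D.red (D.red_surj hK hs) (fun B => ∀ k, IsNilpotent (B k).1)
  rw [D.card_skewCent hK hs] at h1
  simp only [D.red_nilp] at h1
  have hH : Nat.card (∀ k : Fin (n+1), skewGrp K {i // D.b i = k}) =
      ∏ k : Fin (n+1), q ^ (Fintype.card {i // D.b i = k} ^ 2) := by
    rw [Nat.card_pi]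
    exact Finset.prod_congr rfl fun k _ => card_skew_univ hK hs _
  have hN : Nat.card {B : (∀ k : Fin (n+1), skewGrp K {i // D.b i = k}) // ∀ k, IsNilpotent (B k).1} =
      ∏ k : Fin (n+1), cN K {i // D.b i = k} := by
    unfold cN
    rw [← Nat.card_pi]
    refine Nat.card_congr ⟨fun B k => ⟨(B.1 k).1, (B.1 k).2, B.2 k⟩, fun B => ⟨fun k => ⟨(B k).1, (B k).2.1⟩, fun k => (B k).2.2⟩, ?_, ?_⟩
    · intro B; rfl
    · intro B; rfl
  have hr : ∏ k : Fin (n+1), q ^ (Fintype.card {i // D.b i = k}) = q ^ D.r := by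
    rw [Finset.prod_pow_eq_pow_sum, ← Fintype.card_sigma, Fintype.card_congr (Equiv.sigmaFiberEquiv D.b), Fintype.card_fin]
  have hHN : Nat.card {B : (∀ k : Fin (n+1), skewGrp K {i // D.b i = k}) // ∀ k, IsNilpotent (B k).1} * q ^ D.r =
      Nat.card (∀ k : Fin (n+1), skewGrp K {i // D.b i = k}) := by
    rw [hH, hN, ← hr, ← Finset.prod_mul_distrib]
    exact Finset.prod_congr rfl fun k _ => cN_eq hK hs _
  have hpos : 0 < Nat.card (∀ k : Fin (n+1), skewGrp K {i // D.b i = k}) := Nat.card_pos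
  apply Nat.eq_of_mul_eq_mul_left hpos
  rw [← mul_assoc, mul_comm (Nat.card (∀ k : Fin (n+1), skewGrp K {i // D.b i = k})), h1]
  conv_rhs => rw [← hHN]
  ring

end NF
end struc2


theorem mset_min_succ (M : Multiset ℕ) (k : ℕ) :
    (M.map (fun p => min (k+1) p)).sum = (M.map (fun p => min k p)).sum + Multiset.card (M.filter (fun p => k + 1 ≤ p)) := by
  induction M using Multiset.induction_on with
  | empty => simp
  | cons a M ih =>
    rw [Multiset.map_cons, Multiset.map_cons, Multiset.sum_cons, Multiset.sum_cons, ih]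
    by_cases h : k + 1 ≤ a
    · rw [Multiset.filter_cons_of_pos (p := fun p => k + 1 ≤ p) _ h, Multiset.card_cons]; omega
    · rw [Multiset.filter_cons_of_neg (p := fun p => k + 1 ≤ p) _ h]; omega

theorem mset_count_succ (M : Multiset ℕ) (k : ℕ) :
    Multiset.card (M.filter (fun p => k + 1 ≤ p)) = Multiset.count (k+1) M + Multiset.card (M.filter (fun p => k + 1 + 1 ≤ p)) := by
  induction M using Multiset.induction_on with
  | empty => simp
  | cons a M ih =>
    rw [Multiset.count_cons]
    rcases lt_trichotomy (k+1) a with h | h | h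
    · rw [Multiset.filter_cons_of_pos (p := fun p => k + 1 ≤ p) _ (by omega),
        Multiset.filter_cons_of_pos (p := fun p => k + 1 + 1 ≤ p) _ (by omega), Multiset.card_cons, Multiset.card_cons,
        if_neg (by omega)]; omega
    · rw [Multiset.filter_cons_of_pos (p := fun p => k + 1 ≤ p) _ (by omega),
        Multiset.filter_cons_of_neg (p := fun p => k + 1 + 1 ≤ p) _ (by omega), Multiset.card_cons,
        if_pos (by omega)]; omega
    · rw [Multiset.filter_cons_of_neg (p := fun p => k + 1 ≤ p) _ (by omega),
        Multiset.filter_cons_of_neg (p := fun p => k + 1 + 1 ≤ p) _ (by omega),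
        if_neg (by omega)]; omega

theorem mset_count_sum (M : Multiset ℕ) (n : ℕ) :
    ∑ i ∈ Finset.range n, Multiset.count (i+1) M + Multiset.card (M.filter (fun p => n + 1 ≤ p)) =
      Multiset.card (M.filter (fun p => 0 + 1 ≤ p)) := by
  induction n with
  | zero => simp
  | succ n ih => rw [Finset.sum_range_succ, ← ih, mset_count_succ M n]; ring

theorem min_sum_sq {r n : ℕ} (d : Fin r → ℕ) (hd : ∀ i, d i ≤ n) :
    ∑ j, ∑ i, min (d j) (d i) = ∑ k ∈ Finset.range n, (Finset.univ.filter (fun i => k + 1 ≤ d i)).card ^ 2 := by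
  have h1 : ∀ j i, min (d j) (d i) = ∑ k ∈ Finset.range n, (if k + 1 ≤ d j then 1 else 0) * (if k + 1 ≤ d i then 1 else 0) := by
    intro j i
    have : ∀ k, ((if k + 1 ≤ d j then 1 else 0) * (if k + 1 ≤ d i then 1 else 0) : ℕ) = if k < min (d j) (d i) then 1 else 0 := by
      intro k
      split_ifs <;> omega
    simp only [this]
    rw [← Finset.sum_filter, Finset.sum_const, smul_eq_mul, mul_one]
    have : Finset.filter (fun k => k < min (d j) (d i)) (Finset.range n) = Finset.range (min (d j) (d i)) := by
      ext k
      have := hd i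
      simp only [Finset.mem_filter, Finset.mem_range]
      omega
    rw [this, Finset.card_range]
  simp only [h1]
  have h2 : ∀ j, ∑ i, ∑ k ∈ Finset.range n, ((if k + 1 ≤ d j then 1 else 0) * (if k + 1 ≤ d i then 1 else 0) : ℕ) =
      ∑ k ∈ Finset.range n, ∑ i, ((if k + 1 ≤ d j then 1 else 0) * (if k + 1 ≤ d i then 1 else 0) : ℕ) :=
    fun j => Finset.sum_comm
  simp only [h2]
  rw [Finset.sum_comm]
  refine Finset.sum_congr rfl fun k _ => ?_
  rw [sq, Finset.card_filter, Finset.sum_mul_sum]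

theorem card_nilpotent_centralizer_unitary
    (q : ℕ) (hq : ∃ p m : ℕ, p.Prime ∧ 0 < m ∧ q = p ^ m)
    (K : Type) [Field K] [Fintype K] (hK : Fintype.card K = q ^ 2)
    (n : ℕ) (hn : 1 ≤ n) (lam : Nat.Partition n)
    (x : Matrix (Fin n) (Fin n) K)
    (hx : (x.map (fun a => a ^ q))ᵀ = -x)
    (hnil : x ^ n = 0)
    (htype : ∀ k : ℕ, 1 ≤ k →
      (n : ℤ) - Matrix.rank (x ^ k) = (lam.parts.map (fun p => min k p)).sum) :
    Nat.card {y : Matrix (Fin n) (Fin n) K //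
        (y.map (fun a => a ^ q))ᵀ = -y ∧ IsNilpotent y ∧ x * y = y * x} =
      q ^ ((∑ k ∈ Finset.range n,
          (Multiset.card (lam.parts.filter (fun p => k + 1 ≤ p))) ^ 2) -
        ∑ i ∈ Finset.range n, Multiset.count (i + 1) lam.parts) := by
  obtain ⟨S, hs⟩ := exists_starRing q hq K hK
  have hstar : ∀ y : Matrix (Fin n) (Fin n) K, (y.map (fun a => a ^ q))ᵀ = yᴴ := by
    intro y
    ext i j
    exact (hs (y j i)).symm
  rw [hstar] at hx
  simp only [hstar]
  obtain ⟨D⟩ := exists_NF hK hs x hx hnil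
  have hmain := D.main_count hK hs
  have hq2 := two_le_q hK
  have h1 : Nat.card {y : Matrix (Fin n) (Fin n) K // yᴴ = -y ∧ IsNilpotent y ∧ x * y = y * x} =
      Nat.card {c : NF.skewCent x // IsNilpotent c.1} :=
    Nat.card_congr ⟨fun y => ⟨⟨y.1, y.2.2.2, y.2.1⟩, y.2.2.1⟩, fun c => ⟨c.1.1, c.1.2.2, c.2, c.1.2.1⟩,
      fun _ => rfl, fun _ => rfl⟩
  rw [h1]
  have hmin : ∀ k : ℕ, (lam.parts.map (fun p => min k p)).sum = ((Finset.univ.val.map D.d).map (fun p => min k p)).sum := by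
    intro k
    rcases Nat.eq_zero_or_pos k with rfl | hk
    · simp only [Nat.zero_min, Multiset.map_const', Multiset.sum_replicate, smul_zero]
    · have h2 := htype k hk
      rw [D.rank_x] at h2
      have h4 : ∑ i, (D.d i - k) + ∑ i, min k (D.d i) = n := by
        rw [← Finset.sum_add_distrib]
        conv_rhs => rw [← D.hsum]
        exact Finset.sum_congr rfl fun i _ => by omega
      have h5 : ((Finset.univ.val.map D.d).map (fun p => min k p)).sum = ∑ i, min k (D.d i) := by
        rw [Multiset.map_map]; rfl
      rw [h5]
      omega
  have hg : ∀ k : ℕ, Multiset.card (lam.parts.filter (fun p => k + 1 ≤ p)) =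
      (Finset.univ.filter (fun i => k + 1 ≤ D.d i)).card := by
    intro k
    have e1 := mset_min_succ lam.parts k
    have e2 := mset_min_succ (Finset.univ.val.map D.d) k
    have e3 : Multiset.card ((Finset.univ.val.map D.d).filter (fun p => k + 1 ≤ p)) =
        (Finset.univ.filter (fun i => k + 1 ≤ D.d i)).card := by
      rw [Multiset.filter_map, Multiset.card_map]; rfl
    rw [hmin, hmin] at e1
    rw [e1] at e2
    rw [← e3]
    omega
  have hd : ∀ i, D.d i ≤ n := fun i => Nat.lt_succ_iff.1 (D.d_lt i)
  have hcount : ∑ i ∈ Finset.range n, Multiset.count (i + 1) lam.parts = D.r := by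
    have := mset_count_sum lam.parts n
    rw [hg, hg] at this
    rw [Finset.filter_false_of_mem (fun i _ => by have := hd i; omega),
      Finset.filter_true_of_mem (fun i _ => by have := D.hd1 i; omega)] at this
    simpa using this
  rw [hcount]
  simp only [hg]
  rw [← min_sum_sq D.d hd]
  have hle : D.r ≤ ∑ j, ∑ i, min (D.d j) (D.d i) := by
    calc D.r = ∑ j : Fin D.r, 1 := by simp
      _ ≤ ∑ j, ∑ i, min (D.d j) (D.d i) := Finset.sum_le_sum fun j _ => by
        have h1 := Finset.single_le_sum (f := fun i => min (D.d j) (D.d i)) (fun i _ => Nat.zero_le _) (Finset.mem_univ j)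
        have := D.hd1 j
        simp only [min_self] at h1
        omega
  have hpos : 0 < q ^ D.r := by positivity
  apply Nat.eq_of_mul_eq_mul_right hpos
  rw [hmain, ← pow_add, Nat.sub_add_cancel hle]
end
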